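/- Fix b₀ > 0, θ₀ = arctan b₀, and α, δ, δ₀ ∈ (0, 1). Let Q = {y ∈ ℝ³ : y₁ > 0, y₃ > b₀y₁} and for L ≥ 4 let Q_L = Q ∩ {r < L} where r = √(y₁² + y₃²). Let f ∈ H^{(1−δ,2−δ₀)}_{4,α}(Q) be 2π-periodic in y₂, let f_L be its restriction to Q_L, set c_L = (1/(2πL(π/2 − θ₀)))·∫_{Q_L ∩ {0<y₂<2π}} f_L dy, and let v_L be the unique solution of the cut-off problem: Δv_L = f_L in Q_L; vanishing normal derivative on the faces {y₃ = b₀y₁} and {y₁ = 0} (for r < L); ∂_r v_L = c_L on {r = L}; 2π-periodicity in y₂; and v_L → 0 at the point (0,0,0). Then ‖v_L‖^{(0,−δ₀)}_{6,α;Q_{L/2}} ≤ C·‖f_L‖^{(1−δ,2−δ₀)}_{4,α;Q_L}, where C depends only on b₀, α, δ, δ₀ and not on L or f. -/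

import Mathlib

noncomputable section

open Real Set Filter MeasureTheory Topology

/-- Points of `ℝ³` (Euclidean). -/
abbrev V3 : Type := EuclideanSpace ℝ (Fin 3)

/-- `r_x = √(x₁² + x₃²)`, the distance of `x` to the `x₂`-axis. -/
def rx (x : V3) : ℝ := Real.sqrt (x 0 ^ 2 + x 2 ^ 2)

/-- The edge `{x₁ = x₃ = 0}` (the `x₂`-axis). -/
def edge : Set V3 := {x : V3 | x 0 = 0 ∧ x 2 = 0}

/-- The infinite wedge `Q = {y₁ > 0, y₃ > b₀y₁}`. -/
def wedgeQ (b₀ : ℝ) : Set V3 := {y : V3 | 0 < y 0 ∧ b₀ * y 0 < y 2}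

/-- The truncated wedge `Q_L = Q ∩ {r < L}`. -/
def wedgeQL (b₀ L : ℝ) : Set V3 := {y ∈ wedgeQ b₀ | rx y < L}

/-- `Q̄ ∖ edge`, the natural regularity set for functions on the wedge. -/
def SQ (b₀ : ℝ) : Set V3 := closure (wedgeQ b₀) \ edge

/-- `Q̄_L ∖ edge`. -/
def SL (b₀ L : ℝ) : Set V3 := closure (wedgeQL b₀ L) \ edge

/-- Partial derivative within `S` in the `i`-th coordinate direction. -/
def pdW (S : Set V3) (i : Fin 3) (u : V3 → ℝ) (x : V3) : ℝ :=
  fderivWithin ℝ u S x (EuclideanSpace.single i 1)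

/-- Laplacian of `u` at `x` (derivatives taken within `S`). -/
def lapW (S : Set V3) (u : V3 → ℝ) (x : V3) : ℝ :=
  ∑ i : Fin 3, pdW S i (pdW S i u) x

/-- `2π`-periodicity in `y₂`, on the set `D`. -/
def Per2On (D : Set V3) (u : V3 → ℝ) : Prop :=
  ∀ y ∈ D, u (y + EuclideanSpace.single 1 (2 * Real.pi)) = u y

/-- All weighted sup quantities entering `Σ_{j≤m}[u]^{(k,l)}_{j,0;D}` are `≤ M`
(derivatives taken within `S`). -/
def wsupLE (S : Set V3) (m : ℕ) (k l : ℝ) (D : Set V3) (u : V3 → ℝ) (M : ℝ) : Prop :=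
  (∀ j : ℕ, j ≤ m → ∀ x ∈ D, 0 < rx x → rx x < 1 →
      rx x ^ max (k + j) 0 * ‖iteratedFDerivWithin ℝ j u S x‖ ≤ M) ∧
  (∀ j : ℕ, j ≤ m → ∀ x ∈ D, 1 < rx x →
      rx x ^ (l + j) * ‖iteratedFDerivWithin ℝ j u S x‖ ≤ M)

/-- All quantities entering the weighted Hölder norm `‖u‖^{(k,l)}_{m,α;D}` are `≤ M`
(derivatives taken within `S`). -/
def wnormLE (S : Set V3) (m : ℕ) (α k l : ℝ) (D : Set V3) (u : V3 → ℝ) (M : ℝ) : Prop :=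
  wsupLE S m k l D u M ∧
  (∀ x ∈ D, ∀ y ∈ D, 0 < min (rx x) (rx y) → min (rx x) (rx y) < 1 →
      min (rx x) (rx y) ^ max (k + m + α) 0 *
        ‖iteratedFDerivWithin ℝ m u S x - iteratedFDerivWithin ℝ m u S y‖ ≤
        M * ‖x - y‖ ^ α) ∧
  (∀ x ∈ D, ∀ y ∈ D, 1 < min (rx x) (rx y) →
      min (rx x) (rx y) ^ (l + m + α) *
        ‖iteratedFDerivWithin ℝ m u S x - iteratedFDerivWithin ℝ m u S y‖ ≤
        M * ‖x - y‖ ^ α)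

/-- Membership in the weighted Hölder space `H^{(k,l)}_{m,α}(D)`. -/
def memH (S : Set V3) (m : ℕ) (α k l : ℝ) (D : Set V3) (u : V3 → ℝ) : Prop :=
  ContDiffOn ℝ m u S ∧ ∃ M : ℝ, 0 ≤ M ∧ wnormLE S m α k l D u M

/-- The constant `c_L` ensuring solvability of the cut-off Neumann problem (4.6). -/
def cutoffConst (b₀ L : ℝ) (f : V3 → ℝ) : ℝ :=
  (2 * Real.pi * L * (Real.pi / 2 - Real.arctan b₀))⁻¹ *
    ∫ y in {y ∈ wedgeQL b₀ L | 0 < y 1 ∧ y 1 < 2 * Real.pi}, f y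

/-- `v` solves the cut-off problem (4.4) on `Q_L` with right-hand side `f`:
`Δv = f` in `Q_L`, vanishing normal derivatives on the lateral faces `{y₃ = b₀y₁}` and
`{y₁ = 0}`, radial derivative `c_L` on `{r = L}`, `2π`-periodicity in `y₂`, and `v → 0`
at the point `(0,0,0)`. -/
def IsCutoffSolution (b₀ L : ℝ) (f v : V3 → ℝ) : Prop :=
  ContDiffOn ℝ 2 v (SL b₀ L) ∧
  (∀ y ∈ wedgeQL b₀ L, lapW (SL b₀ L) v y = f y) ∧
  (∀ y ∈ SL b₀ L, y 2 = b₀ * y 0 → rx y < L →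
      b₀ * pdW (SL b₀ L) 0 v y - pdW (SL b₀ L) 2 v y = 0) ∧
  (∀ y ∈ SL b₀ L, y 0 = 0 → rx y < L → pdW (SL b₀ L) 0 v y = 0) ∧
  (∀ y ∈ SL b₀ L, rx y = L →
      y 0 / L * pdW (SL b₀ L) 0 v y + y 2 / L * pdW (SL b₀ L) 2 v y = cutoffConst b₀ L f) ∧
  Per2On (closure (wedgeQL b₀ L)) v ∧
  Tendsto v (𝓝[SL b₀ L] (0 : V3)) (𝓝 0)


/-! ### One-variable calculus -/

lemma half_second_diff {g g' : ℝ → ℝ} {d δ : ℝ} (hδ : 0 < δ)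
    (h1 : ∀ t ∈ Ico (0:ℝ) δ, HasDerivWithinAt g (g' t) (Ici t) t)
    (hc : ContinuousOn g (Ico 0 δ))
    (h0 : g' 0 = 0) (h2 : HasDerivWithinAt g' d (Ici 0) 0) :
    Tendsto (fun t => (g t - g 0) / t ^ 2) (𝓝[>] 0) (𝓝 (d / 2)) := by
  rw [hasDerivWithinAt_iff_isLittleO] at h2
  rw [Metric.tendsto_nhdsWithin_nhds]
  intro ε hε
  have h3 := h2.def (c := ε / 2) (by positivity)
  rw [eventually_nhdsWithin_iff, Metric.eventually_nhds_iff] at h3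
  obtain ⟨η, hη, h3⟩ := h3
  refine ⟨min η δ, lt_min hη hδ, ?_⟩
  intro t ht0 ht
  have ht0 : 0 < t := ht0
  rw [Real.dist_eq, sub_zero, abs_of_pos ht0] at ht
  have htη : t < η := lt_of_lt_of_le ht (min_le_left _ _)
  have htδ : t < δ := lt_of_lt_of_le ht (min_le_right _ _)
  have key : ‖(g t - d / 2 * t ^ 2) - g 0‖ ≤ ε / 2 * t * (t - 0) := by
    have := norm_image_sub_le_of_norm_deriv_right_le_segment (a := 0) (b := t)
      (f := fun x => g x - d / 2 * x ^ 2) (f' := fun x => g' x - d * x) (C := ε / 2 * t)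
      (by
        refine ContinuousOn.sub (hc.mono ?_) (by fun_prop)
        intro x hx; exact ⟨hx.1, lt_of_le_of_lt hx.2 htδ⟩)
      (by
        intro x hx
        have hx1 := h1 x ⟨hx.1, lt_trans hx.2 htδ⟩
        have : HasDerivAt (fun x : ℝ => d / 2 * x ^ 2) (d * x) x := by
          have := (hasDerivAt_pow 2 x).const_mul (d / 2)
          exact this.congr_deriv (by push_cast; ring)
        exact hx1.sub this.hasDerivWithinAt)
      (by
        intro x hx
        have := h3 (y := x) (by rw [Real.dist_eq, sub_zero, abs_of_nonneg hx.1]; linarith [hx.2]) hx.1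
        simp only [h0, sub_zero, smul_eq_mul, Real.norm_eq_abs] at this
        rw [Real.norm_eq_abs]
        rw [mul_comm d x]
        refine this.trans ?_
        rw [abs_of_nonneg hx.1]
        have := hx.2
        gcongr) t ⟨ht0.le, le_rfl⟩
    simpa using this
  rw [Real.dist_eq]
  have e1 : (g t - g 0) / t ^ 2 - d / 2 = ((g t - d / 2 * t ^ 2) - g 0) / t ^ 2 := by
    field_simp
    ring
  rw [e1, abs_div, abs_of_pos (by positivity : (0:ℝ) < t ^ 2), div_lt_iff₀ (by positivity)]
  rw [Real.norm_eq_abs] at key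
  have : 0 < t ^ 2 := by positivity
  nlinarith

/-- second-order necessary condition at a right-sided maximum with zero derivative -/
lemma second_le_of_max_right {g g' : ℝ → ℝ} {d p b : ℝ} (hb : p < b)
    (h1 : ∀ t ∈ Ico p b, HasDerivWithinAt g (g' t) (Icc p b) t)
    (h0 : g' p = 0) (h2 : HasDerivWithinAt g' d (Icc p b) p)
    (hmax : ∀ t ∈ Icc p b, g t ≤ g p) : d ≤ 0 := by
  have hmem : ∀ t ∈ Ico p b, Icc p b ∈ 𝓝[≥] t := by
    intro t ht
    exact mem_of_superset (Icc_mem_nhdsGE ht.2) (Icc_subset_Icc_left ht.1)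
  have h1' : ∀ t ∈ Ico (0:ℝ) (b - p), HasDerivWithinAt (fun t => g (p + t)) (g' (p + t)) (Ici t) t := by
    intro t ht
    have htt : p + t ∈ Ico p b := ⟨by linarith [ht.1], by linarith [ht.2]⟩
    have := (h1 (p + t) htt).mono_of_mem_nhdsWithin (hmem _ htt)
    have h3 : HasDerivWithinAt (fun t : ℝ => p + t) 1 (Ici t) t :=
      ((hasDerivAt_id t).const_add p).hasDerivWithinAt
    have := HasDerivWithinAt.comp t this h3 (fun x hx => by simpa using hx)
    simpa [Function.comp_def] using this
  have h2' : HasDerivWithinAt (fun t => g' (p + t)) d (Ici 0) 0 := by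
    have h4 := h2.mono_of_mem_nhdsWithin (hmem p ⟨le_rfl, hb⟩)
    have h3 : HasDerivWithinAt (fun t : ℝ => p + t) 1 (Ici 0) 0 :=
      ((hasDerivAt_id (0:ℝ)).const_add p).hasDerivWithinAt
    have h4 : HasDerivWithinAt g' d (Ici p) (p + 0) := by simpa using h4
    have := HasDerivWithinAt.comp (0:ℝ) h4 h3 (fun x hx => by simpa using hx)
    simpa [Function.comp_def] using this
  have hc : ContinuousOn (fun t => g (p + t)) (Ico 0 (b - p)) := by
    have : ContinuousOn g (Ico p b) := fun t ht => ((h1 t ht).continuousWithinAt).mono Ico_subset_Icc_self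
    refine this.comp (by fun_prop) ?_
    intro t ht
    exact ⟨by linarith [ht.1], by linarith [ht.2]⟩
  have := half_second_diff (sub_pos.2 hb) h1' hc (by simpa using h0) h2'
  have h5 : d / 2 ≤ 0 := by
    refine le_of_tendsto this ?_
    have : Ioo (0:ℝ) (b - p) ∈ 𝓝[>] (0:ℝ) := Ioo_mem_nhdsGT (sub_pos.2 hb)
    filter_upwards [this] with t ht
    have := hmax (p + t) ⟨by linarith [ht.1], by linarith [ht.2]⟩
    refine div_nonpos_of_nonpos_of_nonneg ?_ (by positivity)
    simp; linarith
  linarith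

lemma second_le_of_max_left {g g' : ℝ → ℝ} {d p a : ℝ} (ha : a < p)
    (h1 : ∀ t ∈ Ioc a p, HasDerivWithinAt g (g' t) (Icc a p) t)
    (h0 : g' p = 0) (h2 : HasDerivWithinAt g' d (Icc a p) p)
    (hmax : ∀ t ∈ Icc a p, g t ≤ g p) : d ≤ 0 := by
  have neg : ∀ t, HasDerivWithinAt (fun t : ℝ => -t) (-1) (Icc (-p) (-a)) t := fun t =>
    (hasDerivAt_neg t).hasDerivWithinAt
  have mt : MapsTo (fun t : ℝ => -t) (Icc (-p) (-a)) (Icc a p) := by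
    intro x hx; constructor <;> [have := hx.2; have := hx.1] <;> simp only <;> linarith
  refine second_le_of_max_right (g := fun t => g (-t)) (g' := fun t => - g' (-t)) (d := d) (p := -p) (b := -a)
    (by linarith) ?_ (by simpa using h0) ?_ ?_
  · intro t ht
    have := HasDerivWithinAt.comp t (h1 (-t) ⟨by linarith [ht.2], by linarith [ht.1]⟩) (neg t) mt
    simpa [Function.comp_def] using this
  · have h2' : HasDerivWithinAt g' d (Icc a p) (- (-p)) := by simpa using h2
    have := (HasDerivWithinAt.comp (-p) h2' (neg (-p)) mt).neg
    exact this.congr_deriv (by ring)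
  · intro t ht
    have := hmax (-t) (mt ht)
    simpa using this

/-- first order condition at a maximum on an interval, right side -/
lemma deriv_le_of_max_right {g : ℝ → ℝ} {d p b : ℝ} (hb : p < b)
    (h : HasDerivWithinAt g d (Icc p b) p) (hmax : ∀ t ∈ Icc p b, g t ≤ g p) : d ≤ 0 := by
  have h := (h.mono Ioc_subset_Icc_self)
  rw [hasDerivWithinAt_iff_tendsto_slope' (by simp)] at h
  have : (𝓝[Ioc p b] p).NeBot := by
    rw [nhdsWithin_Ioc_eq_nhdsGT hb]; infer_instance
  refine le_of_tendsto h ?_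
  filter_upwards [self_mem_nhdsWithin] with t ht
  rw [slope_def_field]
  exact div_nonpos_of_nonpos_of_nonneg (by linarith [hmax t ⟨ht.1.le, ht.2⟩]) (by linarith [ht.1])

lemma deriv_ge_of_max_left {g : ℝ → ℝ} {d p a : ℝ} (ha : a < p)
    (h : HasDerivWithinAt g d (Icc a p) p) (hmax : ∀ t ∈ Icc a p, g t ≤ g p) : 0 ≤ d := by
  have h := (h.mono Ico_subset_Icc_self)
  rw [hasDerivWithinAt_iff_tendsto_slope' (by simp)] at h
  have : (𝓝[Ico a p] p).NeBot := by
    rw [nhdsWithin_Ico_eq_nhdsLT ha]; infer_instance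
  refine ge_of_tendsto h ?_
  filter_upwards [self_mem_nhdsWithin] with t ht
  rw [slope_def_field]
  exact div_nonneg_of_nonpos (by linarith [hmax t ⟨ht.1, ht.2.le⟩]) (by linarith [ht.2])

/-- interior or zero derivative at endpoint maximum on an interval. -/
lemma second_le_of_max {g g' : ℝ → ℝ} {d p a b : ℝ} (hab : a < b) (hp : p ∈ Icc a b)
    (h1 : ∀ t ∈ Icc a b, HasDerivWithinAt g (g' t) (Icc a b) t)
    (hend : p = a ∨ p = b → g' p = 0) (h2 : HasDerivWithinAt g' d (Icc a b) p)
    (hmax : ∀ t ∈ Icc a b, g t ≤ g p) : d ≤ 0 := by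
  have h0 : g' p = 0 := by
    by_cases hpa : p = a
    · exact hend (Or.inl hpa)
    by_cases hpb : p = b
    · exact hend (Or.inr hpb)
    have hap : a < p := lt_of_le_of_ne hp.1 (Ne.symm hpa)
    have hpb : p < b := lt_of_le_of_ne hp.2 hpb
    refine le_antisymm ?_ ?_
    · exact deriv_le_of_max_right hpb ((h1 p hp).mono (Icc_subset_Icc_left hp.1))
        (fun t ht => hmax t ⟨hp.1.trans ht.1, ht.2⟩)
    · exact deriv_ge_of_max_left hap ((h1 p hp).mono (Icc_subset_Icc_right hp.2))
        (fun t ht => hmax t ⟨ht.1, ht.2.trans hp.2⟩)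
  rcases hp.2.lt_or_eq with hpb | hpb
  · exact second_le_of_max_right hpb
      (fun t ht => (h1 t ⟨hp.1.trans ht.1, ht.2.le⟩).mono (Icc_subset_Icc_left hp.1)) h0
      (h2.mono (Icc_subset_Icc_left hp.1)) (fun t ht => hmax t ⟨hp.1.trans ht.1, ht.2⟩)
  · subst hpb
    exact second_le_of_max_left hab (fun t ht => h1 t ⟨ht.1.le, ht.2⟩) h0 h2 hmax


/-! ### Symmetric second differences -/

def ee (i : Fin 3) : V3 := EuclideanSpace.single i (1:ℝ)

lemma ee_apply (i j : Fin 3) : ee i j = if j = i then 1 else 0 := by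
  simp [ee]

@[simp] lemma ee_same (i : Fin 3) : ee i i = 1 := by simp [ee_apply]

lemma norm_ee (i : Fin 3) : ‖ee i‖ = 1 := by simp [ee]

lemma v3_eq_sum (x : V3) : x = x 0 • ee 0 + x 1 • ee 1 + x 2 • ee 2 := by
  ext j
  fin_cases j <;> simp [ee_apply]

def HasLap (u : V3 → ℝ) (x : V3) (l : ℝ) : Prop :=
  Tendsto (fun t : ℝ => (∑ i, (u (x + t • ee i) + u (x - t • ee i) - 2 * u x)) / t ^ 2)
    (𝓝[>] 0) (𝓝 l)

lemma HasLap.add {u w : V3 → ℝ} {x : V3} {l k : ℝ} (h : HasLap u x l) (h' : HasLap w x k) :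
    HasLap (fun z => u z + w z) x (l + k) := by
  refine (Tendsto.add h h').congr fun t => ?_
  rw [← add_div, ← Finset.sum_add_distrib]
  congr 1
  exact Finset.sum_congr rfl fun i _ => by ring

lemma HasLap.const_mul {u : V3 → ℝ} {x : V3} {l : ℝ} (c : ℝ) (h : HasLap u x l) :
    HasLap (fun z => c * u z) x (c * l) := by
  refine (Tendsto.const_mul c h).congr fun t => ?_
  rw [← mul_div_assoc, Finset.mul_sum]
  congr 1
  exact Finset.sum_congr rfl fun i _ => by ring

lemma HasLap.sub {u w : V3 → ℝ} {x : V3} {l k : ℝ} (h : HasLap u x l) (h' : HasLap w x k) :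
    HasLap (fun z => u z - w z) x (l - k) := by
  have := h.add (h'.const_mul (-1))
  simpa [sub_eq_add_neg] using this

lemma HasLap.neg {u : V3 → ℝ} {x : V3} {l : ℝ} (h : HasLap u x l) :
    HasLap (fun z => - u z) x (-l) := by
  simpa using h.const_mul (-1)

lemma HasLap.unique {u : V3 → ℝ} {x : V3} {l k : ℝ} (h : HasLap u x l) (h' : HasLap u x k) :
    l = k := tendsto_nhds_unique h h'

lemma tendsto_line (x v : V3) : Tendsto (fun t : ℝ => x + t • v) (𝓝[>] 0) (𝓝 x) := by
  have : Tendsto (fun t : ℝ => x + t • v) (𝓝 0) (𝓝 (x + (0:ℝ) • v)) := by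
    apply Continuous.tendsto; fun_prop
  simp at this
  exact this.mono_left nhdsWithin_le_nhds

lemma tendsto_line' (x v : V3) : Tendsto (fun t : ℝ => x - t • v) (𝓝[>] 0) (𝓝 x) := by
  have : Tendsto (fun t : ℝ => x - t • v) (𝓝 0) (𝓝 (x - (0:ℝ) • v)) := by
    apply Continuous.tendsto; fun_prop
  simp at this
  exact this.mono_left nhdsWithin_le_nhds

lemma HasLap.congr {u w : V3 → ℝ} {x : V3} {l : ℝ} (h : HasLap u x l)
    (he : ∀ᶠ z in 𝓝 x, u z = w z) : HasLap w x l := by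
  refine Tendsto.congr' ?_ h
  have h1 : ∀ᶠ t : ℝ in 𝓝[>] 0, ∀ i, u (x + t • ee i) = w (x + t • ee i) :=
    eventually_all.2 fun i => (tendsto_line x (ee i)).eventually he
  have h2 : ∀ᶠ t : ℝ in 𝓝[>] 0, ∀ i, u (x - t • ee i) = w (x - t • ee i) :=
    eventually_all.2 fun i => (tendsto_line' x (ee i)).eventually he
  filter_upwards [h1, h2] with t h1 h2
  simp only [h1, h2, he.self_of_nhds]

lemma HasLap.comp_affine {u : V3 → ℝ} {x0 z : V3} {s l : ℝ} (hs : 0 < s)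
    (h : HasLap u (x0 + s • z) l) : HasLap (fun z => u (x0 + s • z)) z (s ^ 2 * l) := by
  have h1 : Tendsto (fun t : ℝ => s * t) (𝓝[>] 0) (𝓝[>] 0) := by
    rw [tendsto_nhdsWithin_iff]
    constructor
    · have : Tendsto (fun t : ℝ => s * t) (𝓝 0) (𝓝 (s * 0)) := by
        apply Continuous.tendsto; fun_prop
      simp at this
      exact this.mono_left nhdsWithin_le_nhds
    · filter_upwards [self_mem_nhdsWithin] with t ht
      exact mul_pos hs ht
  refine ((Tendsto.comp h h1).const_mul (s ^ 2)).congr' ?_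
  filter_upwards [self_mem_nhdsWithin] with t ht
  have ht : 0 < t := ht
  have e1 : ∀ i, x0 + s • (z + t • ee i) = x0 + s • z + (s * t) • ee i := fun i => by module
  have e2 : ∀ i, x0 + s • (z - t • ee i) = x0 + s • z - (s * t) • ee i := fun i => by module
  simp only [Function.comp_apply, e1, e2]
  field_simp

lemma HasLap.shift {u : V3 → ℝ} {x0 z : V3} {l : ℝ}
    (h : HasLap u (z + x0) l) : HasLap (fun z => u (z + x0)) z l := by
  have := HasLap.comp_affine (u := u) (x0 := x0) (z := z) (s := 1) (l := l) one_pos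
    (by simpa [add_comm] using h)
  simpa [add_comm] using this

def rfl3 (i : Fin 3) (z : V3) : V3 := z - (2 * z i) • ee i

lemma rfl3_apply_same (i : Fin 3) (z : V3) : rfl3 i z i = - z i := by
  simp [rfl3]; ring

lemma rfl3_apply_ne {i j : Fin 3} (h : j ≠ i) (z : V3) : rfl3 i z j = z j := by
  simp [rfl3, ee_apply, h]

lemma continuous_rfl3 (i : Fin 3) : Continuous (rfl3 i) := by
  unfold rfl3; fun_prop

lemma HasLap.refl {u : V3 → ℝ} {z : V3} {l : ℝ} (i : Fin 3)
    (h : HasLap u (rfl3 i z) l) : HasLap (fun z => u (rfl3 i z)) z l := by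
  refine Tendsto.congr (fun t => ?_) h
  congr 1
  refine Finset.sum_congr rfl fun j _ => ?_
  by_cases hj : j = i
  · subst hj
    have e1 : rfl3 j (z + t • ee j) = rfl3 j z - t • ee j := by
      simp [rfl3]; module
    have e2 : rfl3 j (z - t • ee j) = rfl3 j z + t • ee j := by
      simp [rfl3]; module
    beta_reduce; rw [e1, e2]; ring
  · have hj' : i ≠ j := fun h => hj h.symm
    have e1 : rfl3 i (z + t • ee j) = rfl3 i z + t • ee j := by
      simp [rfl3, ee_apply, hj']; module
    have e2 : rfl3 i (z - t • ee j) = rfl3 i z - t • ee j := by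
      simp [rfl3, ee_apply, hj']; module
    beta_reduce; rw [e1, e2]

/-- Maximum principle at a local max. -/
lemma HasLap.le_of_localMax {u : V3 → ℝ} {x : V3} {l : ℝ} (h : HasLap u x l)
    (hm : ∀ᶠ z in 𝓝 x, u z ≤ u x) : l ≤ 0 := by
  refine le_of_tendsto h ?_
  have h1 : ∀ᶠ t : ℝ in 𝓝[>] 0, ∀ i, u (x + t • ee i) ≤ u x :=
    eventually_all.2 fun i => (tendsto_line x (ee i)).eventually hm
  have h2 : ∀ᶠ t : ℝ in 𝓝[>] 0, ∀ i, u (x - t • ee i) ≤ u x :=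
    eventually_all.2 fun i => (tendsto_line' x (ee i)).eventually hm
  filter_upwards [h1, h2] with t h1 h2
  refine div_nonpos_of_nonpos_of_nonneg (Finset.sum_nonpos fun i _ => ?_) (by positivity)
  linarith [h1 i, h2 i]

/-- quadratic polynomials -/
def qp (c : ℝ) (b : Fin 3 → ℝ) (a : Fin 3 → Fin 3 → ℝ) (z : V3) : ℝ :=
  c + ∑ i, b i * z i + 1 / 2 * ∑ i, ∑ j, a i j * z i * z j

lemma continuous_qp (c : ℝ) (b : Fin 3 → ℝ) (a : Fin 3 → Fin 3 → ℝ) : Continuous (qp c b a) := by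
  unfold qp; fun_prop

lemma hasLap_qp (c : ℝ) (b : Fin 3 → ℝ) (a : Fin 3 → Fin 3 → ℝ) (z : V3) :
    HasLap (qp c b a) z (∑ i, a i i) := by
  refine Tendsto.congr' ?_ tendsto_const_nhds
  filter_upwards [self_mem_nhdsWithin] with t ht
  have ht : 0 < t := ht
  rw [eq_div_iff (by positivity)]
  simp only [qp, Fin.sum_univ_three, PiLp.add_apply, PiLp.sub_apply, PiLp.smul_apply, ee_apply, smul_eq_mul]
  simp
  ring

def cube (x : V3) (d : ℝ) : Set V3 := {z | ∀ i, |z i - x i| ≤ d}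
def ocube (x : V3) (d : ℝ) : Set V3 := {z | ∀ i, |z i - x i| < d}

lemma isOpen_ocube (x : V3) (d : ℝ) : IsOpen (ocube x d) := by
  have : ocube x d = ⋂ i, {z : V3 | |z i - x i| < d} := by ext; simp [ocube]
  rw [this]
  exact isOpen_iInter_of_finite fun i => isOpen_lt (by fun_prop) continuous_const

lemma isClosed_cube (x : V3) (d : ℝ) : IsClosed (cube x d) := by
  have : cube x d = ⋂ i, {z : V3 | |z i - x i| ≤ d} := by ext; simp [cube]
  rw [this]
  exact isClosed_iInter fun i => isClosed_le (by fun_prop) continuous_const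

lemma ocube_subset_cube (x : V3) (d : ℝ) : ocube x d ⊆ cube x d := fun _ hz i => (hz i).le

lemma cube_subset_ocube (x : V3) {d d' : ℝ} (h : d < d') : cube x d ⊆ ocube x d' :=
  fun _ hz i => (hz i).trans_lt h

lemma abs_apply_le_norm (z : V3) (i : Fin 3) : |z i| ≤ ‖z‖ := by
  simpa using PiLp.norm_apply_le z i

lemma norm_le_sum (z : V3) : ‖z‖ ≤ |z 0| + |z 1| + |z 2| := by
  conv_lhs => rw [v3_eq_sum z]
  refine (norm_add₃_le).trans ?_
  simp [norm_smul, norm_ee]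

lemma norm_le_of_mem_cube {x z : V3} {d : ℝ} (h : z ∈ cube x d) : ‖z - x‖ ≤ 3 * d := by
  have := norm_le_sum (z - x)
  have h0 := h 0
  have h1 := h 1
  have h2 := h 2
  simp only [PiLp.sub_apply] at this
  linarith

lemma isCompact_cube (x : V3) (d : ℝ) : IsCompact (cube x d) := by
  refine Metric.isCompact_of_isClosed_isBounded (isClosed_cube x d) ?_
  refine (Metric.isBounded_closedBall (x := x) (r := 3 * d)).subset ?_
  intro z hz
  rw [mem_closedBall_iff_norm]
  exact norm_le_of_mem_cube hz

lemma ball_subset_ocube (x : V3) (d : ℝ) : Metric.ball x d ⊆ ocube x d := by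
  intro z hz i
  rw [mem_ball_iff_norm] at hz
  have := abs_apply_le_norm (z - x) i
  simp only [PiLp.sub_apply] at this
  linarith


/-- `u` continuous on the closed cube with `Δu = f` in the open cube -/
def Good (u f : V3 → ℝ) (x : V3) (d : ℝ) : Prop :=
  ContinuousOn u (cube x d) ∧ ∀ z ∈ ocube x d, HasLap u z (f z)

lemma Good.mono {u f : V3 → ℝ} {x y : V3} {d e : ℝ} (h : Good u f x d)
    (hs : ∀ i, |y i - x i| + e ≤ d) : Good u f y e := by
  have key : ∀ z : V3, ∀ i, |z i - x i| ≤ |z i - y i| + |y i - x i| := fun z i => abs_sub_le _ _ _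
  refine ⟨h.1.mono ?_, fun z hz => h.2 z ?_⟩
  · intro z hz i; linarith [key z i, hs i, hz i]
  · intro i; linarith [key z i, hs i, hz i]

lemma grad_aux {u f : V3 → ℝ} {d M N : ℝ} (hd : 0 < d) (h : Good u f 0 d)
    (hM : ∀ z ∈ cube 0 d, |u z| ≤ M) (hN : ∀ z ∈ ocube 0 d, |f z| ≤ N) (i : Fin 3)
    {t : ℝ} (ht0 : 0 ≤ t) (htd : t ≤ d) :
    u (t • ee i) - u (-(t • ee i)) ≤ 2 * t * d * (4 * M / d ^ 2 + N) := by
  have hM0 : 0 ≤ M := (abs_nonneg _).trans (hM 0 (by intro j; simp; exact hd.le))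
  have hN0 : 0 ≤ N := (abs_nonneg _).trans (hN 0 (by intro j; simp; exact hd))
  have key : ∀ ε > 0, u (t • ee i) - u (-(t • ee i)) ≤ 2 * t * d * (4 * M / d ^ 2 + N + ε) := by
    intro ε hε
    set κ := 4 * M / d ^ 2 + N + ε with hκ
    have hκ0 : 0 ≤ κ := by positivity
    have hκd : 4 * M ≤ κ * d ^ 2 := by
      have : κ * d ^ 2 = 4 * M + (N + ε) * d ^ 2 := by rw [hκ]; field_simp; ring
      rw [this]
      have : 0 ≤ (N + ε) * d ^ 2 := by positivity
      linarith
    set m := 4 * M / d ^ 2 with hm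
    have hm0 : 0 ≤ m := by positivity
    have hmd : m * d ^ 2 = 4 * M := by rw [hm]; field_simp
    set ψ : V3 → ℝ := qp 0 (fun j => if j = i then 2 * d * κ else 0)
      (fun j k => if j = k then (if j = i then -2 * κ else m) else 0) with hψ
    have hψv : ∀ z : V3, ψ z = κ * z i * (2 * d - z i) + m / 2 * (∑ j, if j = i then 0 else z j ^ 2) := by
      intro z
      simp only [hψ, qp, Fin.sum_univ_three]
      fin_cases i <;> simp <;> ring
    have hψl : ∀ z, HasLap ψ z (-2 * N - 2 * ε) := by
      intro z
      have := hasLap_qp 0 (fun j => if j = i then 2 * d * κ else 0)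
        (fun j k => if j = k then (if j = i then -2 * κ else m) else 0) z
      convert this using 1
      simp only [Fin.sum_univ_three]
      fin_cases i <;> simp [hκ] <;> ring
    have hS : ∀ z : V3, 0 ≤ ∑ j, (if j = i then 0 else z j ^ 2) := by
      intro z
      refine Finset.sum_nonneg fun j _ => ?_
      split_ifs <;> positivity
    set H : Set V3 := {z | z ∈ cube 0 d ∧ 0 ≤ z i} with hH
    have hcl : IsClosed {z : V3 | 0 ≤ z i} := isClosed_le continuous_const (by fun_prop)
    have hHc : IsCompact H := (isCompact_cube 0 d).inter_right hcl
    have hrefl : ∀ z ∈ cube 0 d, rfl3 i z ∈ cube 0 d := by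
      intro z hz j
      have := hz j
      by_cases hj : j = i
      · subst hj; simpa [rfl3_apply_same] using this
      · simpa [rfl3_apply_ne hj] using this
    have hreflo : ∀ z ∈ ocube 0 d, rfl3 i z ∈ ocube 0 d := by
      intro z hz j
      have := hz j
      by_cases hj : j = i
      · subst hj; simpa [rfl3_apply_same] using this
      · simpa [rfl3_apply_ne hj] using this
    set φ : V3 → ℝ := fun z => u z - u (rfl3 i z) - ψ z with hφ
    have hφc : ContinuousOn φ H := by
      refine ContinuousOn.sub (ContinuousOn.sub (h.1.mono fun z hz => hz.1) ?_) (continuous_qp _ _ _).continuousOn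
      exact h.1.comp (continuous_rfl3 i).continuousOn fun z hz => hrefl z hz.1
    have hmem : t • ee i ∈ H := by
      refine ⟨?_, by simp [ht0]⟩
      intro j
      by_cases hj : j = i
      · subst hj; simp [abs_of_nonneg ht0, htd]
      · simp [ee_apply, hj, hd.le]
    obtain ⟨p, hp, hpmax⟩ := hHc.exists_isMaxOn ⟨_, hmem⟩ hφc
    have hu : ∀ z ∈ cube 0 d, u z - u (rfl3 i z) ≤ 2 * M := by
      intro z hz
      have h1 := abs_le.1 (hM z hz)
      have h2 := abs_le.1 (hM _ (hrefl z hz))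
      linarith [h1.2, h2.1]
    have hpi : p i ≤ d := by have := hp.1 i; simp at this; exact (abs_le.1 this).2
    have hφp : φ p ≤ 0 := by
      by_cases h1 : p i = 0
      · have : rfl3 i p = p := by simp [rfl3, h1]
        simp only [hφ, this, hψv, h1]
        have := hS p
        have : 0 ≤ m / 2 * (∑ j, if j = i then 0 else p j ^ 2) := by positivity
        simp; linarith
      have hpos : 0 < p i := lt_of_le_of_ne hp.2 (Ne.symm h1)
      have hA : 0 ≤ κ * p i * (2 * d - p i) := mul_nonneg (by positivity) (by linarith)
      by_cases h2 : p ∈ ocube 0 d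
      · exfalso
        have hl : HasLap φ p (f p - f (rfl3 i p) - (-2 * N - 2 * ε)) :=
          ((h.2 p h2).sub (HasLap.refl i (h.2 _ (hreflo p h2)))).sub (hψl p)
        have := hl.le_of_localMax (by
          have o1 : ocube 0 d ∩ {z : V3 | 0 < z i} ∈ 𝓝 p :=
            ((isOpen_ocube 0 d).inter (isOpen_lt continuous_const (by fun_prop))).mem_nhds ⟨h2, hpos⟩
          filter_upwards [o1] with z hz
          exact hpmax ⟨ocube_subset_cube _ _ hz.1, le_of_lt hz.2⟩)
        have a1 := abs_le.1 (hN p h2)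
        have a2 := abs_le.1 (hN _ (hreflo p h2))
        linarith [a1.1, a2.2]
      · simp only [ocube, mem_setOf_eq, not_forall, not_lt] at h2
        obtain ⟨j, hj⟩ := h2
        have hjd : |p j| = d := le_antisymm (by simpa using hp.1 j) (by simpa using hj)
        have := hu p hp.1
        simp only [hφ, hψv]
        by_cases hji : j = i
        · subst hji
          rw [abs_of_pos hpos] at hjd
          rw [hjd]
          have := hS p
          have : 0 ≤ m / 2 * (∑ k, if k = j then 0 else p k ^ 2) := by positivity
          nlinarith
        · have hs : d ^ 2 ≤ ∑ k, (if k = i then 0 else p k ^ 2) := by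
            have := Finset.single_le_sum (f := fun k => if k = i then 0 else p k ^ 2)
              (fun k _ => by split_ifs <;> positivity) (Finset.mem_univ j)
            simp only [hji, if_false] at this
            rw [← hjd, sq_abs]; exact this
          have : m / 2 * d ^ 2 ≤ m / 2 * (∑ k, if k = i then 0 else p k ^ 2) := by gcongr
          nlinarith
    have hfin : φ (t • ee i) ≤ 0 := (hpmax hmem).trans hφp
    have e1 : rfl3 i (t • ee i) = -(t • ee i) := by
      simp [rfl3]; module
    have e2 : (∑ j, if j = i then 0 else (t • ee i) j ^ 2) = 0 := by
      refine Finset.sum_eq_zero fun j _ => ?_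
      by_cases hj : j = i <;> simp [hj, ee_apply]
    simp only [hφ, hψv, e1, e2] at hfin
    simp at hfin
    nlinarith [mul_nonneg hκ0 (mul_nonneg ht0 ht0)]
  by_cases htz : t = 0
  · subst htz; simp
  have htp : 0 < t := lt_of_le_of_ne ht0 (Ne.symm htz)
  refine le_of_forall_pos_le_add fun ε hε => ?_
  have := key (ε / (2 * t * d)) (by positivity)
  refine this.trans (le_of_eq ?_)
  field_simp

lemma grad_est {u f : V3 → ℝ} {m : V3} {d M N : ℝ} (hd : 0 < d) (h : Good u f m d)
    (hM : ∀ z ∈ cube m d, |u z| ≤ M) (hN : ∀ z ∈ ocube m d, |f z| ≤ N) (i : Fin 3)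
    {t : ℝ} (ht0 : 0 ≤ t) (htd : t ≤ d) :
    |u (m + t • ee i) - u (m - t • ee i)| ≤ 2 * t * d * (4 * M / d ^ 2 + N) := by
  have hc : ∀ z, z ∈ cube 0 d → z + m ∈ cube m d := by
    intro z hz j; have := hz j; simpa using this
  have ho : ∀ z, z ∈ ocube 0 d → z + m ∈ ocube m d := by
    intro z hz j; have := hz j; simpa using this
  have h1 : Good (fun z => u (z + m)) (fun z => f (z + m)) 0 d :=
    ⟨h.1.comp (by fun_prop) hc, fun z hz => HasLap.shift (h.2 _ (ho z hz))⟩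
  have h2 : Good (fun z => -u (z + m)) (fun z => -f (z + m)) 0 d :=
    ⟨h1.1.neg, fun z hz => (h1.2 z hz).neg⟩
  have a1 := grad_aux hd h1 (fun z hz => hM _ (hc z hz)) (fun z hz => hN _ (ho z hz)) i ht0 htd
  have a2 := grad_aux hd h2 (fun z hz => by rw [abs_neg]; exact hM _ (hc z hz))
    (fun z hz => by rw [abs_neg]; exact hN _ (ho z hz)) i ht0 htd
  have e1 : t • ee i + m = m + t • ee i := add_comm _ _
  have e2 : -(t • ee i) + m = m - t • ee i := by abel
  simp only [e1, e2] at a1 a2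
  rw [abs_le]; constructor <;> linarith

/-- forward difference -/
def dif (i : Fin 3) (t : ℝ) (u : V3 → ℝ) (z : V3) : ℝ := u (z + t • ee i) - u z

lemma mem_cube_shift {z : V3} {ρ t e : ℝ} {i : Fin 3} (hz : z ∈ cube 0 ρ) (ht : |t| ≤ e) :
    z + t • ee i ∈ cube 0 (ρ + e) := by
  intro j
  have := hz j
  have he : 0 ≤ e := (abs_nonneg _).trans ht
  simp only [PiLp.zero_apply, sub_zero] at this
  by_cases hj : j = i
  · subst hj
    simp
    exact (abs_add_le _ _).trans (add_le_add this ht)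
  · simp [ee_apply, hj]; linarith

lemma mem_ocube_shift {z : V3} {ρ t e : ℝ} {i : Fin 3} (hz : z ∈ ocube 0 ρ) (ht : |t| ≤ e) :
    z + t • ee i ∈ ocube 0 (ρ + e) := by
  intro j
  have := hz j
  have he : 0 ≤ e := (abs_nonneg _).trans ht
  simp only [PiLp.zero_apply, sub_zero] at this
  by_cases hj : j = i
  · subst hj
    simp
    exact (abs_add_le _ _).trans_lt (add_lt_add_of_lt_of_le this ht)
  · simp [ee_apply, hj]; linarith

lemma cube_mono {x : V3} {d e : ℝ} (h : d ≤ e) : cube x d ⊆ cube x e := fun _ hz i => (hz i).trans h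
lemma ocube_mono {x : V3} {d e : ℝ} (h : d ≤ e) : ocube x d ⊆ ocube x e := fun _ hz i => (hz i).trans_le h

lemma dif_step {u f : V3 → ℝ} {ρ M N : ℝ} (h : Good u f 0 (ρ + 1/4))
    (hM : ∀ z ∈ cube 0 (ρ + 1/4), |u z| ≤ M) (hN : ∀ z ∈ ocube 0 (ρ + 1/4), |f z| ≤ N) (i : Fin 3)
    {t : ℝ} (ht0 : 0 ≤ t) (ht : t ≤ 1/4) :
    Good (dif i t u) (dif i t f) 0 ρ ∧ (∀ z ∈ cube 0 ρ, |dif i t u z| ≤ t * (32 * M + N)) ∧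
      (∀ z ∈ ocube 0 ρ, |dif i t f z| ≤ 2 * N) := by
  have hta : |t| ≤ 1/4 := by rwa [abs_of_nonneg ht0]
  refine ⟨⟨?_, ?_⟩, ?_, ?_⟩
  · refine ContinuousOn.sub (h.1.comp (by fun_prop) fun z hz => mem_cube_shift hz hta)
      (h.1.mono (cube_mono (by linarith)))
  · intro z hz
    exact (HasLap.shift (h.2 _ (mem_ocube_shift hz hta))).sub (h.2 _ (ocube_mono (by linarith) hz))
  · intro z hz
    have hsub : ∀ w ∈ cube (z + (t/2) • ee i) (1/8), w ∈ cube 0 (ρ + 1/4) := by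
      intro w hw j
      have h1 := mem_cube_shift (i := i) (t := t/2) (e := 1/8) hz (by rw [abs_of_nonneg (by linarith)]; linarith) j
      have h2 := hw j
      simp only [PiLp.zero_apply, sub_zero] at h1 ⊢
      have := abs_sub_abs_le_abs_sub (w j) ((z + (t/2) • ee i) j)
      linarith
    have hsubo : ∀ w ∈ ocube (z + (t/2) • ee i) (1/8), w ∈ ocube 0 (ρ + 1/4) := by
      intro w hw j
      have h1 := mem_cube_shift (i := i) (t := t/2) (e := 1/8) hz (by rw [abs_of_nonneg (by linarith)]; linarith) j
      have h2 := hw j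
      simp only [PiLp.zero_apply, sub_zero] at h1 ⊢
      have := abs_sub_abs_le_abs_sub (w j) ((z + (t/2) • ee i) j)
      linarith
    have := grad_est (m := z + (t/2) • ee i) (d := 1/8) (M := M) (N := N) (t := t/2) (by norm_num)
      ⟨h.1.mono hsub, fun w hw => h.2 w (hsubo w hw)⟩ (fun w hw => hM w (hsub w hw))
      (fun w hw => hN w (hsubo w hw)) i (by linarith) (by linarith)
    have e1 : z + (t/2) • ee i + (t/2) • ee i = z + t • ee i := by module
    have e2 : z + (t/2) • ee i - (t/2) • ee i = z := by module
    rw [e1, e2] at this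
    refine this.trans ?_
    have hN0 : 0 ≤ M ∧ 0 ≤ N := by
      constructor
      · exact (abs_nonneg _).trans (hM z (cube_mono (by linarith) hz))
      · refine (abs_nonneg _).trans (hN (z + (t/2) • ee i) (hsubo _ ?_))
        intro j; simp
    have e3 : 2 * (t / 2) * (1 / 8) * (4 * M / (1 / 8) ^ 2 + N) = t * (32 * M + N / 8) := by ring
    rw [e3]
    nlinarith [mul_nonneg ht0 hN0.1, mul_nonneg ht0 hN0.2]
  · intro z hz
    have h1 := hN _ (mem_ocube_shift (i := i) hz hta)
    have h2 := hN _ (ocube_mono (by linarith) hz)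
    unfold dif
    exact (abs_sub _ _).trans (by linarith)

/-- third differences -/
lemma third_dif {u f : V3 → ℝ} {ε : ℝ} (h : Good u f 0 1)
    (hM : ∀ z ∈ cube 0 1, |u z| ≤ 1) (hN : ∀ z ∈ ocube 0 1, |f z| ≤ ε) (hε : ε ≤ 1) (i j k : Fin 3)
    {r s t : ℝ} (hr0 : 0 ≤ r) (hr : r ≤ 1/4) (hs0 : 0 ≤ s) (hs : s ≤ 1/4) (ht0 : 0 ≤ t) (ht : t ≤ 1/4) :
    ∀ z ∈ cube 0 (1/4), |dif k t (dif j s (dif i r u)) z| ≤ 33792 * (r * s * t) + 18 * ε := by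
  have hε0 : 0 ≤ ε := (abs_nonneg _).trans (hN 0 (by intro j; simp))
  obtain ⟨g1, b1, c1⟩ := dif_step (ρ := 3/4) (M := 1) (N := ε)
    (by convert h using 1; norm_num) (by convert hM using 3; norm_num) (by convert hN using 3; norm_num) i hr0 hr
  obtain ⟨g2, b2, c2⟩ := dif_step (ρ := 1/2) (by convert g1 using 1; norm_num)
    (by convert b1 using 3; norm_num) (by convert c1 using 3; norm_num) j hs0 hs
  obtain ⟨g3, b3, c3⟩ := dif_step (ρ := 1/4) (by convert g2 using 1; norm_num)
    (by convert b2 using 3; norm_num) (by convert c2 using 3; norm_num) k ht0 ht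
  intro z hz
  refine (b3 z hz).trans ?_
  have hts : t * s ≤ 1 / 4 * (1/4) := mul_le_mul ht hs hs0 (by norm_num)
  have h1 : t * s * ε ≤ 1/16 * ε := by nlinarith
  have h2 : t * ε ≤ 1/4 * ε := by nlinarith
  have h3 : r * s * t * ε ≤ r * s * t := by
    have : 0 ≤ r * s * t := by positivity
    nlinarith
  nlinarith


lemma hyers_ulam {G : ℝ → ℝ} {l B η : ℝ} (hl : 0 < l) (hB : ∀ t ∈ Icc 0 l, |G t| ≤ B)
    (hG : ∀ s t, 0 ≤ s → 0 ≤ t → s + t ≤ l → |G (s + t) - G s - G t| ≤ η) :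
    ∀ t ∈ Icc 0 l, |G t - t / l * G l| ≤ 3 * η := by
  set g : ℝ → ℝ := fun t => G t - t / l * G l with hg
  have hgl : g l = 0 := by simp [hg, hl.ne']
  have hadd : ∀ s t, 0 ≤ s → 0 ≤ t → s + t ≤ l → |g (s + t) - g s - g t| ≤ η := by
    intro s t hs ht hst
    have := hG s t hs ht hst
    have e : g (s + t) - g s - g t = G (s + t) - G s - G t := by simp only [hg]; ring
    rwa [e]
  have hb : ∀ t ∈ Icc 0 l, |g t| ≤ 2 * B := by
    intro t ht
    have h1 := hB t ht
    have h2 := hB l ⟨hl.le, le_rfl⟩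
    have h3 : |t / l * G l| ≤ B := by
      rw [abs_mul, abs_of_nonneg (div_nonneg ht.1 hl.le)]
      have : t / l ≤ 1 := (div_le_one hl).2 ht.2
      have h0 := abs_nonneg (G l)
      nlinarith
    exact (abs_sub _ _).trans (by linarith)
  have step : ∀ n : ℕ, ∀ t ∈ Icc 0 l, |g t| ≤ 2 * B / 2 ^ n + 3 * η := by
    have hη : 0 ≤ η := (abs_nonneg _).trans (hG 0 0 le_rfl le_rfl (by simpa using hl.le))
    intro n
    induction n with
    | zero => intro t ht; have := hb t ht; simp; linarith
    | succ n ih =>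
      have e : 2 * B / 2 ^ (n + 1) = (2 * B / 2 ^ n) / 2 := by rw [pow_succ]; field_simp
      rw [e]
      have small : ∀ t ∈ Icc 0 (l/2), |g t| ≤ (2 * B / 2 ^ n) / 2 + 2 * η := by
        intro t ht
        have h1 := abs_le.1 (hadd t t ht.1 ht.1 (by linarith [ht.2]))
        have h2 := abs_le.1 (ih (t + t) ⟨by linarith [ht.1], by linarith [ht.2]⟩)
        rw [abs_le]; constructor <;> linarith [h1.1, h1.2, h2.1, h2.2]
      intro t ht
      rcases le_total t (l/2) with h | h
      · linarith [small t ⟨ht.1, h⟩]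
      · have h1 := hadd (l - t) t (by linarith [ht.2]) ht.1 (by linarith)
        have h2 := abs_le.1 (small (l - t) ⟨by linarith [ht.2], by linarith⟩)
        rw [sub_add_cancel, hgl] at h1
        have h1 := abs_le.1 h1
        rw [abs_le]; constructor <;> linarith [h1.1, h1.2, h2.1, h2.2]
  intro t ht
  have hlim : Tendsto (fun n : ℕ => 2 * B / 2 ^ n + 3 * η) atTop (𝓝 (0 + 3 * η)) := by
    refine Tendsto.add ?_ tendsto_const_nhds
    exact tendsto_const_nhds.div_atTop (tendsto_pow_atTop_atTop_of_one_lt (by norm_num))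
  rw [zero_add] at hlim
  exact ge_of_tendsto hlim (Eventually.of_forall fun n => step n t ht)

lemma qp_shift (c : ℝ) (b : Fin 3 → ℝ) (a : Fin 3 → Fin 3 → ℝ) (ha : ∀ i j, a i j = a j i) (q z : V3) :
    qp c b a (z + q) = qp (qp c b a q) (fun i => b i + ∑ j, a i j * q j) a z := by
  simp only [qp, Fin.sum_univ_three, PiLp.add_apply]
  rw [ha 1 0, ha 2 0, ha 2 1]
  ring

lemma mem_cube_add {x z q : V3} {a b : ℝ} (h : z ∈ cube x a) (hq : ∀ i, |q i| ≤ b) :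
    z + q ∈ cube x (a + b) := by
  intro i
  have h1 := h i
  have h2 := hq i
  have : (z + q) i - x i = (z i - x i) + q i := by simp; ring
  rw [this]
  exact (abs_add_le _ _).trans (add_le_add h1 h2)

lemma quad_approx {w : V3 → ℝ} {l η B : ℝ} {p : V3} (hl : 0 < l) (hl4 : l ≤ 1/4)
    (hp : ∀ i, p i = - (l/2))
    (hb : ∀ z ∈ cube 0 1, |w z| ≤ B)
    (h3 : ∀ i j k : Fin 3, ∀ r ∈ Icc 0 l, ∀ s ∈ Icc 0 l, ∀ t ∈ Icc 0 l,
      |dif k t (dif j s (dif i r w)) p| ≤ η) :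
    ∃ c b a, (∀ i j, a i j = a j i) ∧ ∀ z ∈ cube 0 (l/2), |w z - qp c b a z| ≤ 73 * η := by
  have hpc : p ∈ cube 0 (1/8) := by
    intro i; rw [hp i]; simp; rw [abs_of_pos (by linarith)]; linarith
  have smallee : ∀ i j : Fin 3, ∀ s ∈ Icc 0 l, |(s • ee i) j| ≤ 1/4 := by
    intro i j s hs
    simp only [PiLp.smul_apply, ee_apply, smul_eq_mul]
    split_ifs
    · rw [mul_one, abs_of_nonneg hs.1]; linarith [hs.2]
    · simp
  have c1 : ∀ i, ∀ s ∈ Icc 0 l, |w (p + s • ee i)| ≤ B := fun i s hs =>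
    hb _ (cube_mono (by norm_num) (mem_cube_add hpc (smallee i · s hs)))
  have c2 : ∀ i j, ∀ s ∈ Icc 0 l, ∀ t ∈ Icc 0 l, |w (p + s • ee i + t • ee j)| ≤ B := fun i j s hs t ht =>
    hb _ (cube_mono (by norm_num) (mem_cube_add (mem_cube_add hpc (smallee i · s hs)) (smallee j · t ht)))
  have c0 : |w p| ≤ B := hb _ (cube_mono (by norm_num) hpc)
  set Bf : Fin 3 → Fin 3 → ℝ → ℝ → ℝ := fun i j s t =>
    w (p + s • ee i + t • ee j) - w (p + s • ee i) - w (p + t • ee j) + w p with hBf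
  have Bsymm : ∀ i j s t, Bf i j s t = Bf j i t s := by
    intro i j s t; simp only [hBf]
    rw [add_right_comm p (s • ee i)]; ring
  have Bbd : ∀ i j, ∀ s ∈ Icc 0 l, ∀ t ∈ Icc 0 l, |Bf i j s t| ≤ 4 * B := by
    intro i j s hs t ht
    have h1 := abs_le.1 (c2 i j s hs t ht)
    have h2 := abs_le.1 (c1 i s hs)
    have h3 := abs_le.1 (c1 j t ht)
    have h4 := abs_le.1 c0
    simp only [hBf]
    rw [abs_le]; constructor <;> linarith [h1.1, h1.2, h2.1, h2.2, h3.1, h3.2, h4.1, h4.2]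
  have lmem : l ∈ Icc 0 l := ⟨hl.le, le_rfl⟩
  have B1 : ∀ i j, ∀ s ∈ Icc 0 l, ∀ t ∈ Icc 0 l, |Bf i j s t - s / l * Bf i j l t| ≤ 3 * η := by
    intro i j s hs t ht
    refine hyers_ulam (G := fun s => Bf i j s t) hl (fun s hs => Bbd i j s hs t ht) ?_ s hs
    intro s s' hs hs' hss
    have := h3 i i j s ⟨hs, by linarith⟩ s' ⟨hs', by linarith⟩ t ht
    convert this using 2
    simp only [hBf, dif]
    have e1 : p + t • ee j + s' • ee i + s • ee i = p + (s + s') • ee i + t • ee j := by module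
    have e2 : p + t • ee j + s' • ee i = p + s' • ee i + t • ee j := by module
    have e3 : p + t • ee j + s • ee i = p + s • ee i + t • ee j := by module
    have e4 : p + s' • ee i + s • ee i = p + (s + s') • ee i := by module
    rw [e1, e2, e3, e4]; ring
  set β : Fin 3 → Fin 3 → ℝ := fun i j => Bf i j l l / l ^ 2 with hβ
  have βs : ∀ i j, β i j = β j i := fun i j => by simp only [hβ]; rw [Bsymm]
  have B2 : ∀ i j, ∀ s ∈ Icc 0 l, ∀ t ∈ Icc 0 l, |Bf i j s t - β i j * s * t| ≤ 6 * η := by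
    intro i j s hs t ht
    have h1 := B1 i j s hs t ht
    have h2 := B1 j i t ht l lmem
    rw [Bsymm j i, Bsymm j i] at h2
    have hη : 0 ≤ η := by linarith [abs_nonneg (Bf i j s t - s / l * Bf i j l t)]
    have e : Bf i j s t - β i j * s * t =
      (Bf i j s t - s / l * Bf i j l t) + s / l * (Bf i j l t - t / l * Bf i j l l) := by
      simp only [hβ]; field_simp; ring
    rw [e]
    have hs1 : s / l ≤ 1 := (div_le_one hl).2 hs.2
    have hs0 : 0 ≤ s / l := div_nonneg hs.1 hl.le
    refine (abs_add_le _ _).trans ?_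
    rw [abs_mul, abs_of_nonneg hs0]
    nlinarith [abs_nonneg (Bf i j l t - t / l * Bf i j l l)]
  have D1 : ∀ i, ∃ κ : ℝ, ∀ t ∈ Icc 0 l, |w (p + t • ee i) - w p - (κ * t + β i i * t ^ 2 / 2)| ≤ 18 * η := by
    intro i
    set G : ℝ → ℝ := fun t => w (p + t • ee i) - w p - β i i * t ^ 2 / 2 with hG
    refine ⟨G l / l, fun t ht => ?_⟩
    have := hyers_ulam (G := G) (η := 6 * η) (B := 2 * B + |β i i| * l ^ 2) hl ?_ ?_ t ht
    · have e : w (p + t • ee i) - w p - (G l / l * t + β i i * t ^ 2 / 2) = G t - t / l * G l := by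
        simp only [hG]; ring
      rw [e]; linarith
    · intro t ht
      have h1 := abs_le.1 (c1 i t ht)
      have h4 := abs_le.1 c0
      have h5 : |β i i * t ^ 2 / 2| ≤ |β i i| * l ^ 2 := by
        rw [abs_div, abs_mul, abs_of_nonneg (sq_nonneg t)]
        have : t ^ 2 ≤ l ^ 2 := by
          have := ht.1; have := ht.2; gcongr
        have h0 := abs_nonneg (β i i)
        rw [abs_of_pos (by norm_num : (0:ℝ) < 2)]
        nlinarith [mul_le_mul_of_nonneg_left this h0, mul_nonneg h0 (sq_nonneg t)]
      have h5 := abs_le.1 h5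
      simp only [hG]
      rw [abs_le]; constructor <;> linarith [h1.1, h1.2, h4.1, h4.2, h5.1, h5.2]
    · intro s t hs ht hst
      have := B2 i i s ⟨hs, by linarith⟩ t ⟨ht, by linarith⟩
      convert this using 2
      simp only [hG, hBf]
      have e : p + s • ee i + t • ee i = p + (s + t) • ee i := by module
      rw [e]; ring
  choose κ hκ using D1
  refine ⟨qp (w p) κ β (-p), fun i => κ i + ∑ j, β i j * (-p) j, β, βs, fun z hz => ?_⟩
  rw [← qp_shift _ _ _ βs]
  set τ : V3 := z + -p with hτ
  have hτm : ∀ i, τ i ∈ Icc 0 l := by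
    intro i
    have h1 := abs_le.1 (hz i)
    have : τ i = z i + l / 2 := by simp [hτ, hp i]
    rw [this]
    simp only [PiLp.zero_apply, sub_zero] at h1
    exact ⟨by linarith [h1.1], by linarith [h1.2]⟩
  have hz' : z = p + τ 0 • ee 0 + τ 1 • ee 1 + τ 2 • ee 2 := by
    have := v3_eq_sum τ
    rw [add_assoc p, add_assoc p, ← this, hτ]; abel
  have k0 := abs_le.1 (hκ 0 _ (hτm 0))
  have k1 := abs_le.1 (hκ 1 _ (hτm 1))
  have k2 := abs_le.1 (hκ 2 _ (hτm 2))
  have k01 := abs_le.1 (B2 0 1 _ (hτm 0) _ (hτm 1))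
  have k02 := abs_le.1 (B2 0 2 _ (hτm 0) _ (hτm 2))
  have k12 := abs_le.1 (B2 1 2 _ (hτm 1) _ (hτm 2))
  have k3 := h3 0 1 2 _ (hτm 0) _ (hτm 1) _ (hτm 2)
  simp only [hBf] at k01 k02 k12
  have e3 : dif 2 (τ 2) (dif 1 (τ 1) (dif 0 (τ 0) w)) p =
      w (p + τ 0 • ee 0 + τ 1 • ee 1 + τ 2 • ee 2) - w (p + τ 1 • ee 1 + τ 2 • ee 2)
      - w (p + τ 0 • ee 0 + τ 2 • ee 2) - w (p + τ 0 • ee 0 + τ 1 • ee 1)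
      + w (p + τ 0 • ee 0) + w (p + τ 1 • ee 1) + w (p + τ 2 • ee 2) - w p := by
    simp only [dif]
    have e1 : p + τ 2 • ee 2 + τ 1 • ee 1 + τ 0 • ee 0 = p + τ 0 • ee 0 + τ 1 • ee 1 + τ 2 • ee 2 := by module
    have e2 : p + τ 2 • ee 2 + τ 1 • ee 1 = p + τ 1 • ee 1 + τ 2 • ee 2 := by module
    have e4 : p + τ 2 • ee 2 + τ 0 • ee 0 = p + τ 0 • ee 0 + τ 2 • ee 2 := by module
    have e5 : p + τ 1 • ee 1 + τ 0 • ee 0 = p + τ 0 • ee 0 + τ 1 • ee 1 := by module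
    rw [e1, e2, e4, e5]; ring
  rw [e3] at k3
  have k3 := abs_le.1 k3
  have eq : qp (w p) κ β τ = w p + (κ 0 * τ 0 + β 0 0 * τ 0 ^ 2 / 2) + (κ 1 * τ 1 + β 1 1 * τ 1 ^ 2 / 2)
    + (κ 2 * τ 2 + β 2 2 * τ 2 ^ 2 / 2) + β 0 1 * τ 0 * τ 1 + β 0 2 * τ 0 * τ 2 + β 1 2 * τ 1 * τ 2 := by
    simp only [qp, Fin.sum_univ_three]
    rw [βs 1 0, βs 2 0, βs 2 1]; ring
  rw [eq, hz', abs_le]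
  constructor <;> linarith [k0.1, k0.2, k1.1, k1.2, k2.1, k2.2, k01.1, k01.2, k02.1, k02.2, k12.1, k12.2, k3.1, k3.2]


lemma max_cube {g h : V3 → ℝ} {x : V3} {d m : ℝ} (hg : Good g h x d) (hpos : ∀ z ∈ ocube x d, 0 < h z)
    (hb : ∀ z ∈ cube x d, z ∉ ocube x d → g z ≤ m) : ∀ z ∈ cube x d, g z ≤ m := by
  intro z hz
  obtain ⟨p, hp, hmax⟩ := (isCompact_cube x d).exists_isMaxOn ⟨z, hz⟩ hg.1
  by_cases h2 : p ∈ ocube x d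
  · exfalso
    have := (hg.2 p h2).le_of_localMax (by
      filter_upwards [(isOpen_ocube x d).mem_nhds h2] with z hz
      exact hmax (ocube_subset_cube _ _ hz))
    linarith [hpos p h2]
  · exact (hmax hz).trans (hb p hp h2)

lemma qp_add (c c' : ℝ) (b b' : Fin 3 → ℝ) (a a' : Fin 3 → Fin 3 → ℝ) (z : V3) :
    qp (c + c') (fun i => b i + b' i) (fun i j => a i j + a' i j) z = qp c b a z + qp c' b' a' z := by
  simp only [qp, Fin.sum_univ_three]; ring

lemma qp_smul (s c : ℝ) (b : Fin 3 → ℝ) (a : Fin 3 → Fin 3 → ℝ) (z : V3) :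
    qp (s * c) (fun i => s * b i) (fun i j => s * a i j) z = s * qp c b a z := by
  simp only [qp, Fin.sum_univ_three]; ring

/-- `k |z|²/6` as a quadratic polynomial -/
def qdiag (k : ℝ) : Fin 3 → Fin 3 → ℝ := fun i j => if i = j then k / 3 else 0

lemma qdiag_symm (k : ℝ) (i j : Fin 3) : qdiag k i j = qdiag k j i := by
  unfold qdiag; simp only [eq_comm]

lemma qdiag_val (k : ℝ) (z : V3) : qp 0 0 (qdiag k) z = k / 6 * (z 0 ^ 2 + z 1 ^ 2 + z 2 ^ 2) := by
  simp [qp, Fin.sum_univ_three, qdiag]; ring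

lemma qdiag_trace (k : ℝ) : ∑ i, qdiag k i i = k := by
  simp [Fin.sum_univ_three, qdiag]; ring

lemma trace_bound {g h : V3 → ℝ} {d k m : ℝ} (hd : 0 < d) (hg : Good g h 0 d)
    (hh : ∀ z ∈ ocube 0 d, k ≤ h z) (hm : ∀ z ∈ cube 0 d, |g z| ≤ m) : k * d ^ 2 ≤ 12 * m := by
  by_contra! hlt
  have hm0 : 0 ≤ m := (abs_nonneg _).trans (hm 0 (by intro j; simp; exact hd.le))
  have hk : 0 < k := by
    by_contra! hk
    nlinarith [sq_nonneg d]
  obtain ⟨k', h1, h2⟩ : ∃ k', k' < k ∧ 12 * m < k' * d ^ 2 := by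
    have : 12 * m / d ^ 2 < k := by rw [div_lt_iff₀ (by positivity)]; exact hlt
    obtain ⟨k', h1, h2⟩ := exists_between this
    refine ⟨k', h2, ?_⟩
    rwa [div_lt_iff₀ (by positivity)] at h1
  have hk' : 0 < k' := by
    by_contra! hk
    nlinarith [sq_nonneg d]
  set q := qp 0 0 (qdiag k') with hq
  have hG : Good (fun z => g z - q z) (fun z => h z - k') 0 d := by
    refine ⟨hg.1.sub (continuous_qp _ _ _).continuousOn, fun z hz => (hg.2 z hz).sub ?_⟩
    have := hasLap_qp 0 0 (qdiag k') z
    rwa [qdiag_trace] at this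
  have := max_cube (m := m - k' / 6 * d ^ 2) hG (fun z hz => by linarith [hh z hz]) ?_ 0
    (by intro j; simp; exact hd.le)
  · have h0 := (abs_le.1 (hm 0 (by intro j; simp; exact hd.le))).1
    have : q 0 = 0 := by rw [hq, qdiag_val]; simp
    linarith
  · intro z hz hz'
    simp only [ocube, mem_setOf_eq, not_forall, not_lt] at hz'
    obtain ⟨j, hj⟩ := hz'
    have h3 := (abs_le.1 (hm z hz)).2
    have h4 : d ^ 2 ≤ z j ^ 2 := by
      rw [← sq_abs (z j)]; simp at hj; gcongr
    have h5 : d ^ 2 ≤ z 0 ^ 2 + z 1 ^ 2 + z 2 ^ 2 := by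
      fin_cases j <;> simp at h4 <;> nlinarith [sq_nonneg (z 0), sq_nonneg (z 1), sq_nonneg (z 2)]
    have : q z = k' / 6 * (z 0 ^ 2 + z 1 ^ 2 + z 2 ^ 2) := by rw [hq, qdiag_val]
    rw [this]
    nlinarith

/-- decay constant -/
def C0 : ℝ := 7 * 73 * 33792 * 8 + 10000

lemma C0_pos : 0 < C0 := by unfold C0; norm_num

lemma decay {u f : V3 → ℝ} {ε l : ℝ} (h : Good u f 0 1)
    (hM : ∀ z ∈ cube 0 1, |u z| ≤ 1) (hN : ∀ z ∈ ocube 0 1, |f z| ≤ ε) (hε : ε ≤ 1)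
    (hl : 0 < l) (hl8 : l ≤ 1/8) :
    ∃ c b a, (∀ i j, a i j = a j i) ∧ (∑ i, a i i = 0) ∧
      ∀ z ∈ cube 0 l, |u z - qp c b a z| ≤ C0 * (l ^ 3 + ε) := by
  have hε0 : 0 ≤ ε := (abs_nonneg _).trans (hN 0 (by intro j; simp))
  set η := 33792 * (2 * l) ^ 3 + 18 * ε with hη
  have hη0 : 0 ≤ η := by positivity
  set p : V3 := WithLp.toLp 2 (fun _ => -l) with hp
  obtain ⟨c, b, a, hs, hQ⟩ := quad_approx (w := u) (l := 2 * l) (η := η) (B := 1) (p := p) (by linarith)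
    (by linarith) (by intro i; simp [hp]) hM (by
      intro i j k r hr s hs t ht
      have hpc : p ∈ cube 0 (1/4) := by intro i; simp [hp]; rw [abs_of_pos hl]; linarith
      refine (third_dif h hM hN hε i j k hr.1 (by linarith [hr.2]) hs.1 (by linarith [hs.2]) ht.1
        (by linarith [ht.2]) p hpc).trans ?_
      have : r * s * t ≤ (2 * l) * (2 * l) * (2 * l) :=
        mul_le_mul (mul_le_mul hr.2 hs.2 hs.1 (by linarith)) ht.2 ht.1 (by positivity)
      rw [hη]; nlinarith)
  have hl2 : 2 * l / 2 = l := by ring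
  rw [hl2] at hQ
  set τ := ∑ i, a i i with hτ
  have hsub : Good u f 0 l := h.mono (by intro i; simp; linarith)
  have hfs : ∀ z ∈ ocube 0 l, |f z| ≤ ε := fun z hz => hN z (ocube_mono (by linarith) hz)
  have g1 : Good (fun z => qp c b a z - u z) (fun z => τ - f z) 0 l :=
    ⟨(continuous_qp _ _ _).continuousOn.sub hsub.1, fun z hz => (hasLap_qp c b a z).sub (hsub.2 z hz)⟩
  have g2 : Good (fun z => u z - qp c b a z) (fun z => f z - τ) 0 l :=
    ⟨hsub.1.sub (continuous_qp _ _ _).continuousOn, fun z hz => (hsub.2 z hz).sub (hasLap_qp c b a z)⟩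
  have t1 := trace_bound hl g1 (k := τ - ε) (fun z hz => by linarith [(abs_le.1 (hfs z hz)).2])
    (fun z hz => by rw [abs_sub_comm]; exact hQ z hz)
  have t2 := trace_bound hl g2 (k := -τ - ε) (fun z hz => by linarith [(abs_le.1 (hfs z hz)).1]) hQ
  have hll : l ^ 2 ≤ 1 := by nlinarith
  have hτb : |τ| * l ^ 2 ≤ ε + 12 * (73 * η) := by
    have : |τ| * l ^ 2 = |τ * l ^ 2| := by rw [abs_mul, abs_of_nonneg (sq_nonneg l)]
    rw [this, abs_le]
    have : ε * l ^ 2 ≤ ε := by nlinarith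
    constructor <;> nlinarith
  refine ⟨c + 0, fun i => b i + (0 : Fin 3 → ℝ) i, fun i j => a i j + qdiag (-τ) i j, ?_, ?_, ?_⟩
  · intro i j; simp only; rw [hs i j, qdiag_symm]
  · rw [Finset.sum_add_distrib, qdiag_trace, ← hτ]; ring
  · intro z hz
    rw [qp_add, qdiag_val]
    have h1 := hQ z hz
    have h2 : ∀ i, z i ^ 2 ≤ l ^ 2 := by
      intro i
      have := hz i
      simp at this
      rw [← sq_abs]; gcongr
    have h3 : |-τ / 6 * (z 0 ^ 2 + z 1 ^ 2 + z 2 ^ 2)| ≤ |τ| * l ^ 2 / 2 := by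
      rw [abs_mul, abs_div, abs_neg, abs_of_nonneg (by positivity : 0 ≤ z 0 ^ 2 + z 1 ^ 2 + z 2 ^ 2),
        abs_of_pos (by norm_num : (0:ℝ) < 6)]
      have := abs_nonneg τ
      have := mul_le_mul_of_nonneg_left (add_le_add (add_le_add (h2 0) (h2 1)) (h2 2)) this
      linarith
    have e : u z - (qp c b a z + -τ / 6 * (z 0 ^ 2 + z 1 ^ 2 + z 2 ^ 2)) =
      (u z - qp c b a z) - (-τ / 6 * (z 0 ^ 2 + z 1 ^ 2 + z 2 ^ 2)) := by ring
    rw [e]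
    refine (abs_sub _ _).trans ?_
    have hl3 : 0 ≤ l ^ 3 := by positivity
    rw [hη] at h1 hτb
    unfold C0
    nlinarith


lemma ee_comb_mem {d s t : ℝ} (i j : Fin 3) (hij : i ≠ j) (hs : |s| ≤ d) (ht : |t| ≤ d) :
    s • ee i + t • ee j ∈ cube 0 d := by
  intro k
  have hd : 0 ≤ d := (abs_nonneg _).trans hs
  simp only [PiLp.add_apply, PiLp.smul_apply, ee_apply, smul_eq_mul, PiLp.zero_apply, sub_zero]
  by_cases h1 : k = i
  · subst h1; simp [hij, hs]
  · by_cases h2 : k = j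
    · subst h2; simp [h1, ht]
    · simp [h1, h2, hd]

lemma qp_coef {c : ℝ} {b : Fin 3 → ℝ} {a : Fin 3 → Fin 3 → ℝ} (ha : ∀ i j, a i j = a j i) {d m : ℝ}
    (hd : 0 < d) (h : ∀ z ∈ cube 0 d, |qp c b a z| ≤ m) :
    |c| ≤ m ∧ (∀ i, |b i| ≤ m / d) ∧ ∀ i j, |a i j| ≤ 4 * m / d ^ 2 := by
  have h0 : |c| ≤ m := by
    have := h 0 (by intro i; simp; exact hd.le)
    simpa [qp] using this
  have h1 : ∀ i, ∀ s, |s| ≤ d → |c + b i * s + a i i * s ^ 2 / 2| ≤ m := by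
    intro i s hs
    obtain ⟨j, hj⟩ : ∃ j : Fin 3, i ≠ j := ⟨i + 1, by fin_cases i <;> simp⟩
    have := h _ (ee_comb_mem i j hj hs (t := 0) (by simpa using hd.le))
    convert this using 2
    simp only [qp, Fin.sum_univ_three, PiLp.add_apply, PiLp.smul_apply, ee_apply, smul_eq_mul]
    fin_cases i <;> simp <;> ring
  have hm : 0 ≤ m := (abs_nonneg _).trans h0
  have hdd : |d| ≤ d := by rw [abs_of_pos hd]
  have hdn : |-d| ≤ d := by rw [abs_neg, abs_of_pos hd]
  refine ⟨h0, fun i => ?_, fun i j => ?_⟩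
  · have a1 := abs_le.1 (h1 i d hdd)
    have a2 := abs_le.1 (h1 i (-d) hdn)
    rw [le_div_iff₀ hd, ← abs_of_pos hd, ← abs_mul, abs_le]
    constructor <;> linarith [a1.1, a1.2, a2.1, a2.2]
  · rw [le_div_iff₀ (by positivity), ← abs_of_pos (show 0 < d ^ 2 by positivity), ← abs_mul, abs_le]
    have a0 := abs_le.1 h0
    by_cases hij : i = j
    · subst hij
      have a1 := abs_le.1 (h1 i d hdd)
      have a2 := abs_le.1 (h1 i (-d) hdn)
      constructor <;> nlinarith [a1.1, a1.2, a2.1, a2.2, a0.1, a0.2]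
    · have key : ∀ s t : ℝ, |s| ≤ d → |t| ≤ d →
          |c + b i * s + b j * t + a i i * s ^ 2 / 2 + a j j * t ^ 2 / 2 + a i j * s * t| ≤ m := by
        intro s t hs ht
        have := h _ (ee_comb_mem i j hij hs ht)
        convert this using 2
        simp only [qp, Fin.sum_univ_three, PiLp.add_apply, PiLp.smul_apply, ee_apply, smul_eq_mul]
        have e1 := ha 1 0
        have e2 := ha 2 0
        have e3 := ha 2 1
        fin_cases i <;> fin_cases j <;> simp at hij ⊢ <;> simp only [e1, e2, e3] <;> ring
      have a1 := abs_le.1 (key d d hdd hdd)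
      have a2 := abs_le.1 (key d (-d) hdd hdn)
      have a3 := abs_le.1 (key (-d) d hdn hdd)
      have a4 := abs_le.1 (key (-d) (-d) hdn hdn)
      constructor <;> nlinarith [a1.1, a1.2, a2.1, a2.2, a3.1, a3.2, a4.1, a4.2]

lemma qp_bound {c : ℝ} {b : Fin 3 → ℝ} {a : Fin 3 → Fin 3 → ℝ} {d m0 m1 m2 : ℝ} 
    (h0 : |c| ≤ m0) (h1 : ∀ i, |b i| ≤ m1) (h2 : ∀ i j, |a i j| ≤ m2) (z : V3) (hz : z ∈ cube 0 d) :
    |qp c b a z| ≤ m0 + 3 * (m1 * d) + 9 / 2 * (m2 * d ^ 2) := by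
  have hz' : ∀ i, |z i| ≤ d := fun i => by simpa using hz i
  have hd : 0 ≤ d := (abs_nonneg _).trans (hz' 0)
  have hm1 : 0 ≤ m1 := (abs_nonneg _).trans (h1 0)
  have hm2 : 0 ≤ m2 := (abs_nonneg _).trans (h2 0 0)
  unfold qp
  refine (abs_add_three _ _ _).trans ?_
  have s1 : |∑ i, b i * z i| ≤ 3 * (m1 * d) := by
    refine (Finset.abs_sum_le_sum_abs _ _).trans ?_
    have : ∑ i : Fin 3, |b i * z i| ≤ ∑ i : Fin 3, m1 * d := by
      refine Finset.sum_le_sum fun i _ => ?_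
      rw [abs_mul]; exact mul_le_mul (h1 i) (hz' i) (abs_nonneg _) hm1
    simpa using this
  have s2 : |∑ i, ∑ j, a i j * z i * z j| ≤ 9 * (m2 * d ^ 2) := by
    refine (Finset.abs_sum_le_sum_abs _ _).trans ?_
    have : ∑ i : Fin 3, |∑ j, a i j * z i * z j| ≤ ∑ i : Fin 3, 3 * (m2 * d ^ 2) := by
      refine Finset.sum_le_sum fun i _ => ?_
      refine (Finset.abs_sum_le_sum_abs _ _).trans ?_
      have : ∑ j : Fin 3, |a i j * z i * z j| ≤ ∑ j : Fin 3, (m2 * d ^ 2) := by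
        refine Finset.sum_le_sum fun j _ => ?_
        rw [abs_mul, abs_mul, sq, ← mul_assoc]
        exact mul_le_mul (mul_le_mul (h2 i j) (hz' i) (abs_nonneg _) hm2) (hz' j) (abs_nonneg _) (by positivity)
      simpa using this
    refine this.trans (le_of_eq ?_)
    simp; ring
  rw [abs_mul, abs_of_pos (by norm_num : (0:ℝ) < 1/2)]
  linarith

lemma mem_cube_scale {z : V3} {s d : ℝ} (hs : 0 ≤ s) (hz : z ∈ cube 0 d) : s • z ∈ cube 0 (s * d) := by
  intro i
  have := hz i
  simp only [PiLp.zero_apply, sub_zero, PiLp.smul_apply, smul_eq_mul] at this ⊢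
  rw [abs_mul, abs_of_nonneg hs]; gcongr

lemma mem_ocube_scale {z : V3} {s d : ℝ} (hs : 0 < s) (hz : z ∈ ocube 0 d) : s • z ∈ ocube 0 (s * d) := by
  intro i
  have := hz i
  simp only [PiLp.zero_apply, sub_zero, PiLp.smul_apply, smul_eq_mul] at this ⊢
  rw [abs_mul, abs_of_pos hs]; gcongr

lemma qp_scale (s c : ℝ) (b : Fin 3 → ℝ) (a : Fin 3 → Fin 3 → ℝ) (z : V3) :
    qp c b a (s • z) = qp c (fun i => s * b i) (fun i j => s ^ 2 * a i j) z := by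
  simp [qp, Fin.sum_univ_three]; ring

/-- one step of the iteration -/
lemma iter {u f : V3 → ℝ} {A l ν ε : ℝ} (hA : 0 < A) (hl : 0 < l) (hl8 : l ≤ 1/8) (hν : 0 < ν)
    (hε0 : 0 ≤ ε) (hε : ε ≤ 1) (hC : C0 * (l ^ 3 + ε) ≤ l ^ 2 * ν) (h : Good u f 0 1)
    (hu : ∀ z ∈ cube 0 1, |u z| ≤ A) (hf : ∀ k : ℕ, ∀ z ∈ ocube 0 (l ^ k), |f z| ≤ ε * A * ν ^ k) (k : ℕ) :
    ∃ c b a, (∀ i j, a i j = a j i) ∧ (∑ i, a i i = 0) ∧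
      ∀ z ∈ cube 0 (l ^ k), |u z - qp c b a z| ≤ A * (l ^ 2 * ν) ^ k := by
  induction k with
  | zero =>
    refine ⟨0, 0, 0, by simp, by simp, fun z hz => ?_⟩
    have := hu z (by simpa using hz)
    simpa [qp] using this
  | succ k ih =>
    obtain ⟨c, b, a, hs, htr, hk⟩ := ih
    have hlk : 0 < l ^ k := by positivity
    set D := A * (l ^ 2 * ν) ^ k with hD
    have hDp : 0 < D := by positivity
    have hlk1 : l ^ k ≤ 1 := pow_le_one₀ hl.le (by linarith)
    have hG : Good (fun z => D⁻¹ * (u (0 + l ^ k • z) - qp c b a (0 + l ^ k • z)))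
        (fun z => D⁻¹ * ((l ^ k) ^ 2 * (f (0 + l ^ k • z) - 0))) 0 1 := by
      constructor
      · refine ContinuousOn.mul continuousOn_const (ContinuousOn.sub ?_ ?_)
        · refine h.1.comp (by fun_prop) ?_
          intro z hz
          have := mem_cube_scale hlk.le hz
          rw [mul_one] at this
          beta_reduce; rw [zero_add]
          exact cube_mono hlk1 this
        · exact ((continuous_qp c b a).comp (by fun_prop)).continuousOn
      · intro z hz
        refine HasLap.const_mul _ (HasLap.comp_affine (u := fun z => u z - qp c b a z) hlk ?_)
        have h1 := mem_ocube_scale hlk hz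
        rw [mul_one] at h1
        have h2 := (h.2 (0 + l ^ k • z) (by rw [zero_add]; exact ocube_mono hlk1 h1)).sub (hasLap_qp c b a _)
        rwa [htr] at h2
    obtain ⟨c', b', a', hs', htr', hk'⟩ := decay hG (ε := ε) (l := l) (by
        intro z hz
        have h1 := mem_cube_scale hlk.le hz
        rw [mul_one] at h1
        rw [abs_mul, zero_add, abs_of_pos (by positivity), inv_mul_le_iff₀ hDp, mul_one]
        exact hk _ h1) (by
        intro z hz
        have h1 := mem_ocube_scale hlk hz
        rw [mul_one] at h1
        rw [zero_add, sub_zero, abs_mul, abs_of_pos (by positivity), inv_mul_le_iff₀ hDp, abs_mul,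
          abs_of_pos (by positivity)]
        calc (l ^ k) ^ 2 * |f (l ^ k • z)| ≤ (l ^ k) ^ 2 * (ε * A * ν ^ k) := by gcongr; exact hf k _ h1
          _ = D * ε := by rw [hD, mul_pow]; ring) hε hl hl8
    refine ⟨c + D * c', fun i => b i + D * ((l ^ k)⁻¹ * b' i), fun i j => a i j + D * ((l ^ k)⁻¹ ^ 2 * a' i j),
      ?_, ?_, ?_⟩
    · intro i j; simp only; rw [hs i j, hs' i j]
    · rw [Finset.sum_add_distrib, htr, ← Finset.mul_sum, ← Finset.mul_sum, htr']; simp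
    · intro z hz
      rw [qp_add, qp_smul, ← qp_scale]
      have h1 := mem_cube_scale (inv_nonneg.2 hlk.le) hz
      have e : (l ^ k)⁻¹ * l ^ (k + 1) = l := by rw [pow_succ]; field_simp
      rw [e] at h1
      have h2 := (hk' _ h1).trans hC
      have e2 : l ^ k • (l ^ k)⁻¹ • z = z := by rw [smul_smul, mul_inv_cancel₀ hlk.ne', one_smul]
      rw [e2, zero_add] at h2
      have e3 : u z - (qp c b a z + D * qp c' b' a' ((l ^ k)⁻¹ • z)) =
        D * (D⁻¹ * (u z - qp c b a z) - qp c' b' a' ((l ^ k)⁻¹ • z)) := by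
        field_simp; ring
      rw [e3, abs_mul, abs_of_pos hDp, pow_succ, ← mul_assoc, ← hD]
      gcongr


lemma geo_limit {s : ℕ → ℝ} {r D : ℝ} (hr : r < 1) (h : ∀ k, |s (k + 1) - s k| ≤ D * r ^ k) :
    ∃ L, Tendsto s atTop (𝓝 L) ∧ ∀ k, |s k - L| ≤ D * r ^ k / (1 - r) := by
  have h' : ∀ k, dist (s k) (s (k + 1)) ≤ D * r ^ k := fun k => by
    rw [dist_comm, Real.dist_eq]; exact h k
  obtain ⟨L, hL⟩ := cauchySeq_tendsto_of_complete (cauchySeq_of_le_geometric r D hr h')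
  exact ⟨L, hL, fun k => by
    have := dist_le_of_le_geometric_of_tendsto r D hr h' hL k
    rwa [Real.dist_eq] at this⟩

lemma qp_sub (c c' : ℝ) (b b' : Fin 3 → ℝ) (a a' : Fin 3 → Fin 3 → ℝ) (z : V3) :
    qp (c - c') (fun i => b i - b' i) (fun i j => a i j - a' i j) z = qp c b a z - qp c' b' a' z := by
  simp only [qp, Fin.sum_univ_three]; ring

lemma limit_poly {u : V3 → ℝ} {A l ν τ : ℝ} (hA : 0 < A) (hl : 0 < l) (hl8 : l ≤ 1/8) (hν : 0 < ν)
    (hν1 : ν < 1) (hu : ∀ z ∈ cube 0 1, |u z| ≤ A)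
    (hP : ∀ k : ℕ, ∃ c b a, (∀ i j, a i j = a j i) ∧ (∑ i, a i i = τ) ∧
      ∀ z ∈ cube 0 (l ^ k), |u z - qp c b a z| ≤ A * (l ^ 2 * ν) ^ k) :
    ∃ b a, (∀ i j, a i j = a j i) ∧ (∑ i, a i i = τ) ∧ (∀ i, |b i| ≤ 100 / (l ^ 2 * (1 - ν)) * A) ∧
      (∀ i j, |a i j| ≤ 100 / (l ^ 2 * (1 - ν)) * A) ∧
      ∀ k : ℕ, ∀ z ∈ cube 0 (l ^ k), |u z - qp (u 0) b a z| ≤ 100 / (l ^ 2 * (1 - ν)) * A * (l ^ 2 * ν) ^ k := by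
  choose c b a hs htr hk using hP
  set μ := l ^ 2 * ν with hμ
  have hμ0 : 0 < μ := by positivity
  have hl1 : l < 1 := by linarith
  have hμ1 : μ ≤ 1 := by
    rw [hμ]; exact mul_le_one₀ (pow_le_one₀ hl.le hl1.le) hν.le hν1.le
  have lk : ∀ k : ℕ, 0 < l ^ k := fun k => by positivity
  have hν2 : 0 < 1 - ν := by linarith
  have diff : ∀ k, ∀ z ∈ cube 0 (l ^ (k+1)), |qp (c (k+1) - c k) (fun i => b (k+1) i - b k i)
      (fun i j => a (k+1) i j - a k i j) z| ≤ 2 * A * μ ^ k := by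
    intro k z hz
    rw [qp_sub]
    have h1 := abs_le.1 (hk (k+1) z hz)
    have h2 := abs_le.1 (hk k z (cube_mono (by rw [pow_succ]; nlinarith [lk k]) hz))
    have h3 : μ ^ (k+1) ≤ μ ^ k := by rw [pow_succ]; nlinarith [pow_pos hμ0 k]
    have h4 : A * μ ^ (k+1) ≤ A * μ ^ k := by gcongr
    rw [abs_le]; constructor <;> linarith [h1.1, h1.2, h2.1, h2.2]
  have co : ∀ k, _ := fun k => qp_coef (fun i j => by rw [hs (k+1) i j, hs k i j]) (lk (k+1)) (diff k)
  have cb : ∀ i k, |b (k+1) i - b k i| ≤ (2 * A / l) * (l * ν) ^ k := by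
    intro i k
    refine ((co k).2.1 i).trans (le_of_eq ?_)
    have e : μ ^ k = l ^ k * l ^ k * ν ^ k := by rw [hμ, ← mul_pow, ← mul_pow]; ring
    have hlk := (lk k).ne'
    rw [e, mul_pow, pow_succ]; field_simp
  have ca : ∀ i j k, |a (k+1) i j - a k i j| ≤ (8 * A / l ^ 2) * ν ^ k := by
    intro i j k
    refine ((co k).2.2 i j).trans (le_of_eq ?_)
    rw [hμ, mul_pow, ← pow_mul, ← pow_mul]; field_simp; ring
  have hlν : l * ν ≤ ν := by nlinarith
  have hlν1 : l * ν < 1 := by linarith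
  have hb := fun i => geo_limit (s := fun k => b k i) hlν1 (cb i)
  have ha := fun i j => geo_limit (s := fun k => a k i j) hν1 (ca i j)
  choose bl hbt hbl using hb
  choose al hat hal using ha
  have hbl' : ∀ i k, |b k i - bl i| ≤ 2 * A / l / (1 - ν) * (l * ν) ^ k := by
    intro i k
    refine (hbl i k).trans ?_
    rw [mul_div_right_comm]; gcongr
  have hal' : ∀ i j k, |a k i j - al i j| ≤ 8 * A / l ^ 2 / (1 - ν) * ν ^ k := by
    intro i j k
    refine (hal i j k).trans (le_of_eq ?_)
    ring
  set T := A / (l ^ 2 * (1 - ν)) with hT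
  have hT0 : 0 < T := by positivity
  have e1 : 2 * A / l / (1 - ν) = 2 * l * T := by rw [hT]; field_simp
  have e2 : 8 * A / l ^ 2 / (1 - ν) = 8 * T := by rw [hT]; field_simp
  have hAT : A ≤ T := by
    rw [hT, le_div_iff₀ (by positivity)]
    have : l ^ 2 * (1 - ν) ≤ 1 := mul_le_one₀ (pow_le_one₀ hl.le hl1.le) hν2.le (by linarith)
    nlinarith
  have e3 : 100 / (l ^ 2 * (1 - ν)) * A = 100 * T := by rw [hT]; ring
  rw [e3]
  rw [e1] at hbl'
  rw [e2] at hal'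
  have P0 : ∀ z ∈ cube 0 1, |qp (c 0) (b 0) (a 0) z| ≤ 2 * A := by
    intro z hz
    have h1 := abs_le.1 (hk 0 z (by simpa using hz))
    have h2 := abs_le.1 (hu z hz)
    simp only [pow_zero, mul_one] at h1
    rw [abs_le]; constructor <;> linarith [h1.1, h1.2, h2.1, h2.2]
  have co0 := qp_coef (hs 0) one_pos P0
  simp only [div_one, one_pow] at co0
  refine ⟨bl, al, ?_, ?_, ?_, ?_, ?_⟩
  · intro i j
    refine tendsto_nhds_unique (hat i j) ?_
    simpa only [hs _ i j] using hat j i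
  · have : Tendsto (fun k => ∑ i, a k i i) atTop (𝓝 (∑ i, al i i)) := tendsto_finsetSum _ fun i _ => hat i i
    refine tendsto_nhds_unique this ?_
    simp only [htr]; exact tendsto_const_nhds
  · intro i
    have h1 := abs_le.1 (co0.2.1 i)
    have h2 := abs_le.1 (hbl' i 0)
    simp only [pow_zero, mul_one] at h2
    have : l * T ≤ T := by nlinarith
    rw [abs_le]; constructor <;> linarith [h1.1, h1.2, h2.1, h2.2]
  · intro i j
    have h1 := abs_le.1 (co0.2.2 i j)
    have h2 := abs_le.1 (hal' i j 0)
    simp only [pow_zero, mul_one] at h2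
    rw [abs_le]; constructor <;> linarith [h1.1, h1.2, h2.1, h2.2]
  · intro k z hz
    have h0 : |c k - u 0| ≤ A * μ ^ k := by
      have := hk k 0 (by intro i; simp; exact (lk k).le)
      rw [abs_sub_comm]
      simpa [qp] using this
    have h1 := qp_bound h0 (hbl' · k) (hal' · · k) z hz
    rw [qp_sub (c k) (u 0) (b k) bl (a k) al] at h1
    have h2 := hk k z hz
    have e4 : 2 * l * T * (l * ν) ^ k * l ^ k = 2 * l * T * μ ^ k := by
      have e : μ ^ k = l ^ k * l ^ k * ν ^ k := by rw [hμ, ← mul_pow, ← mul_pow]; ring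
      rw [e, mul_pow]; ring
    have e5 : 8 * T * ν ^ k * (l ^ k) ^ 2 = 8 * T * μ ^ k := by
      rw [hμ, mul_pow, ← pow_mul, ← pow_mul]; ring
    rw [e4, e5] at h1
    have e6 : u z - qp (u 0) bl al z = (u z - qp (c k) (b k) (a k) z) +
      (qp (c k) (b k) (a k) z - qp (u 0) bl al z) := by ring
    rw [e6]
    refine (abs_add_le _ _).trans ((add_le_add h2 h1).trans ?_)
    have hmk := pow_pos hμ0 k
    have h7 : A * μ ^ k ≤ T * μ ^ k := by gcongr
    have h8 : l * T * μ ^ k ≤ T * μ ^ k := by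
      have : l * T ≤ T := by nlinarith
      gcongr
    have h9 : 0 ≤ T * μ ^ k := by positivity
    linarith

/-- second order expansion at `x` -/
def Expn (u f : V3 → ℝ) (α : ℝ) (x : V3) (K : ℝ) : Prop :=
  ∃ (b : Fin 3 → ℝ) (a : Fin 3 → Fin 3 → ℝ), (∀ i j, a i j = a j i) ∧ (∑ i, a i i = f x) ∧
    (∀ i, |b i| ≤ K) ∧ (∀ i j, |a i j| ≤ K) ∧
    ∀ z ∈ cube x 1, |u z - qp (u x) b a (z - x)| ≤ K * ‖z - x‖ ^ (2 + α)

lemma choose_l {α : ℝ} (hα0 : 0 < α) (hα1 : α < 1) : ∃ l : ℝ, 0 < l ∧ l ≤ 1/8 ∧ C0 * l ^ (1 - α) ≤ 1/2 := by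
  have h : Tendsto (fun l : ℝ => C0 * l ^ (1 - α)) (𝓝[>] 0) (𝓝 (C0 * 0 ^ (1 - α))) := by
    refine Tendsto.const_mul _ ?_
    refine Tendsto.mono_left ?_ nhdsWithin_le_nhds
    exact (continuousAt_rpow_const 0 (1 - α) (Or.inr (by linarith))).tendsto
  rw [zero_rpow (by linarith), mul_zero] at h
  have h1 := h.eventually (gt_mem_nhds (by norm_num : (0:ℝ) < 1/2))
  have h2 : ∀ᶠ l : ℝ in 𝓝[>] 0, l ∈ Ioc (0:ℝ) (1/8) := Ioc_mem_nhdsGT (by norm_num)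
  obtain ⟨l, h3, h4⟩ := (h1.and h2).exists
  exact ⟨l, h4.1, h4.2, h3.le⟩

lemma expn0 {α : ℝ} (hα0 : 0 < α) (hα1 : α < 1) : ∃ K : ℝ, 0 < K ∧ ∀ (u f : V3 → ℝ) (A : ℝ), 0 < A →
    Good u f 0 1 → (∀ z ∈ cube 0 1, |u z| ≤ A) → |f 0| ≤ A →
    (∀ z ∈ ocube 0 1, |f z - f 0| ≤ A * ‖z‖ ^ α) → Expn u f α 0 (K * A) := by
  obtain ⟨l, hl, hl8, hlC⟩ := choose_l hα0 hα1
  have hl1 : l < 1 := by linarith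
  set ν := l ^ α with hν
  have hν0 : 0 < ν := rpow_pos_of_pos hl _
  have hν1 : ν < 1 := rpow_lt_one hl.le hl1 hα0
  have hC0 := C0_pos
  have hC1 : 1 ≤ C0 := by unfold C0; norm_num
  set ε := l ^ 2 * ν / (2 * C0) with hε
  have hε0 : 0 < ε := by positivity
  have hμ1 : l ^ 2 * ν ≤ 1 := mul_le_one₀ (pow_le_one₀ hl.le hl1.le) hν0.le hν1.le
  have hε1 : ε ≤ 1 := by
    rw [hε, div_le_one (by positivity)]; linarith
  have hl3 : l ^ (1 - α) * ν = l := by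
    rw [hν, ← rpow_add hl]; simp
  have hC : C0 * (l ^ 3 + ε) ≤ l ^ 2 * ν := by
    have e1 : C0 * ε = l ^ 2 * ν / 2 := by rw [hε]; field_simp
    have e2 : C0 * l ^ 3 = (C0 * l ^ (1 - α)) * (l ^ 2 * ν) := by
      calc C0 * l ^ 3 = C0 * l ^ 2 * l := by ring
        _ = C0 * l ^ 2 * (l ^ (1 - α) * ν) := by rw [hl3]
        _ = _ := by ring
    rw [mul_add, e1, e2]
    nlinarith [show 0 < l ^ 2 * ν by positivity]
  set K1 := 100 / (l ^ 2 * (1 - ν)) with hK1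
  have hK1p : 0 < K1 := by
    have : 0 < 1 - ν := by linarith
    positivity
  set μ := l ^ 2 * ν with hμ
  have hμ0 : 0 < μ := by positivity
  have hμk : ∀ k : ℕ, (l ^ k) ^ (2 + α) = μ ^ k := by
    intro k
    rw [hμ, rpow_add (by positivity), hν, mul_pow, ← rpow_natCast (l ^ α) k, ← rpow_mul hl.le,
      ← rpow_natCast l k, ← rpow_mul hl.le, ← rpow_mul hl.le, ← rpow_natCast (l ^ 2) k, ← rpow_natCast l 2,
      ← rpow_mul hl.le]
    congr 2 <;> push_cast <;> ring
  have hνk : ∀ k : ℕ, (l ^ k) ^ α = ν ^ k := by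
    intro k
    rw [hν, ← rpow_natCast (l ^ α) k, ← rpow_mul hl.le, ← rpow_natCast l k, ← rpow_mul hl.le, mul_comm]
  refine ⟨K1 * (3 / ε) / μ + K1 * (3 / ε) + 1, by positivity, fun u f A hA h hu hf0 hf => ?_⟩
  set A' := 3 * A / ε with hA'
  have hA'0 : 0 < A' := by positivity
  have hAA' : 3 * A ≤ A' := by rw [hA', le_div_iff₀ hε0]; nlinarith
  set q := qp 0 0 (qdiag (f 0)) with hq
  have hG : Good (fun z => u z - q z) (fun z => f z - f 0) 0 1 := by
    refine ⟨h.1.sub (continuous_qp _ _ _).continuousOn, fun z hz => (h.2 z hz).sub ?_⟩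
    have := hasLap_qp 0 0 (qdiag (f 0)) z
    rwa [qdiag_trace] at this
  have hub : ∀ z ∈ cube 0 1, |u z - q z| ≤ A' := by
    intro z hz
    refine (abs_sub _ _).trans ?_
    have h1 := hu z hz
    have h2 : ∀ i, z i ^ 2 ≤ 1 := by
      intro i
      have := hz i
      simp at this
      rw [← sq_abs]; exact pow_le_one₀ (abs_nonneg _) this
    have h3 : |q z| ≤ A / 2 := by
      rw [hq, qdiag_val, abs_mul, abs_of_nonneg (by positivity : 0 ≤ z 0 ^ 2 + z 1 ^ 2 + z 2 ^ 2), abs_div,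
        abs_of_pos (by norm_num : (0:ℝ) < 6)]
      have := mul_le_mul hf0 (add_le_add (add_le_add (h2 0) (h2 1)) (h2 2)) (by positivity) hA.le
      linarith
    linarith
  have hfb : ∀ k : ℕ, ∀ z ∈ ocube 0 (l ^ k), |f z - f 0| ≤ ε * A' * ν ^ k := by
    intro k z hz
    have hz1 : z ∈ ocube 0 1 := ocube_mono (pow_le_one₀ hl.le hl1.le) hz
    refine (hf z hz1).trans ?_
    have h1 := norm_le_of_mem_cube (ocube_subset_cube _ _ hz)
    rw [sub_zero] at h1
    have h2 : ‖z‖ ^ α ≤ 3 * ν ^ k := by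
      calc ‖z‖ ^ α ≤ (3 * l ^ k) ^ α := rpow_le_rpow (norm_nonneg _) h1 hα0.le
        _ = 3 ^ α * ν ^ k := by rw [mul_rpow (by norm_num) (by positivity), hνk]
        _ ≤ 3 * ν ^ k := by
          gcongr
          calc (3:ℝ) ^ α ≤ 3 ^ (1:ℝ) := rpow_le_rpow_of_exponent_le (by norm_num) hα1.le
            _ = 3 := by simp
    have e : ε * A' = 3 * A := by rw [hA']; field_simp
    rw [e]; nlinarith
  obtain ⟨b, a, hs, htr, hb, ha, hk⟩ := limit_poly (τ := 0) hA'0 hl hl8 hν0 hν1 hub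
    (iter hA'0 hl hl8 hν0 hε0.le hε1 hC hG hub hfb)
  rw [← hK1] at hb ha hk
  have hKA : K1 * A' ≤ (K1 * (3 / ε) + 1) * A := by
    rw [hA']
    have : K1 * (3 * A / ε) = K1 * (3 / ε) * A := by ring
    rw [this]; linarith
  have hKmA : K1 * A' / μ ≤ (K1 * (3 / ε) / μ) * A := by
    rw [hA']
    exact le_of_eq (by ring)
  have hpos1 : 0 ≤ K1 * (3 / ε) / μ * A := by positivity
  have hpos2 : 0 ≤ K1 * (3 / ε) * A := by positivity
  refine ⟨b, fun i j => a i j + qdiag (f 0) i j, ?_, ?_, ?_, ?_, ?_⟩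
  · intro i j; simp only; rw [hs i j, qdiag_symm]
  · rw [Finset.sum_add_distrib, htr, qdiag_trace]; ring
  · intro i
    refine (hb i).trans (hKA.trans ?_)
    linarith
  · intro i j
    refine (abs_add_le _ _).trans ?_
    have : |qdiag (f 0) i j| ≤ A := by
      unfold qdiag
      split_ifs
      · rw [abs_div, abs_of_pos (by norm_num : (0:ℝ) < 3)]; linarith [abs_nonneg (f 0)]
      · simpa using hA.le
    have := ha i j
    have e : K1 * A' = K1 * (3 / ε) * A := by rw [hA']; ring
    rw [e] at this
    linarith
  · intro z hz
    rw [sub_zero]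
    have hq0 : q 0 = 0 := by rw [hq, qdiag_val]; simp
    have e : u z - qp (u 0) b (fun i j => a i j + qdiag (f 0) i j) z =
        u z - q z - qp (u 0 - q 0) b a z := by
      rw [hq0, sub_zero]
      have := qp_add (u 0) 0 b 0 a (qdiag (f 0)) z
      simp only [add_zero, Pi.zero_apply] at this
      rw [this, hq]; ring
    rw [e]
    have fin : ∀ k : ℕ, z ∈ cube 0 (l ^ k) → l ^ (k + 1) < ‖z‖ →
        |u z - q z - qp (u 0 - q 0) b a z| ≤ (K1 * (3 / ε) / μ + K1 * (3 / ε) + 1) * A * ‖z‖ ^ (2 + α) := by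
      intro k h1 h2
      refine (hk k z h1).trans ?_
      have h3 : μ ^ (k+1) ≤ ‖z‖ ^ (2 + α) := by
        rw [← hμk]; exact rpow_le_rpow (by positivity) h2.le (by linarith)
      have h4 : K1 * A' * μ ^ k = K1 * A' / μ * μ ^ (k+1) := by rw [pow_succ]; field_simp
      rw [h4]
      calc K1 * A' / μ * μ ^ (k+1) ≤ (K1 * (3 / ε) / μ) * A * ‖z‖ ^ (2 + α) := by gcongr
        _ ≤ _ := by gcongr; nlinarith
    by_cases hz0 : z = 0
    · subst hz0
      have : qp (u 0 - q 0) b a 0 = u 0 - q 0 := by simp [qp]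
      rw [this, sub_self, abs_zero]; positivity
    have hzn : 0 < ‖z‖ := norm_pos_iff.2 hz0
    rcases le_or_gt ‖z‖ 1 with h1 | h1
    · obtain ⟨k, hk1, hk2⟩ := exists_nat_pow_near_of_lt_one hzn h1 hl hl1
      refine fin k ?_ hk1
      intro i
      rw [PiLp.zero_apply, sub_zero]
      exact (abs_apply_le_norm z i).trans hk2
    · refine fin 0 (by simpa using hz) ?_
      rw [zero_add, pow_one]; linarith

lemma expn {α : ℝ} (hα0 : 0 < α) (hα1 : α < 1) : ∃ K : ℝ, 0 < K ∧ ∀ (u f : V3 → ℝ) (x : V3) (A : ℝ), 0 < A →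
    Good u f x 1 → (∀ z ∈ cube x 1, |u z| ≤ A) → |f x| ≤ A →
    (∀ z ∈ ocube x 1, |f z - f x| ≤ A * ‖z - x‖ ^ α) → Expn u f α x (K * A) := by
  obtain ⟨K, hK, h⟩ := expn0 hα0 hα1
  refine ⟨K, hK, fun u f x A hA hG hu hf0 hf => ?_⟩
  have hc : ∀ z, z ∈ cube 0 1 → z + x ∈ cube x 1 := by
    intro z hz j; have := hz j; simpa using this
  have ho : ∀ z, z ∈ ocube 0 1 → z + x ∈ ocube x 1 := by
    intro z hz j; have := hz j; simpa using this
  obtain ⟨b, a, hs, htr, hb, ha, he⟩ := h (fun z => u (z + x)) (fun z => f (z + x)) A hA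
    ⟨hG.1.comp (by fun_prop) hc, fun z hz => HasLap.shift (hG.2 _ (ho z hz))⟩
    (fun z hz => hu _ (hc z hz)) (by simpa using hf0)
    (fun z hz => by have := hf _ (ho z hz); simpa using this)
  refine ⟨b, a, hs, by simpa using htr, hb, ha, fun z hz => ?_⟩
  have := he (z - x) (by intro j; have := hz j; simpa using this)
  simpa using this


/-- linear form with coefficients `c` -/
def LL (c : Fin 3 → ℝ) : V3 →L[ℝ] ℝ := ∑ i, c i • (EuclideanSpace.proj i : V3 →L[ℝ] ℝ)

lemma LL_apply (c : Fin 3 → ℝ) (z : V3) : LL c z = ∑ i, c i * z i := by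
  simp [LL]

lemma LL_ee (c : Fin 3 → ℝ) (i : Fin 3) : LL c (ee i) = c i := by
  rw [LL_apply]; simp [ee_apply]

lemma eq_LL (L : V3 →L[ℝ] ℝ) : L = LL (fun i => L (ee i)) := by
  ext z
  rw [LL_apply]
  conv_lhs => rw [v3_eq_sum z]
  simp [Fin.sum_univ_three, mul_comm]

lemma cube_mem_nhds (x : V3) {d : ℝ} (hd : 0 < d) : cube x d ∈ 𝓝 x :=
  mem_of_superset ((isOpen_ocube x d).mem_nhds (by intro i; simp; exact hd)) (ocube_subset_cube x d)

lemma mem_cube_norm (x z : V3) : z ∈ cube x ‖z - x‖ := fun i => abs_apply_le_norm (z - x) i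

lemma qp_quad_bound {a : Fin 3 → Fin 3 → ℝ} {K : ℝ} (ha : ∀ i j, |a i j| ≤ K) (z : V3) :
    |qp 0 0 a z| ≤ 9 / 2 * (K * ‖z‖ ^ 2) := by
  have := qp_bound (c := 0) (b := 0) (m0 := 0) (m1 := 0) (by simp) (by simp) ha z (d := ‖z‖)
    (by simpa using mem_cube_norm 0 z)
  simpa using this

lemma qp_split (c : ℝ) (b : Fin 3 → ℝ) (a : Fin 3 → Fin 3 → ℝ) (z : V3) :
    qp c b a z = c + LL b z + qp 0 0 a z := by
  rw [LL_apply]; simp [qp]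

lemma hasFDerivAt_of_bound {w : V3 → ℝ} {x : V3} {L : V3 →L[ℝ] ℝ} {C p : ℝ} (hp : 1 < p) {s : Set V3}
    (hs : s ∈ 𝓝 x) (h : ∀ z ∈ s, |w z - w x - L (z - x)| ≤ C * ‖z - x‖ ^ p) : HasFDerivAt w L x := by
  rw [hasFDerivAt_iff_isLittleO]
  have h1 : (fun z => w z - w x - L (z - x)) =O[𝓝 x] fun z => ‖z - x‖ ^ p := by
    refine Asymptotics.IsBigO.of_bound C ?_
    filter_upwards [hs] with z hz
    rw [Real.norm_eq_abs, Real.norm_of_nonneg (rpow_nonneg (norm_nonneg _) _)]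
    exact h z hz
  refine h1.trans_isLittleO ?_
  have e : (fun z : V3 => ‖z - x‖ ^ p) = fun z => ‖z - x‖ ^ (p - 1) * ‖z - x‖ := by
    ext z
    rcases eq_or_ne ‖z - x‖ 0 with h0 | h0
    · rw [h0, zero_rpow (by linarith)]; simp
    · rw [← rpow_add_one h0]; simp
  rw [e]
  have h2 : Tendsto (fun z : V3 => ‖z - x‖ ^ (p - 1)) (𝓝 x) (𝓝 0) := by
    have : ContinuousAt (fun z : V3 => ‖z - x‖ ^ (p - 1)) x := by
      refine ContinuousAt.rpow_const (by fun_prop) (Or.inr (by linarith))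
    have h3 := this.tendsto
    simp only [sub_self, norm_zero] at h3
    rwa [zero_rpow (by linarith)] at h3
  have h3 : (fun z : V3 => ‖z - x‖ ^ (p - 1) * ‖z - x‖) =o[𝓝 x] fun z => 1 * ‖z - x‖ :=
    ((Asymptotics.isLittleO_one_iff ℝ).2 h2).mul_isBigO (Asymptotics.isBigO_refl _ _)
  simpa using h3.norm_right

section
variable {u f : V3 → ℝ} {α K : ℝ} {x y : V3} {b b' : Fin 3 → ℝ} {a a' : Fin 3 → Fin 3 → ℝ}

lemma rpow_le_small {t p q : ℝ} (ht : 0 ≤ t) (ht1 : t ≤ 1) (hq : 0 < q) (hpq : q ≤ p) : t ^ p ≤ t ^ q := by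
  rcases ht.eq_or_lt with h | h
  · rw [← h, zero_rpow (by linarith), zero_rpow (by linarith)]
  · exact rpow_le_rpow_of_exponent_ge h ht1 hpq

lemma exp_fderiv (hα : 0 < α) (ha : ∀ i j, |a i j| ≤ K)
    (h : ∀ z ∈ cube x 1, |u z - qp (u x) b a (z - x)| ≤ K * ‖z - x‖ ^ (2 + α)) :
    HasFDerivAt u (LL b) x := by
  have hK : 0 ≤ K := (abs_nonneg _).trans (ha 0 0)
  refine hasFDerivAt_of_bound (C := 6 * K) (p := 2) (by norm_num)
    (inter_mem (cube_mem_nhds x one_pos) (Metric.closedBall_mem_nhds x one_pos)) fun z hz => ?_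
  have h1 := abs_le.1 (h z hz.1)
  have h2 := abs_le.1 (qp_quad_bound ha (z - x))
  have hz2 : ‖z - x‖ ≤ 1 := by simpa [dist_eq_norm] using hz.2
  have h3 : ‖z - x‖ ^ (2 + α) ≤ ‖z - x‖ ^ (2:ℝ) := rpow_le_small (norm_nonneg _) hz2 (by norm_num) (by linarith)
  rw [qp_split] at h1
  have h4 : ‖z - x‖ ^ (2:ℝ) = ‖z - x‖ ^ 2 := by norm_cast
  rw [h4] at h3 ⊢
  have h5 : K * ‖z - x‖ ^ (2 + α) ≤ K * ‖z - x‖ ^ 2 := by gcongr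
  have h6 : 0 ≤ K * ‖z - x‖ ^ 2 := by positivity
  rw [abs_le]; constructor <;> linarith [h1.1, h1.2, h2.1, h2.2]

lemma exp_hasLap (hα : 0 < α)
    (h : ∀ z ∈ cube x 1, |u z - qp (u x) b a (z - x)| ≤ K * ‖z - x‖ ^ (2 + α)) :
    HasLap u x (∑ i, a i i) := by
  have h1 : HasLap (fun z => u z - qp (u x) b a (z - x)) x 0 := by
    have hcube := cube_mem_nhds x one_pos
    have hp : ∀ᶠ t : ℝ in 𝓝[>] 0, ∀ i, x + t • ee i ∈ cube x 1 :=
      eventually_all.2 fun i => (tendsto_line x (ee i)).eventually hcube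
    have hm : ∀ᶠ t : ℝ in 𝓝[>] 0, ∀ i, x - t • ee i ∈ cube x 1 :=
      eventually_all.2 fun i => (tendsto_line' x (ee i)).eventually hcube
    have h0 : u x - qp (u x) b a (x - x) = 0 := by simp [qp]
    refine squeeze_zero_norm' (a := fun t => 6 * K * t ^ α) ?_ ?_
    · filter_upwards [hp, hm, self_mem_nhdsWithin] with t h1 h2 ht
      have ht : 0 < t := ht
      beta_reduce
      rw [h0, Real.norm_eq_abs, abs_div, abs_of_pos (by positivity : 0 < t ^ 2), div_le_iff₀ (by positivity)]
      refine (Finset.abs_sum_le_sum_abs _ _).trans ?_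
      have e : 6 * K * t ^ α * t ^ 2 = ∑ i : Fin 3, (K * t ^ (2 + α) + K * t ^ (2 + α)) := by
        rw [rpow_add ht]; simp; ring
      rw [e]
      refine Finset.sum_le_sum fun i _ => ?_
      rw [mul_zero, sub_zero]
      have g1 := h _ (h1 i)
      have g2 := h _ (h2 i)
      have n1 : ‖x + t • ee i - x‖ = t := by
        rw [add_sub_cancel_left, norm_smul, norm_ee, Real.norm_eq_abs, abs_of_pos ht, mul_one]
      have n2 : ‖x - t • ee i - x‖ = t := by
        rw [sub_sub_cancel_left, norm_neg, norm_smul, norm_ee, Real.norm_eq_abs, abs_of_pos ht, mul_one]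
      rw [n1] at g1
      rw [n2] at g2
      exact (abs_add_le _ _).trans (add_le_add g1 g2)
    · have : Tendsto (fun t : ℝ => t ^ α) (𝓝[>] 0) (𝓝 0) := by
        have := (continuousAt_rpow_const (0:ℝ) α (Or.inr hα.le)).tendsto
        rw [zero_rpow hα.ne'] at this
        exact this.mono_left nhdsWithin_le_nhds
      simpa using this.const_mul (6 * K)
  have h2 : HasLap (fun z => qp (u x) b a (z + -x)) x (∑ i, a i i) := HasLap.shift (hasLap_qp _ _ _ _)
  have h3 := h1.add h2
  simpa [sub_eq_add_neg] using h3

/-- comparing expansions at two points -/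
lemma exp_compare (hα0 : 0 < α) (hα1 : α < 1) (hs : ∀ i j, a i j = a j i) (hs' : ∀ i j, a' i j = a' j i)
    (hK : 0 ≤ K)
    (h : ∀ z ∈ cube x 1, |u z - qp (u x) b a (z - x)| ≤ K * ‖z - x‖ ^ (2 + α))
    (h' : ∀ z ∈ cube y 1, |u z - qp (u y) b' a' (z - y)| ≤ K * ‖z - y‖ ^ (2 + α))
    (hxy : ‖y - x‖ ≤ 1 / 2) (h0 : y ≠ x) :
    (∀ i, |b' i - b i - LL (a i) (y - x)| ≤ 128 * K * ‖y - x‖ ^ (1 + α)) ∧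
    ∀ i j, |a' i j - a i j| ≤ 512 * K * ‖y - x‖ ^ α := by
  set t := ‖y - x‖ with ht
  have ht0 : 0 < t := norm_pos_iff.2 (sub_ne_zero.2 h0)
  have key : ∀ z ∈ cube 0 t, |qp (qp (u x) b a (y - x) - u y) (fun i => (b i + ∑ j, a i j * (y - x) j) - b' i)
      (fun i j => a i j - a' i j) z| ≤ 128 * K * t ^ (2 + α) := by
    intro z hz
    rw [qp_sub, ← qp_shift _ _ _ hs]
    have hzt : ∀ i, |z i| ≤ t := fun i => by simpa using hz i
    have m1 : z + y ∈ cube y 1 := by intro i; have := hzt i; simp; linarith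
    have m2 : z + y ∈ cube x 1 := by
      intro i
      have e : (z + y) i - x i = z i + (y - x) i := by simp; ring
      rw [e]
      refine (abs_add_le _ _).trans ?_
      have := abs_apply_le_norm (y - x) i
      linarith [hzt i]
    have h1 := abs_le.1 (h _ m2)
    have h2 := abs_le.1 (h' _ m1)
    have n0 := norm_le_of_mem_cube hz
    rw [sub_zero] at n0
    have n1 : ‖z + y - x‖ ≤ 4 * t := by
      rw [add_sub_assoc]; exact (norm_add_le _ _).trans (by linarith)
    have b4 : (4 * t) ^ (2 + α) ≤ 64 * t ^ (2 + α) := by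
      rw [mul_rpow (by norm_num) ht0.le]
      gcongr
      calc (4:ℝ) ^ (2 + α) ≤ 4 ^ (3:ℝ) := rpow_le_rpow_of_exponent_le (by norm_num) (by linarith)
        _ = 64 := by norm_num
    have p1 : K * ‖z + y - x‖ ^ (2 + α) ≤ K * (64 * t ^ (2 + α)) := by
      gcongr
      exact (rpow_le_rpow (norm_nonneg _) n1 (by linarith)).trans b4
    rw [add_sub_cancel_right] at h2
    have p2 : K * ‖z‖ ^ (2 + α) ≤ K * (64 * t ^ (2 + α)) := by
      gcongr
      exact (rpow_le_rpow (norm_nonneg _) (by linarith : ‖z‖ ≤ 4 * t) (by linarith)).trans b4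
    have e : z + (y - x) = z + y - x := by abel
    rw [e, abs_le]; constructor <;> linarith [h1.1, h1.2, h2.1, h2.2]
  obtain ⟨-, hb, ha⟩ := qp_coef (fun i j => by rw [hs, hs']) ht0 key
  constructor
  · intro i
    have := hb i
    rw [abs_sub_comm] at this
    rw [LL_apply]
    have e : b' i - (b i + ∑ j, a i j * (y - x) j) = b' i - b i - ∑ j, a i j * (y - x) j := by ring
    rw [e] at this
    refine this.trans (le_of_eq ?_)
    rw [show (2:ℝ) + α = (1 + α) + 1 by ring, rpow_add_one ht0.ne' (1 + α)]; field_simp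
  · intro i j
    have := ha i j
    rw [abs_sub_comm] at this
    refine this.trans (le_of_eq ?_)
    rw [show (2:ℝ) + α = α + 2 by ring, rpow_add ht0]; norm_cast; field_simp; ring

end

lemma expn_limit {w : ℕ → V3 → ℝ} {g : ℕ → V3 → ℝ} {u f : V3 → ℝ} {α K : ℝ} {x : V3} 
    (h : ∀ n, Expn (w n) (g n) α x K) (hw : ∀ z ∈ cube x 1, Tendsto (fun n => w n z) atTop (𝓝 (u z)))
    (hg : Tendsto (fun n => g n x) atTop (𝓝 (f x))) : Expn u f α x K := by
  choose b a hs htr hb ha he using h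
  have hx : x ∈ cube x 1 := by intro i; simp
  have hK : 0 ≤ K := (abs_nonneg _).trans (hb 0 0)
  have hbd : ∀ n, ((b n, a n) : (Fin 3 → ℝ) × (Fin 3 → Fin 3 → ℝ)) ∈ Metric.closedBall 0 K := by
    intro n
    rw [mem_closedBall_zero_iff, Prod.norm_def, max_le_iff]
    constructor
    · exact (pi_norm_le_iff_of_nonneg hK).2 (hb n)
    · exact (pi_norm_le_iff_of_nonneg hK).2 fun i => (pi_norm_le_iff_of_nonneg hK).2 (ha n i)
  obtain ⟨⟨bl, al⟩, -, φ, hφ, hlim⟩ := tendsto_subseq_of_bounded Metric.isBounded_closedBall hbd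
  have hlim := Prod.tendsto_iff _ _ |>.1 hlim
  have lb : ∀ i, Tendsto (fun n => b (φ n) i) atTop (𝓝 (bl i)) := fun i => (tendsto_pi_nhds.1 hlim.1 i)
  have la : ∀ i j, Tendsto (fun n => a (φ n) i j) atTop (𝓝 (al i j)) := fun i j =>
    (tendsto_pi_nhds.1 (tendsto_pi_nhds.1 hlim.2 i) j)
  refine ⟨bl, al, ?_, ?_, ?_, ?_, ?_⟩
  · intro i j
    refine tendsto_nhds_unique (la i j) ?_
    simpa only [hs _ i j] using la j i
  · have : Tendsto (fun k => ∑ i, a (φ k) i i) atTop (𝓝 (∑ i, al i i)) := tendsto_finsetSum _ fun i _ => la i i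
    refine tendsto_nhds_unique this ?_
    simp only [htr]; exact hg.comp hφ.tendsto_atTop
  · exact fun i => le_of_tendsto (lb i).abs (Eventually.of_forall fun n => hb _ i)
  · exact fun i j => le_of_tendsto (la i j).abs (Eventually.of_forall fun n => ha _ i j)
  · intro z hz
    have hq : Tendsto (fun n => qp (w (φ n) x) (b (φ n)) (a (φ n)) (z - x)) atTop (𝓝 (qp (u x) bl al (z - x))) := by
      unfold qp
      refine ((((hw x hx).comp hφ.tendsto_atTop)).add (tendsto_finsetSum _ fun i _ => (lb i).mul_const _)).add
        (Tendsto.const_mul _ (tendsto_finsetSum _ fun i _ => tendsto_finsetSum _ fun j _ =>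
          ((la i j).mul_const _).mul_const _))
    refine le_of_tendsto (((hw z hz).comp hφ.tendsto_atTop).sub hq).abs (Eventually.of_forall fun n => ?_)
    exact he _ z hz


/-- bounded and Hölder -/
def BH (S : Set V3) (α : ℝ) (u : V3 → ℝ) (A : ℝ) : Prop :=
  (∀ x ∈ S, |u x| ≤ A) ∧ ∀ x ∈ S, ∀ y ∈ S, |u x - u y| ≤ A * ‖x - y‖ ^ α

lemma BH.mono {S S' : Set V3} {α A A' : ℝ} {u : V3 → ℝ} (h : BH S α u A) (hA : A ≤ A') (hS : S' ⊆ S) :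
    BH S' α u A' := by
  refine ⟨fun x hx => (h.1 x (hS hx)).trans hA, fun x hx y hy => (h.2 x (hS hx) y (hS hy)).trans ?_⟩
  gcongr

lemma half_rpow {t α : ℝ} (hα0 : 0 < α) (hα1 : α < 1) (ht : 1 / 2 ≤ t) : 1 / 2 ≤ t ^ α := by
  calc (1:ℝ) / 2 = (1 / 2) ^ (1:ℝ) := by simp
    _ ≤ (1 / 2) ^ α := rpow_le_rpow_of_exponent_ge (by norm_num) (by norm_num) hα1.le
    _ ≤ t ^ α := by gcongr

lemma BH_of_near {S : Set V3} {α A B : ℝ} {u : V3 → ℝ} (hα0 : 0 < α) (hα1 : α < 1) (h1 : ∀ x ∈ S, |u x| ≤ B)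
    (h2 : ∀ x ∈ S, ∀ y ∈ S, y ≠ x → ‖y - x‖ ≤ 1 / 2 → |u y - u x| ≤ A * ‖y - x‖ ^ α) (hB : B ≤ A) (hBA : 4 * B ≤ A) :
    BH S α u A := by
  refine ⟨fun x hx => (h1 x hx).trans hB, fun x hx y hy => ?_⟩
  have hB0 : 0 ≤ B := (abs_nonneg _).trans (h1 x hx)
  have hA0 : 0 ≤ A := hB0.trans hB
  by_cases hxy : x = y
  · subst hxy; simp; positivity
  by_cases hn : ‖x - y‖ ≤ 1 / 2
  · exact h2 y hy x hx hxy hn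
  · have := half_rpow hα0 hα1 (not_le.1 hn).le
    calc |u x - u y| ≤ |u x| + |u y| := abs_sub _ _
      _ ≤ 2 * B := by linarith [h1 x hx, h1 y hy]
      _ ≤ A * (1 / 2) := by linarith
      _ ≤ A * ‖x - y‖ ^ α := by gcongr

lemma LL_bound {c : Fin 3 → ℝ} {m : ℝ} (h : ∀ i, |c i| ≤ m) (z : V3) : |LL c z| ≤ 3 * m * ‖z‖ := by
  rw [LL_apply]
  refine (Finset.abs_sum_le_sum_abs _ _).trans ?_
  have : ∀ i : Fin 3, |c i * z i| ≤ m * ‖z‖ := fun i => by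
    rw [abs_mul]
    exact mul_le_mul (h i) (abs_apply_le_norm z i) (abs_nonneg _) ((abs_nonneg _).trans (h i))
  refine (Finset.sum_le_sum fun i _ => this i).trans (le_of_eq ?_)
  simp; ring

lemma ocube_convex (x : V3) (d : ℝ) : Convex ℝ (ocube x d) := by
  intro y hy z hz s t hs ht hst i
  have h1 := abs_lt.1 (hy i)
  have h2 := abs_lt.1 (hz i)
  have e : (s • y + t • z) i - x i = s * (y i - x i) + t * (z i - x i) := by
    simp only [PiLp.add_apply, PiLp.smul_apply, smul_eq_mul]
    linear_combination (x i) * hst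
  rw [e]
  have h3 : s * |y i - x i| + t * |z i - x i| < d := by
    rcases hs.eq_or_lt with h | h
    · have : t = 1 := by linarith
      subst this; rw [← h]; simpa using hz i
    · nlinarith [hy i, hz i, mul_lt_mul_of_pos_left (hy i) h, mul_le_mul_of_nonneg_left (hz i).le ht]
  refine (abs_add_le _ _).trans_lt ?_
  rwa [abs_mul, abs_mul, abs_of_nonneg hs, abs_of_nonneg ht]

/-- interior C^{2,α} estimate -/
lemma base {α : ℝ} (hα0 : 0 < α) (hα1 : α < 1) : ∃ C : ℝ, 0 < C ∧ ∀ (U F : V3 → ℝ) (x : V3) (A : ℝ), 0 < A →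
    Good U F x 2 → (∀ z ∈ cube x 2, |U z| ≤ A) → BH (ocube x 2) α F A →
    ∃ (b : Fin 3 → V3 → ℝ) (a : Fin 3 → Fin 3 → V3 → ℝ),
      (∀ y ∈ ocube x 1, HasFDerivAt U (LL fun i => b i y) y) ∧
      (∀ i, ∀ y ∈ ocube x 1, HasFDerivAt (b i) (LL fun j => a i j y) y) ∧
      (∀ i j y, a i j y = a j i y) ∧ (∀ y ∈ ocube x 1, ∑ i, a i i y = F y) ∧
      BH (ocube x 1) α U (C * A) ∧ (∀ i, BH (ocube x 1) α (b i) (C * A)) ∧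
      (∀ i j, BH (ocube x 1) α (a i j) (C * A)) := by
  obtain ⟨K, hK, hE⟩ := expn hα0 hα1
  refine ⟨512 * K + 9, by positivity, fun U F x A hA hG hU hF => ?_⟩
  have ex : ∀ y, y ∈ ocube x 1 → Expn U F α y (K * A) := by
    intro y hy
    have hs : ∀ z, z ∈ cube y 1 → z ∈ ocube x 2 := fun z hz i => by
      have := abs_sub_le (z i) (y i) (x i)
      linarith [hz i, hy i]
    have hyo : y ∈ ocube x 2 := ocube_mono (by norm_num) hy
    refine hE U F y A hA (hG.mono fun i => by linarith [hy i]) (fun z hz => hU z (ocube_subset_cube _ _ (hs z hz)))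
      (hF.1 y hyo) fun z hz => hF.2 z (hs z (ocube_subset_cube _ _ hz)) y hyo
  have ex' : ∀ y, ∃ (b : Fin 3 → ℝ) (a : Fin 3 → Fin 3 → ℝ), (∀ i j, a i j = a j i) ∧ (y ∈ ocube x 1 → (∑ i, a i i = F y) ∧
    (∀ i, |b i| ≤ K * A) ∧ (∀ i j, |a i j| ≤ K * A) ∧
    ∀ z ∈ cube y 1, |U z - qp (U y) b a (z - y)| ≤ K * A * ‖z - y‖ ^ (2 + α)) := by
    intro y
    by_cases hy : y ∈ ocube x 1
    · obtain ⟨b, a, h1, h2⟩ := ex y hy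
      exact ⟨b, a, h1, fun _ => h2⟩
    · exact ⟨0, 0, fun _ _ => rfl, fun h => absurd h hy⟩
  choose b a hs hba using ex'
  have hKA : 0 < K * A := by positivity
  have hcmp : ∀ y ∈ ocube x 1, ∀ z ∈ ocube x 1, z ≠ y → ‖z - y‖ ≤ 1 / 2 → _ := fun y hy z hz h0 hn =>
    exp_compare hα0 hα1 (hs y) (hs z) hKA.le (hba y hy).2.2.2 (hba z hz).2.2.2 hn h0
  have hfd : ∀ y ∈ ocube x 1, HasFDerivAt U (LL (b y)) y := fun y hy => exp_fderiv hα0 (hba y hy).2.2.1 (hba y hy).2.2.2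
  have p1 : ∀ t : ℝ, 0 ≤ t → t ≤ 1 / 2 → t ≤ t ^ α := fun t h0 h1 => by
    simpa using rpow_le_small h0 (by linarith : t ≤ 1) hα0 hα1.le
  have hC : 512 * (K * A) ≤ (512 * K + 9) * A := by nlinarith
  refine ⟨fun i y => b y i, fun i j y => a y i j, hfd, ?_, fun i j y => hs y i j, fun y hy => (hba y hy).1, ?_, ?_, ?_⟩
  · intro i y hy
    refine hasFDerivAt_of_bound (C := 128 * (K * A)) (p := 1 + α) (by linarith)
      (inter_mem ((isOpen_ocube x 1).mem_nhds hy) (Metric.closedBall_mem_nhds y (by norm_num : (0:ℝ) < 1 / 2))) ?_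
    intro z hz
    by_cases h0 : z = y
    · subst h0; simp [zero_rpow (by linarith : 1 + α ≠ 0)]
    · exact (hcmp y hy z hz.1 h0 (by simpa [dist_eq_norm] using hz.2)).1 i
  · have hU1 : ∀ y ∈ ocube x 1, |U y| ≤ A := fun y hy => hU y (ocube_subset_cube _ _ (ocube_mono (by norm_num) hy))
    refine BH_of_near hα0 hα1 hU1 ?_ (by nlinarith) (by nlinarith)
    intro y hy z hz h0 hn
    have hz1 : z ∈ cube y 1 := cube_mono (by linarith) (mem_cube_norm y z)
    have g1 := abs_le.1 ((hba y hy).2.2.2 z hz1)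
    have g2 := abs_le.1 (LL_bound (hba y hy).2.1 (z - y))
    have g3 := abs_le.1 (qp_quad_bound (hba y hy).2.2.1 (z - y))
    rw [qp_split] at g1
    have q1 := p1 _ (norm_nonneg (z - y)) hn
    have q2 : ‖z - y‖ ^ (2 + α) ≤ ‖z - y‖ ^ α := rpow_le_small (norm_nonneg _) (by linarith) hα0 (by linarith)
    have q3 : ‖z - y‖ ^ 2 ≤ ‖z - y‖ ^ α := by nlinarith [norm_nonneg (z - y)]
    have q4 := mul_le_mul_of_nonneg_left q1 hKA.le
    have q5 := mul_le_mul_of_nonneg_left q2 hKA.le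
    have q6 := mul_le_mul_of_nonneg_left q3 hKA.le
    have q0 : 0 ≤ K * A * ‖z - y‖ ^ α := by positivity
    have q7 : 512 * (K * A) * ‖z - y‖ ^ α ≤ (512 * K + 9) * A * ‖z - y‖ ^ α := by gcongr
    rw [abs_le]; constructor <;> nlinarith
  · intro i
    refine BH_of_near hα0 hα1 (fun y hy => (hba y hy).2.1 i) ?_ (by nlinarith) (by nlinarith)
    intro y hy z hz h0 hn
    have g1 := abs_le.1 ((hcmp y hy z hz h0 hn).1 i)
    have g2 := abs_le.1 (LL_bound ((hba y hy).2.2.1 i) (z - y))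
    have q1 := p1 _ (norm_nonneg (z - y)) hn
    have q2 : ‖z - y‖ ^ (1 + α) ≤ ‖z - y‖ ^ α := rpow_le_small (norm_nonneg _) (by linarith) hα0 (by linarith)
    have q4 := mul_le_mul_of_nonneg_left q1 hKA.le
    have q5 := mul_le_mul_of_nonneg_left q2 hKA.le
    have q0 : 0 ≤ K * A * ‖z - y‖ ^ α := by positivity
    have q7 : 512 * (K * A) * ‖z - y‖ ^ α ≤ (512 * K + 9) * A * ‖z - y‖ ^ α := by gcongr
    rw [abs_le]; constructor <;> nlinarith
  · intro i j
    refine BH_of_near hα0 hα1 (fun y hy => (hba y hy).2.2.1 i j) ?_ (by nlinarith) (by nlinarith)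
    intro y hy z hz h0 hn
    refine ((hcmp y hy z hz h0 hn).2 i j).trans ?_
    gcongr

/-- tangential derivative of a solution solves the differentiated equation -/
lemma tang {α : ℝ} (hα0 : 0 < α) (hα1 : α < 1) : ∃ C : ℝ, 0 < C ∧ ∀ (U F Ft : V3 → ℝ) (x : V3) (d A : ℝ) (j : Fin 3),
    0 < d → 0 < A → Good U F x (d + 3) → (∀ z ∈ cube x (d + 3), |U z| ≤ A) → BH (ocube x (d + 3)) α F A →
    BH (ocube x (d + 3)) α Ft A →
    (∀ y ∈ ocube x (d + 3), HasDerivAt (fun s : ℝ => F (y + s • ee j)) (Ft y) 0) →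
    Good (fun y => deriv (fun s : ℝ => U (y + s • ee j)) 0) Ft x d ∧
    (∀ y ∈ cube x d, |deriv (fun s : ℝ => U (y + s • ee j)) 0| ≤ C * A) := by
  obtain ⟨K, hK, hE⟩ := expn hα0 hα1
  refine ⟨K, by positivity, fun U F Ft x d A j hd hA hG hU hF hFt hder => ?_⟩
  set Ut : V3 → ℝ := fun y => deriv (fun s : ℝ => U (y + s • ee j)) 0 with hUt
  have mv : ∀ {ρ : ℝ} {y z : V3} {e : ℝ}, y ∈ cube x ρ → z ∈ cube y e → z ∈ cube x (ρ + e) := by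
    intro ρ y z e hy hz i
    have := abs_sub_le (z i) (y i) (x i)
    linarith [hz i, hy i]
  have mvs : ∀ {y : V3} {s : ℝ}, y + s • ee j ∈ cube y |s| := by
    intro y s i
    by_cases h : i = j <;> simp [ee_apply, h]
  have ex : ∀ y, y ∈ cube x (d + 2) → Expn U F α y (K * A) := by
    intro y hy
    have hs : ∀ z, z ∈ ocube y 1 → z ∈ ocube x (d + 3) := fun z hz i => by
      have := abs_sub_le (z i) (y i) (x i)
      linarith [hz i, hy i]
    have hyo : y ∈ ocube x (d + 3) := cube_subset_ocube x (by linarith) hy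
    refine hE U F y A hA (hG.mono fun i => by linarith [hy i]) (fun z hz => hU z (by
      have := mv hy hz; rw [show d + 2 + 1 = d + 3 by ring] at this; exact this))
      (hF.1 y hyo) fun z hz => hF.2 z (hs z hz) y hyo
  have hUd : ∀ y ∈ cube x (d + 2), HasDerivAt (fun s : ℝ => U (y + s • ee j)) (Ut y) 0 ∧ |Ut y| ≤ K * A := by
    intro y hy
    obtain ⟨b, a, h1, h2, h3, h4, h5⟩ := ex y hy
    have hf := exp_fderiv hα0 h4 h5
    have hd : HasDerivAt (fun s : ℝ => U (y + s • ee j)) (b j) 0 := by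
      have hl : HasDerivAt (fun s : ℝ => y + s • ee j) (ee j) 0 := by
        simpa using ((hasDerivAt_id (0:ℝ)).smul_const (ee j)).const_add y
      have h0 : HasFDerivAt U (LL b) (y + (0:ℝ) • ee j) := by simpa using hf
      have := h0.comp_hasDerivAt (0:ℝ) hl
      rwa [LL_ee] at this
    have e : Ut y = b j := hd.deriv
    rw [e]; exact ⟨hd, h3 j⟩
  have shift : ∀ (G : V3 → ℝ) (c : ℝ) (y : V3) (t : ℝ), HasDerivAt (fun s : ℝ => G (y + t • ee j + s • ee j)) c 0 →
      HasDerivAt (fun s : ℝ => G (y + s • ee j)) c t := by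
    intro G c y t h
    have h' : HasDerivAt (fun s : ℝ => G (y + t • ee j + s • ee j)) c (t - t) := by simpa using h
    have := h'.comp_sub_const t t
    refine this.congr_of_eventuallyEq (Eventually.of_forall fun s => ?_)
    beta_reduce
    congr 1
    rw [sub_smul]; abel
  have hUd' : ∀ y ∈ cube x (d + 1), ∀ t : ℝ, |t| ≤ 1 → HasDerivAt (fun s : ℝ => U (y + s • ee j)) (Ut (y + t • ee j)) t ∧
      |Ut (y + t • ee j)| ≤ K * A := by
    intro y hy t ht
    have h1 : y + t • ee j ∈ cube x (d + 2) := by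
      have := mv hy (cube_mono ht (mvs (y := y) (s := t)))
      rwa [show d + 1 + 1 = d + 2 by ring] at this
    exact ⟨shift U _ y t (hUd _ h1).1, (hUd _ h1).2⟩
  have mo : ∀ y ∈ cube x (d + 1), ∀ t : ℝ, |t| ≤ 1 → y + t • ee j ∈ ocube x (d + 3) := by
    intro y hy t ht
    have := mv hy (cube_mono ht (mvs (y := y) (s := t)))
    exact cube_subset_ocube x (by linarith) this
  have hFd' : ∀ y ∈ cube x (d + 1), ∀ t : ℝ, |t| ≤ 1 → HasDerivAt (fun s : ℝ => F (y + s • ee j)) (Ft (y + t • ee j)) t :=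
    fun y hy t ht => shift F _ y t (hder _ (mo y hy t ht))
  have mvt : ∀ (g g' : ℝ → ℝ) (m h : ℝ), 0 < h → h ≤ 1 → (∀ t : ℝ, |t| ≤ 1 → HasDerivAt g (g' t) t) →
      (∀ t : ℝ, |t| ≤ 1 → |g' t| ≤ m) → |(g h - g 0) / h| ≤ m := by
    intro g g' m h h0 h1 hg hb
    have hin : ∀ t ∈ Icc (0:ℝ) h, |t| ≤ 1 := fun t ht => by rw [abs_of_nonneg ht.1]; exact ht.2.trans h1
    have := (convex_Icc (0:ℝ) h).norm_image_sub_le_of_norm_hasDerivWithin_le (f := g) (f' := g') (C := m)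
      (fun t ht => (hg t (hin t ht)).hasDerivWithinAt) (fun t ht => hb t (hin t ht))
      (left_mem_Icc.2 h0.le) (right_mem_Icc.2 h0.le)
    rw [abs_div, abs_of_pos h0, div_le_iff₀ h0]
    simpa [abs_of_pos h0] using this
  set A' := max K 1 * A with hA'
  have hA'0 : 0 < A' := by positivity
  have hKA' : K * A ≤ A' := by rw [hA']; gcongr; exact le_max_left _ _
  have hAA' : A ≤ A' := by rw [hA']; nlinarith [le_max_right K 1]
  have key : ∀ y ∈ cube x d, Expn Ut Ft α y (K * A') := by
    intro y hy
    set hn : ℕ → ℝ := fun n => 1 / ((n:ℝ) + 2) with hhn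
    have hn0 : ∀ n, 0 < hn n := fun n => by positivity
    have hn1 : ∀ n, hn n ≤ 1 := fun n => by
      rw [hhn]; beta_reduce; rw [div_le_one (by positivity)]; linarith [(Nat.cast_nonneg n : (0:ℝ) ≤ n)]
    have hnl : Tendsto hn atTop (𝓝[≠] 0) := by
      rw [tendsto_nhdsWithin_iff]
      refine ⟨?_, Eventually.of_forall fun n => (hn0 n).ne'⟩
      have := (tendsto_const_div_atTop_nhds_zero_nat (1:ℝ)).comp (tendsto_add_atTop_nat 2)
      refine this.congr fun n => ?_
      simp [hhn]
    have hnA : ∀ n, |hn n| ≤ 1 := fun n => by rw [abs_of_pos (hn0 n)]; exact hn1 n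
    have hz1 : ∀ z ∈ cube y 1, z ∈ cube x (d + 1) := fun z hz => mv hy hz
    refine expn_limit (w := fun n z => (hn n)⁻¹ * (U (z + hn n • ee j) - U z))
      (g := fun n z => (hn n)⁻¹ * (F (z + hn n • ee j) - F z)) (fun n => ?_) ?_ ?_
    · refine hE _ _ y A' hA'0 ?_ ?_ ?_ ?_
      · constructor
        · refine continuousOn_const.mul (ContinuousOn.sub ?_ ?_)
          · refine hG.1.comp (by fun_prop) fun z hz => ?_
            exact ocube_subset_cube _ _ (mo z (hz1 z hz) _ (hnA n))
          · exact hG.1.mono fun z hz => cube_mono (by linarith) (hz1 z hz)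
        · intro z hz
          have hz' := hz1 z (ocube_subset_cube _ _ hz)
          refine HasLap.const_mul _ (HasLap.sub ?_ ?_)
          · exact HasLap.shift (hG.2 _ (mo z hz' _ (hnA n)))
          · exact hG.2 z (cube_subset_ocube _ (by linarith) hz')
      · intro z hz
        have := mvt (fun s => U (z + s • ee j)) _ (K * A) (hn n) (hn0 n) (hn1 n)
          (fun t ht => (hUd' z (hz1 z hz) t ht).1) (fun t ht => (hUd' z (hz1 z hz) t ht).2)
        simp only [zero_smul, add_zero] at this
        rw [div_eq_inv_mul] at this
        exact this.trans hKA'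
      · have hy1 : y ∈ cube x (d + 1) := cube_mono (by linarith) hy
        have := mvt (fun s => F (y + s • ee j)) _ A (hn n) (hn0 n) (hn1 n)
          (fun t ht => hFd' y hy1 t ht) (fun t ht => hFt.1 _ (mo y hy1 t ht))
        simp only [zero_smul, add_zero] at this
        rw [div_eq_inv_mul] at this
        exact this.trans hAA'
      · intro z hz
        have hz1 := hz1 z (ocube_subset_cube _ _ hz)
        have hy1 : y ∈ cube x (d + 1) := cube_mono (by linarith) hy
        have := mvt (fun s => F (z + s • ee j) - F (y + s • ee j)) _ (A * ‖z - y‖ ^ α) (hn n) (hn0 n) (hn1 n)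
          (fun t ht => (hFd' z hz1 t ht).sub (hFd' y hy1 t ht)) (fun t ht => by
            have := hFt.2 _ (mo z hz1 t ht) _ (mo y hy1 t ht)
            rwa [add_sub_add_right_eq_sub] at this)
        simp only [zero_smul, add_zero] at this
        rw [div_eq_inv_mul] at this
        have e : (hn n)⁻¹ * (F (z + hn n • ee j) - F z) - (hn n)⁻¹ * (F (y + hn n • ee j) - F y) =
          (hn n)⁻¹ * (F (z + hn n • ee j) - F (y + hn n • ee j) - (F z - F y)) := by ring
        rw [e]
        refine this.trans ?_
        gcongr
    · intro z hz
      have := (hUd z (cube_mono (by linarith) (hz1 z hz))).1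
      rw [hasDerivAt_iff_tendsto_slope_zero] at this
      have := this.comp hnl
      simpa [Function.comp_def] using this
    · have := (hder y (cube_subset_ocube x (by linarith) hy))
      rw [hasDerivAt_iff_tendsto_slope_zero] at this
      have := this.comp hnl
      simpa [Function.comp_def] using this
  refine ⟨⟨?_, ?_⟩, fun y hy => (hUd y (cube_mono (by linarith) hy)).2⟩
  · intro y hy
    obtain ⟨b, a, h1, h2, h3, h4, h5⟩ := key y hy
    exact (exp_fderiv hα0 h4 h5).continuousAt.continuousWithinAt
  · intro y hy
    obtain ⟨b, a, h1, h2, h3, h4, h5⟩ := key y (ocube_subset_cube _ _ hy)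
    rw [← h2]
    exact exp_hasLap hα0 h5


/-- `u` has Hölder bounded derivatives on `S` up to order `n` -/
def CB (S : Set V3) (α : ℝ) : ℕ → (V3 → ℝ) → ℝ → Prop
  | 0, u, A => BH S α u A
  | n + 1, u, A => BH S α u A ∧ ∃ g : Fin 3 → V3 → ℝ,
      (∀ x ∈ S, HasFDerivWithinAt u (LL fun i => g i x) S x) ∧ ∀ i, CB S α n (g i) A

lemma CB.bh {S : Set V3} {α : ℝ} : ∀ {n : ℕ} {u : V3 → ℝ} {A : ℝ}, CB S α n u A → BH S α u A
  | 0, _, _, h => h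
  | _ + 1, _, _, h => h.1

lemma CB.mono {S S' : Set V3} {α : ℝ} (hS : S' ⊆ S) : ∀ {n : ℕ} {u : V3 → ℝ} {A A' : ℝ}, CB S α n u A → A ≤ A' →
    CB S' α n u A'
  | 0, _, _, _, h, hA => BH.mono h hA hS
  | _ + 1, _, _, _, h, hA => by
    obtain ⟨h1, g, h2, h3⟩ := h
    exact ⟨h1.mono hA hS, g, fun x hx => (h2 x (hS hx)).mono hS, fun i => (h3 i).mono hS hA⟩

lemma CB.down {S : Set V3} {α : ℝ} : ∀ {n : ℕ} {u : V3 → ℝ} {A : ℝ}, CB S α (n + 1) u A → CB S α n u A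
  | 0, _, _, h => h.1
  | _ + 1, _, _, h => by
    obtain ⟨h1, g, h2, h3⟩ := h
    exact ⟨h1, g, h2, fun i => (h3 i).down⟩

lemma BH.congr {S : Set V3} {α : ℝ} {u w : V3 → ℝ} {A : ℝ} (h : BH S α u A) (e : ∀ x ∈ S, w x = u x) :
    BH S α w A :=
  ⟨fun x hx => by rw [e x hx]; exact h.1 x hx, fun x hx y hy => by rw [e x hx, e y hy]; exact h.2 x hx y hy⟩

lemma CB.congr {S : Set V3} {α : ℝ} {u w : V3 → ℝ} : ∀ {n : ℕ} {A : ℝ}, CB S α n u A → (∀ x ∈ S, w x = u x) →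
    CB S α n w A
  | 0, _, h, e => BH.congr h e
  | _ + 1, _, h, e => by
    obtain ⟨h1, g, h2, h3⟩ := h
    exact ⟨h1.congr e, g, fun x hx => (h2 x hx).congr e (e x hx), h3⟩

lemma LL_add (c d : Fin 3 → ℝ) : LL (fun i => c i + d i) = LL c + LL d := by
  ext z; simp [LL_apply, add_mul, Finset.sum_add_distrib]

lemma LL_smul (s : ℝ) (c : Fin 3 → ℝ) : LL (fun i => s * c i) = s • LL c := by
  ext z; simp [LL_apply, Finset.mul_sum, mul_assoc]

lemma CB.comb {S : Set V3} {α : ℝ} (s : ℝ) : ∀ {n : ℕ} {u w : V3 → ℝ} {A B : ℝ}, CB S α n u A → CB S α n w B →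
    CB S α n (fun x => u x + s * w x) (A + |s| * B)
  | 0, u, w, A, B, h, h' => by
    refine ⟨fun x hx => ?_, fun x hx y hy => ?_⟩
    · refine (abs_add_le _ _).trans (add_le_add (h.1 x hx) ?_)
      rw [abs_mul]; exact mul_le_mul_of_nonneg_left (h'.1 x hx) (abs_nonneg _)
    · have e : u x + s * w x - (u y + s * w y) = (u x - u y) + s * (w x - w y) := by ring
      rw [e, add_mul, mul_assoc]
      refine (abs_add_le _ _).trans (add_le_add (h.2 x hx y hy) ?_)
      rw [abs_mul]; exact mul_le_mul_of_nonneg_left (h'.2 x hx y hy) (abs_nonneg _)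
  | n + 1, u, w, A, B, h, h' => by
    obtain ⟨h1, g, h2, h3⟩ := h
    obtain ⟨h1', g', h2', h3'⟩ := h'
    refine ⟨CB.comb (n := 0) s h1 h1', fun i x => g i x + s * g' i x, fun x hx => ?_, fun i => (h3 i).comb s (h3' i)⟩
    rw [LL_add, LL_smul]
    exact (h2 x hx).add ((h2' x hx).const_mul s)

/-- reflection into the half space -/
def R3 (y : V3) : V3 := y + (|y 0| - y 0) • ee 0

lemma R3_zero (y : V3) : R3 y 0 = |y 0| := by simp [R3]
lemma R3_ne {i : Fin 3} (h : i ≠ 0) (y : V3) : R3 y i = y i := by simp [R3, ee_apply, h]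
lemma R3_of_nonneg {y : V3} (h : 0 ≤ y 0) : R3 y = y := by simp [R3, abs_of_nonneg h]
lemma R3_R3 (y : V3) : R3 (R3 y) = R3 y := R3_of_nonneg (by rw [R3_zero]; positivity)
lemma R3_shift {j : Fin 3} (hj : j ≠ 0) (y : V3) (s : ℝ) : R3 (y + s • ee j) = R3 y + s • ee j := by
  have : (y + s • ee j) 0 = y 0 := by simp [ee_apply, hj.symm]
  simp only [R3, this]; abel

lemma continuous_R3 : Continuous R3 := by unfold R3; fun_prop

lemma R3_dist (y z : V3) : ‖R3 y - R3 z‖ ≤ ‖y - z‖ := by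
  rw [EuclideanSpace.norm_eq, EuclideanSpace.norm_eq]
  refine Real.sqrt_le_sqrt (Finset.sum_le_sum fun i _ => ?_)
  refine pow_le_pow_left₀ (norm_nonneg _) ?_ 2
  simp only [PiLp.sub_apply, Real.norm_eq_abs]
  by_cases h : i = 0
  · subst h; rw [R3_zero, R3_zero]; exact abs_abs_sub_abs_le_abs_sub _ _
  · rw [R3_ne h, R3_ne h]

/-- half cube -/
def hc (x : V3) (d : ℝ) : Set V3 := {y | y ∈ ocube x d ∧ 0 ≤ y 0}

lemma hc_mono {x : V3} {d e : ℝ} (h : d ≤ e) : hc x d ⊆ hc x e := fun _ hy => ⟨ocube_mono h hy.1, hy.2⟩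

lemma R3_mem_hc {x : V3} (hx : 0 ≤ x 0) {d : ℝ} {y : V3} (hy : y ∈ ocube x d) : R3 y ∈ hc x d := by
  refine ⟨fun i => ?_, by rw [R3_zero]; positivity⟩
  by_cases h : i = 0
  · subst h; rw [R3_zero]
    have := abs_abs_sub_abs_le_abs_sub (y 0) (x 0)
    rw [abs_of_nonneg hx] at this
    exact this.trans_lt (hy 0)
  · rw [R3_ne h]; exact hy i

lemma R3_mem_cube {x : V3} (hx : 0 ≤ x 0) {d : ℝ} {y : V3} (hy : y ∈ cube x d) : R3 y ∈ cube x d := by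
  intro i
  by_cases h : i = 0
  · subst h; rw [R3_zero]
    have := abs_abs_sub_abs_le_abs_sub (y 0) (x 0)
    rw [abs_of_nonneg hx] at this
    exact this.trans (hy 0)
  · rw [R3_ne h]; exact hy i

lemma hc_convex (x : V3) (d : ℝ) : Convex ℝ (hc x d) := by
  refine (ocube_convex x d).inter ?_
  intro y hy z hz s t hs ht _
  have hy : 0 ≤ y 0 := hy
  have hz : 0 ≤ z 0 := hz
  change 0 ≤ (s • y + t • z) 0
  simp only [PiLp.add_apply, PiLp.smul_apply, smul_eq_mul]
  positivity

lemma hc_unique {x : V3} (hx : 0 ≤ x 0) {d : ℝ} (hd : 0 < d) : UniqueDiffOn ℝ (hc x d) := by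
  refine uniqueDiffOn_convex (hc_convex x d) ⟨x + (d / 2) • ee 0, ?_⟩
  have ho : IsOpen (ocube x d ∩ {y : V3 | 0 < y 0}) :=
    (isOpen_ocube x d).inter (isOpen_lt continuous_const (by fun_prop))
  refine interior_maximal (t := ocube x d ∩ {y : V3 | 0 < y 0}) (fun y hy => show y ∈ hc x d from ⟨hy.1, le_of_lt hy.2⟩) ho ⟨fun i => ?_, ?_⟩
  · have : |d / 2| < d := by rw [abs_of_pos (by linarith)]; linarith
    by_cases h : i = 0 <;> simp [ee_apply, h, hd, this]
  · change 0 < (x + (d / 2) • ee 0) 0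
    simp; linarith

lemma BH.even {x : V3} (hx : 0 ≤ x 0) {d α A : ℝ} (hα : 0 < α) {F : V3 → ℝ} (hF : ∀ y, F (R3 y) = F y) (h : BH (hc x d) α F A) :
    BH (ocube x d) α F A := by
  refine ⟨fun y hy => by rw [← hF]; exact h.1 _ (R3_mem_hc hx hy), fun y hy z hz => ?_⟩
  rw [← hF y, ← hF z]
  have hA : 0 ≤ A := (abs_nonneg _).trans (h.1 _ (R3_mem_hc hx hy))
  refine (h.2 _ (R3_mem_hc hx hy) _ (R3_mem_hc hx hz)).trans ?_
  gcongr
  exact R3_dist y z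

lemma LL_inj {c d : Fin 3 → ℝ} (h : LL c = LL d) (i : Fin 3) : c i = d i := by
  rw [← LL_ee c, ← LL_ee d, h]

lemma line_deriv {S : Set V3} {u : V3 → ℝ} {c : Fin 3 → ℝ} {y : V3} (j : Fin 3) (h : HasFDerivWithinAt u (LL c) S y)
    (hS : ∀ᶠ s : ℝ in 𝓝 0, y + s • ee j ∈ S) : HasDerivAt (fun s : ℝ => u (y + s • ee j)) (c j) 0 := by
  have hl : HasDerivAt (fun s : ℝ => y + s • ee j) (ee j) 0 := by
    simpa using ((hasDerivAt_id (0:ℝ)).smul_const (ee j)).const_add y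
  have h0 : HasFDerivWithinAt u (LL c) S (y + (0:ℝ) • ee j) := by simpa using h
  have h1 := h0.comp_hasDerivWithinAt_of_eq (x := (0:ℝ)) (s := {s : ℝ | y + s • ee j ∈ S}) hl.hasDerivWithinAt (fun s hs => hs) rfl
  rw [LL_ee] at h1
  exact h1.hasDerivAt hS

/-- Schauder estimates of all orders up to a flat Neumann face -/
lemma schauder {α : ℝ} (hα0 : 0 < α) (hα1 : α < 1) (n : ℕ) : ∃ C : ℝ, 0 < C ∧ ∀ (U F : V3 → ℝ) (x : V3) (A : ℝ), 0 ≤ x 0 → 0 < A →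
    (∀ y, U (R3 y) = U y) → (∀ y, F (R3 y) = F y) →
    Good U F x (2 + 3 * n) → (∀ z ∈ cube x (2 + 3 * n), |U z| ≤ A) → CB (hc x (2 + 3 * n)) α n F A →
    CB (hc x 1) α (n + 2) U (C * A) := by
  obtain ⟨C1, hC1, hb⟩ := base hα0 hα1
  obtain ⟨C2, hC2, ht⟩ := tang hα0 hα1
  have hsub : ∀ x : V3, hc x 1 ⊆ ocube x 1 := fun x y hy => hy.1
  induction n with
  | zero =>
    refine ⟨C1, hC1, fun U F x A hx hA hUe hFe hG hU hF => ?_⟩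
    simp only [CharP.cast_eq_zero, mul_zero, add_zero] at hG hU hF
    obtain ⟨b, a, h1, h2, h3, h4, h5, h6, h7⟩ := hb U F x A hA hG hU (hF.bh.even hx hα0 hFe)
    exact ⟨h5.mono le_rfl (hsub x), b, fun y hy => (h1 y hy.1).hasFDerivWithinAt, fun i =>
      ⟨(h6 i).mono le_rfl (hsub x), a i, fun y hy => (h2 i y hy.1).hasFDerivWithinAt, fun j =>
        (h7 i j).mono le_rfl (hsub x)⟩⟩
  | succ n ih =>
    obtain ⟨C3, hC3, hi⟩ := ih
    set C4 := C1 + C3 * max C2 1 with hC4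
    refine ⟨1 + 2 * C4, by positivity, fun U F x A hx hA hUe hFe hG hU hF => ?_⟩
    set d : ℝ := 2 + 3 * n with hd
    have hd0 : 0 < d := by positivity
    have e3 : (2:ℝ) + 3 * ((n + 1 : ℕ) : ℝ) = d + 3 := by push_cast; rw [hd]; ring
    rw [e3] at hG hU hF
    have hFb := hF.bh.even hx hα0 hFe
    obtain ⟨b, a, h1, h2, h3, h4, h5, h6, h7⟩ := hb U F x A hA
      (hG.mono fun i => by simp; linarith [(Nat.cast_nonneg n : (0:ℝ) ≤ n)])
      (fun z hz => hU z (cube_mono (by linarith [(Nat.cast_nonneg n : (0:ℝ) ≤ n)]) hz))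
      (hFb.mono le_rfl (ocube_mono (by linarith [(Nat.cast_nonneg n : (0:ℝ) ≤ n)])))
    obtain ⟨-, g, hg, hgc⟩ := hF
    have hcA : C1 * A ≤ C4 * A := by
      have : 0 ≤ C3 * max C2 1 * A := by positivity
      rw [hC4, add_mul]; linarith
    have hmA : C3 * (max C2 1 * A) ≤ C4 * A := by
      have : 0 ≤ C1 * A := by positivity
      rw [hC4, add_mul, mul_assoc C3]; linarith
    have hxA : C4 * A ≤ (1 + 2 * C4) * A := by nlinarith [mul_pos (by positivity : 0 < C4) hA]
    have tg : ∀ j : Fin 3, j ≠ 0 → CB (hc x 1) α (n + 2) (b j) (C4 * A) := by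
      intro j hj
      have hgR : ∀ y ∈ ocube x (d + 3), HasDerivAt (fun s : ℝ => F (y + s • ee j)) (g j (R3 y)) 0 := by
        intro y hy
        have hy' := R3_mem_hc hx hy
        have hl := line_deriv j (hg _ hy') (by
          have c : Tendsto (fun s : ℝ => R3 y + s • ee j) (𝓝 0) (𝓝 (R3 y)) := by
            have : Tendsto (fun s : ℝ => R3 y + s • ee j) (𝓝 0) (𝓝 (R3 y + (0:ℝ) • ee j)) := by
              apply Continuous.tendsto; fun_prop
            simpa using this
          filter_upwards [c.eventually ((isOpen_ocube x (d + 3)).mem_nhds hy'.1)] with s hs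
          refine ⟨hs, ?_⟩
          have : (R3 y + s • ee j) 0 = R3 y 0 := by simp [ee_apply, hj.symm]
          rw [this]; exact hy'.2)
        refine hl.congr_of_eventuallyEq (Eventually.of_forall fun s => ?_)
        beta_reduce
        rw [← hFe (y + s • ee j), R3_shift hj]
      have hFt : CB (hc x (d + 3)) α n (fun y => g j (R3 y)) A :=
        (hgc j).congr fun y hy => by rw [R3_of_nonneg hy.2]
      obtain ⟨t1, t2⟩ := ht U F (fun y => g j (R3 y)) x d A j hd0 hA hG hU hFb
        (hFt.bh.even hx hα0 (fun y => by rw [R3_R3])) hgR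
      have hAm : A ≤ max C2 1 * A := by nlinarith [le_max_right C2 1]
      have := hi _ _ x (max C2 1 * A) hx (by positivity)
        (fun y => by
          congr 1; ext s
          rw [← hUe (y + s • ee j), R3_shift hj])
        (fun y => by rw [R3_R3]) t1 (fun z hz => (t2 z hz).trans (by gcongr; exact le_max_left _ _))
        (hFt.mono (hc_mono (by linarith)) hAm)
      refine (this.mono subset_rfl hmA).congr fun y hy => ?_
      have hl := line_deriv j (h1 y hy.1).hasFDerivWithinAt (S := univ) (by simp)
      exact hl.deriv.symm
    have hud := hc_unique hx one_pos
    have ta : ∀ j : Fin 3, j ≠ 0 → ∀ k, CB (hc x 1) α (n + 1) (a j k) (C4 * A) := by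
      intro j hj k
      obtain ⟨-, q, hq, hqc⟩ := tg j hj
      refine (hqc k).congr fun y hy => ?_
      exact LL_inj ((hud y hy).eq (h2 j y hy.1).hasFDerivWithinAt (hq y hy)) k
    have ta0 : ∀ k, CB (hc x 1) α (n + 1) (a 0 k) ((1 + 2 * C4) * A) := by
      intro k
      by_cases hk : k = 0
      · subst hk
        have hFc : CB (hc x 1) α (n + 1) F A := by
          refine CB.mono (S := hc x (d + 3)) (hc_mono (by linarith)) ?_ le_rfl
          exact ⟨hFb.mono le_rfl fun y hy => hy.1, g, hg, hgc⟩
        have := (hFc.comb (-1) (ta 1 (by decide) 1)).comb (-1) (ta 2 (by decide) 2)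
        refine (this.mono subset_rfl (le_of_eq ?_)).congr fun y hy => ?_
        · simp; ring
        · have := h4 y hy.1
          rw [Fin.sum_univ_three] at this
          linarith
      · exact ((ta k hk 0).mono subset_rfl hxA).congr fun y _ => h3 0 k y
    refine ⟨h5.mono (hcA.trans hxA) (hsub x), b, fun y hy => (h1 y hy.1).hasFDerivWithinAt, fun i => ?_⟩
    by_cases hi0 : i = 0
    · subst hi0
      exact ⟨(h6 0).mono (hcA.trans hxA) (hsub x), a 0, fun y hy => (h2 0 y hy.1).hasFDerivWithinAt, ta0⟩
    · exact (tg i hi0).mono subset_rfl hxA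


/-- the solution in logarithmic polar coordinates -/
structure Pol (V Vs Vss Vt Vtt Vy Vyy : ℝ → ℝ → ℝ → ℝ) (t0 t1 S c0 M δ B : ℝ) : Prop where
  cont : ContinuousOn (fun p : ℝ × ℝ × ℝ => V p.1 p.2.1 p.2.2) (Iic S ×ˢ Icc t0 t1 ×ˢ univ)
  hs : ∀ s ≤ S, ∀ t ∈ Icc t0 t1, ∀ y, HasDerivWithinAt (fun s => V s t y) (Vs s t y) (Iic S) s
  hss : ∀ s ≤ S, ∀ t ∈ Icc t0 t1, ∀ y, HasDerivWithinAt (fun s => Vs s t y) (Vss s t y) (Iic S) s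
  ht : ∀ s ≤ S, ∀ t ∈ Icc t0 t1, ∀ y, HasDerivWithinAt (fun t => V s t y) (Vt s t y) (Icc t0 t1) t
  htt : ∀ s ≤ S, ∀ t ∈ Icc t0 t1, ∀ y, HasDerivWithinAt (fun t => Vt s t y) (Vtt s t y) (Icc t0 t1) t
  hy : ∀ s ≤ S, ∀ t ∈ Icc t0 t1, ∀ y, HasDerivAt (fun y => V s t y) (Vy s t y) y
  hyy : ∀ s ≤ S, ∀ t ∈ Icc t0 t1, ∀ y, HasDerivAt (fun y => Vy s t y) (Vyy s t y) y
  eqn : ∀ s ≤ S, ∀ t ∈ Icc t0 t1, ∀ y, |Vss s t y + Vtt s t y + exp (2 * s) * Vyy s t y| ≤ M * exp (δ * s)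
  hS : ∀ t ∈ Icc t0 t1, ∀ y, Vs S t y = c0
  n0 : ∀ s < S, ∀ y, Vt s t0 y = 0
  n1 : ∀ s < S, ∀ y, Vt s t1 y = 0
  per : ∀ s ≤ S, ∀ t ∈ Icc t0 t1, ∀ y, V s t (y + 2 * π) = V s t y
  bdd : ∀ s ≤ S, ∀ t ∈ Icc t0 t1, ∀ y, |V s t y| ≤ B

lemma exists_max {X : Type} [TopologicalSpace X] {T : Set X} (hT : IsCompact T) (Φ : ℝ → X → ℝ → ℝ) {S : ℝ}
    (cont : ContinuousOn (fun p : ℝ × X × ℝ => Φ p.1 p.2.1 p.2.2) (Iic S ×ˢ T ×ˢ univ))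
    (per : ∀ s ≤ S, ∀ x ∈ T, ∀ y, Φ s x (y + 2 * π) = Φ s x y)
    (neg : ∃ s0, ∀ s ≤ s0, s ≤ S → ∀ x ∈ T, ∀ y, Φ s x y ≤ 0)
    (hpos : ∃ s ≤ S, ∃ x ∈ T, ∃ y, 0 < Φ s x y) :
    ∃ s ≤ S, ∃ x ∈ T, ∃ y, 0 < Φ s x y ∧ ∀ s' ≤ S, ∀ x' ∈ T, ∀ y', Φ s' x' y' ≤ Φ s x y := by
  obtain ⟨s0, hneg⟩ := neg
  obtain ⟨s1, hs1, x1, hx1, y1, hp⟩ := hpos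
  have red : ∀ s ≤ S, ∀ x ∈ T, ∀ y, ∃ y' ∈ Icc 0 (2 * π), Φ s x y = Φ s x y' := by
    intro s hs x hx y
    obtain ⟨y', hy', e⟩ := Function.Periodic.exists_mem_Ico₀ (f := fun y => Φ s x y) (fun y => per s hs x hx y) (by positivity) y
    exact ⟨y', Ico_subset_Icc_self hy', e⟩
  have hs01 : s0 < s1 := by
    by_contra h
    exact absurd (hneg s1 (not_lt.1 h) hs1 x1 hx1 y1) (not_le.2 hp)
  have hK : IsCompact (Icc s0 S ×ˢ T ×ˢ Icc 0 (2 * π)) := isCompact_Icc.prod (hT.prod isCompact_Icc)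
  obtain ⟨y2, hy2, e2⟩ := red s1 hs1 x1 hx1 y1
  obtain ⟨⟨s, x, y⟩, ⟨hs, hx, hy⟩, hmax⟩ := hK.exists_isMaxOn ⟨(s1, x1, y2), ⟨hs01.le, hs1⟩, hx1, hy2⟩
    (cont.mono (prod_mono Icc_subset_Iic_self (prod_mono subset_rfl (subset_univ _))))
  have hm : ∀ s' x' y', s' ∈ Icc s0 S → x' ∈ T → y' ∈ Icc 0 (2 * π) → Φ s' x' y' ≤ Φ s x y := fun s' x' y' h1 h2 h3 =>
    hmax (show (s', x', y') ∈ _ from ⟨h1, h2, h3⟩)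
  have hpos : 0 < Φ s x y := (e2 ▸ hp).trans_le (hm s1 x1 y2 ⟨hs01.le, hs1⟩ hx1 hy2)
  refine ⟨s, hs.2, x, hx, y, hpos, fun s' hs' x' hx' y' => ?_⟩
  by_cases h : s' ≤ s0
  · exact (hneg s' h hs' x' hx' y').trans hpos.le
  · obtain ⟨y'', hy'', e⟩ := red s' hs' x' hx' y'
    rw [e]; exact hm s' x' y'' ⟨(not_le.1 h).le, hs'⟩ hx' hy''

lemma second_le_interior {g g' : ℝ → ℝ} {d p a b : ℝ} (ha : a < p) (hb : p < b)
    (h1 : ∀ t ∈ Icc a b, HasDerivWithinAt g (g' t) (Icc a b) t)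
    (h2 : HasDerivWithinAt g' d (Icc a b) p)
    (hmax : ∀ t ∈ Icc a b, g t ≤ g p) : d ≤ 0 :=
  second_le_of_max (ha.trans hb) ⟨ha.le, hb.le⟩ h1 (by rintro (h | h) <;> linarith) h2 hmax

lemma s_second {g g' : ℝ → ℝ} {d p S : ℝ} (hb : p < S)
    (h1 : ∀ t ≤ S, HasDerivWithinAt g (g' t) (Iic S) t)
    (h2 : HasDerivWithinAt g' d (Iic S) p)
    (hmax : ∀ t ≤ S, g t ≤ g p) : d ≤ 0 :=
  second_le_interior (a := p - 1) (b := S) (by linarith) hb (fun t ht => (h1 t ht.2).mono Icc_subset_Iic_self)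
    (h2.mono Icc_subset_Iic_self) (fun t ht => hmax t ht.2)

lemma s_first {g : ℝ → ℝ} {d S : ℝ} (h1 : HasDerivWithinAt g d (Iic S) S)
    (hmax : ∀ t ≤ S, g t ≤ g S) : 0 ≤ d :=
  deriv_ge_of_max_left (a := S - 1) (by linarith) (h1.mono Icc_subset_Iic_self) (fun t ht => hmax t ht.2)

lemma y_second {g g' : ℝ → ℝ} {d p : ℝ} (h1 : ∀ t, HasDerivAt g (g' t) t) (h2 : HasDerivAt g' d p)
    (hmax : ∀ t, g t ≤ g p) : d ≤ 0 :=
  second_le_interior (a := p - 1) (b := p + 1) (by linarith) (by linarith) (fun t _ => (h1 t).hasDerivWithinAt)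
    h2.hasDerivWithinAt (fun t _ => hmax t)

lemma hexp (c s : ℝ) : HasDerivAt (fun s : ℝ => exp (c * s)) (c * exp (c * s)) s := by
  have := ((hasDerivAt_id s).const_mul c).exp
  exact this.congr_deriv (by simp; ring)

lemma le_of_eps {a b k : ℝ} (e0 : ℝ) (he0 : 0 < e0) (h : ∀ ε, 0 < ε → ε < e0 → a ≤ b + ε * k) : a ≤ b := by
  have h1 : Tendsto (fun ε : ℝ => b + ε * k) (𝓝[>] 0) (𝓝 b) := by
    have : Tendsto (fun ε : ℝ => b + ε * k) (𝓝 0) (𝓝 (b + 0 * k)) := by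
      apply Continuous.tendsto; fun_prop
    simp at this
    exact this.mono_left nhdsWithin_le_nhds
  refine ge_of_tendsto h1 ?_
  filter_upwards [Ioo_mem_nhdsGT he0] with ε hε
  exact h ε hε.1 hε.2

section
variable {V Vs Vss Vt Vtt Vy Vyy : ℝ → ℝ → ℝ → ℝ} {t0 t1 S c0 M δ B : ℝ}

lemma Pol.neg (h : Pol V Vs Vss Vt Vtt Vy Vyy t0 t1 S c0 M δ B) :
    Pol (fun s t y => - V s t y) (fun s t y => - Vs s t y) (fun s t y => - Vss s t y) (fun s t y => - Vt s t y)
     (fun s t y => - Vtt s t y) (fun s t y => - Vy s t y) (fun s t y => - Vyy s t y) t0 t1 S (-c0) M δ B where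
  cont := h.cont.neg
  hs := fun s hs t ht y => (h.hs s hs t ht y).neg
  hss := fun s hs t ht y => (h.hss s hs t ht y).neg
  ht := fun s hs t ht y => (h.ht s hs t ht y).neg
  htt := fun s hs t ht y => (h.htt s hs t ht y).neg
  hy := fun s hs t ht y => (h.hy s hs t ht y).neg
  hyy := fun s hs t ht y => (h.hyy s hs t ht y).neg
  eqn := fun s hs t ht y => by
    have := h.eqn s hs t ht y
    rw [← abs_neg] at this
    refine le_of_eq_of_le (congrArg _ ?_) this
    ring
  hS := fun t ht y => by simp [h.hS t ht y]
  n0 := fun s hs y => by simp [h.n0 s hs y]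
  n1 := fun s hs y => by simp [h.n1 s hs y]
  per := fun s hs t ht y => by simp [h.per s hs t ht y]
  bdd := fun s hs t ht y => by simpa using h.bdd s hs t ht y

lemma Pol.contV (h : Pol V Vs Vss Vt Vtt Vy Vyy t0 t1 S c0 M δ B) {X : Type} [TopologicalSpace X] {T : Set X} {a b c : X → ℝ}
   (ha : ContinuousOn a T) (hb : ContinuousOn b T) (hc : ContinuousOn c T) (hm : ∀ x ∈ T, a x ≤ S ∧ b x ∈ Icc t0 t1) :
   ContinuousOn (fun x => V (a x) (b x) (c x)) T :=
  h.cont.comp (f := fun x => (a x, b x, c x)) (ha.prodMk (hb.prodMk hc)) fun x hx => ⟨(hm x hx).1, (hm x hx).2, mem_univ _⟩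

lemma Pol.theta (h : Pol V Vs Vss Vt Vtt Vy Vyy t0 t1 S c0 M δ B) (hM : 0 < M) (hδ : 0 < δ) (hδ1 : δ < 1)
    (hπ : t1 - t0 ≤ π / 2) :
    ∀ s ≤ S, ∀ t ∈ Icc t0 t1, ∀ t' ∈ Icc t0 t1, t' ≤ t → ∀ y, V s t y - V s t' y ≤ 180 * M * exp (δ * s) := by
  set g : ℝ → ℝ := fun σ => 1 + 23 * (2 * σ - σ ^ 2 / 2) with hg
  have hpi : π / 2 < 1.5708 := by have := Real.pi_lt_d4; linarith
  have g1 : ∀ σ, 0 ≤ σ → σ ≤ 1.5708 → 1 ≤ g σ := fun σ h0 h1 => by simp only [hg]; nlinarith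
  have g2 : ∀ σ, 0 ≤ σ → σ ≤ 1.5708 → g σ ≤ 44.9 := fun σ h0 h1 => by simp only [hg]; nlinarith
  have hgd : ∀ σ, HasDerivAt g (23 * (2 - σ)) σ := fun σ => by
    have h1 := (((hasDerivAt_id σ).const_mul 2).sub (((hasDerivAt_id σ).pow 2).div_const 2)).const_mul 23 |>.const_add 1
    exact h1.congr_deriv (by simp)
  have hgd2 : ∀ σ, HasDerivAt (fun σ : ℝ => 23 * (2 - σ)) (-23) σ := fun σ => by
    have h1 := ((hasDerivAt_id σ).const_sub 2).const_mul 23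
    exact h1.congr_deriv (by norm_num)
  suffices H : ∀ ε, 0 < ε → ε < 4 * M * δ * exp (δ * S) → ∀ s ≤ S, ∀ t ∈ Icc t0 t1, ∀ t' ∈ Icc t0 t1, t' ≤ t → ∀ y,
      V s t y - V s t' y ≤ 4 * M * exp (δ * s) * g (t - t') + ε * (S - s) by
    intro s hs t ht t' ht' htt' y
    have h1 : V s t y - V s t' y ≤ 4 * M * exp (δ * s) * g (t - t') :=
      le_of_eps (4 * M * δ * exp (δ * S)) (by positivity) (k := S - s) fun ε h0 h1 => H ε h0 h1 s hs t ht t' ht' htt' y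
    have h2 := g2 (t - t') (by linarith) (by linarith [ht.2, ht'.1])
    have h3 : 4 * M * exp (δ * s) * g (t - t') ≤ 4 * M * exp (δ * s) * 44.9 := by gcongr
    nlinarith [mul_pos hM (exp_pos (δ * s))]
  intro ε hε hε1
  by_contra hcon
  push Not at hcon
  obtain ⟨s1, hs1, p1, hp1, q1, hq1, hqp1, y1, hpos1⟩ := hcon
  set T : Set (ℝ × ℝ) := {x | x.1 ∈ Icc t0 t1 ∧ x.2 ∈ Icc t0 t1 ∧ x.2 ≤ x.1} with hT
  have hTc : IsCompact T := by
    have : T = (Icc t0 t1 ×ˢ Icc t0 t1) ∩ {x : ℝ × ℝ | x.2 ≤ x.1} := by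
      ext x; simp only [hT, mem_inter_iff, mem_prod, mem_setOf_eq, and_assoc]
    rw [this]
    exact (isCompact_Icc.prod isCompact_Icc).inter_right (isClosed_le continuous_snd continuous_fst)
  have hgc : Continuous g := by simp only [hg]; fun_prop
  have hB0 : 0 ≤ B := (abs_nonneg _).trans (h.bdd s1 hs1 p1 hp1 y1)
  obtain ⟨s, hs, ⟨t, t'⟩, ⟨ht, ht', htt⟩, y, hpos, hmax⟩ := exists_max hTc
    (fun s x y => V s x.1 y - V s x.2 y - (4 * M * exp (δ * s) * g (x.1 - x.2) + ε * (S - s))) (S := S)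
    (by
      refine ContinuousOn.sub (ContinuousOn.sub ?_ ?_) (by fun_prop)
      · exact h.contV (by fun_prop) (by fun_prop) (by fun_prop) fun x hx => ⟨hx.1, hx.2.1.1⟩
      · exact h.contV (by fun_prop) (by fun_prop) (by fun_prop) fun x hx => ⟨hx.1, hx.2.1.2.1⟩)
    (fun s hs x hx y => by beta_reduce; rw [h.per s hs _ hx.1, h.per s hs _ hx.2.1])
    ⟨S - 2 * B / ε, fun s hs0 hs x hx y => by
      have h1 := abs_le.1 (h.bdd s hs _ hx.1 y)
      have h2 := abs_le.1 (h.bdd s hs _ hx.2.1 y)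
      have h3 : 2 * B ≤ ε * (S - s) := by
        have : 2 * B / ε ≤ S - s := by linarith
        rw [div_le_iff₀ hε] at this; linarith
      have h4 := g1 (x.1 - x.2) (by linarith [hx.2.2]) (by linarith [hx.1.2, hx.2.1.1])
      have h5 : 0 ≤ 4 * M * exp (δ * s) * g (x.1 - x.2) := by positivity
      beta_reduce; linarith⟩
    ⟨s1, hs1, (p1, q1), ⟨hp1, hq1, hqp1⟩, y1, by beta_reduce; linarith⟩
  dsimp only at ht ht' htt hpos hmax
  have hE := exp_pos (δ * s)
  have hσ1 : t - t' ≤ 1.5708 := by linarith [ht.2, ht'.1]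
  have htlt : t' < t := by
    rcases htt.lt_or_eq with h1 | h1
    · exact h1
    · subst h1
      have h4 := g1 (t' - t') (by simp) hσ1
      have h5 : 0 ≤ 4 * M * exp (δ * s) * g (t' - t') := by positivity
      have h6 : 0 ≤ ε * (S - s) := mul_nonneg hε.le (by linarith)
      linarith
  have hg1 := g1 _ (sub_nonneg.2 htlt.le) hσ1
  have hg2 := g2 _ (sub_nonneg.2 htlt.le) hσ1
  have ds : ∀ s, HasDerivAt (fun s => 4 * M * exp (δ * s) * g (t - t') + ε * (S - s))
      (4 * M * (δ * exp (δ * s)) * g (t - t') - ε) s := fun s => by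
    have := ((((hexp δ s).const_mul (4 * M)).mul_const (g (t - t')))).add (((hasDerivAt_id s).const_sub S).const_mul ε)
    exact this.congr_deriv (by ring)
  have dss : HasDerivAt (fun s => 4 * M * (δ * exp (δ * s)) * g (t - t') - ε)
      (4 * M * (δ * (δ * exp (δ * s))) * g (t - t')) s := by
    have := ((((hexp δ s).const_mul δ).const_mul (4 * M)).mul_const (g (t - t'))).sub_const ε
    exact this
  have hsd : ∀ s ≤ S, HasDerivWithinAt (fun s => V s t y - V s t' y - (4 * M * exp (δ * s) * g (t - t') + ε * (S - s)))
      (Vs s t y - Vs s t' y - (4 * M * (δ * exp (δ * s)) * g (t - t') - ε)) (Iic S) s := fun s hs =>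
    ((h.hs s hs t ht y).sub (h.hs s hs t' ht' y)).sub (ds s).hasDerivWithinAt
  have hsS : s < S := by
    rcases hs.lt_or_eq with h1 | h1
    · exact h1
    · exfalso
      have := s_first (hsd S le_rfl) (fun s' hs' => by
        have := hmax s' hs' (t, t') ⟨ht, ht', htt⟩ y
        rw [h1] at this; exact this)
      rw [h.hS t ht, h.hS t' ht'] at this
      have hES := exp_pos (δ * S)
      have : 4 * M * (δ * exp (δ * S)) ≤ 4 * M * (δ * exp (δ * S)) * g (t - t') := le_mul_of_one_le_right (by positivity) hg1
      linarith
  have r1 := s_second hsS hsd (((h.hss s hs t ht y).sub (h.hss s hs t' ht' y)).sub dss.hasDerivWithinAt)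
    (fun s' hs' => hmax s' hs' (t, t') ⟨ht, ht', htt⟩ y)
  have r2 := y_second (p := y) (g := fun y => V s t y - V s t' y - (4 * M * exp (δ * s) * g (t - t') + ε * (S - s)))
    (fun y => ((h.hy s hs t ht y).sub (h.hy s hs t' ht' y)).sub_const _)
    (((h.hyy s hs t ht y).sub (h.hyy s hs t' ht' y)))
    (fun y' => hmax s hs (t, t') ⟨ht, ht', htt⟩ y')
  have dt : ∀ t ∈ Icc t' t1, HasDerivWithinAt (fun t => V s t y - V s t' y - (4 * M * exp (δ * s) * g (t - t') + ε * (S - s)))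
      (Vt s t y - 4 * M * exp (δ * s) * (23 * (2 - (t - t')))) (Icc t' t1) t := fun t htt => by
    have a1 := (h.ht s hs t ⟨ht'.1.trans htt.1, htt.2⟩ y).mono (Icc_subset_Icc_left ht'.1)
    have a2 : HasDerivAt (fun t => g (t - t')) (23 * (2 - (t - t'))) t := (hgd (t - t')).comp_sub_const t t'
    exact (a1.sub_const _).sub ((a2.const_mul (4 * M * exp (δ * s))).add_const _).hasDerivWithinAt
  have mt : ∀ t'' ∈ Icc t' t1, V s t'' y - V s t' y - (4 * M * exp (δ * s) * g (t'' - t') + ε * (S - s)) ≤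
      V s t y - V s t' y - (4 * M * exp (δ * s) * g (t - t') + ε * (S - s)) := fun t'' h'' =>
    hmax s hs (t'', t') ⟨⟨ht'.1.trans h''.1, h''.2⟩, ht', h''.1⟩ y
  have htl : t < t1 := by
    rcases ht.2.lt_or_eq with h1 | h1
    · exact h1
    · exfalso
      have := deriv_ge_of_max_left htlt ((dt t ⟨htlt.le, ht.2⟩).mono (Icc_subset_Icc_right ht.2))
        (fun t'' h'' => mt t'' ⟨h''.1, h''.2.trans ht.2⟩)
      have e : Vt s t y = 0 := by rw [h1]; exact h.n1 s hsS y
      rw [e] at this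
      have : 0 < 4 * M * exp (δ * s) * (23 * (2 - (t - t'))) := by
        have : 0 < 2 - (t - t') := by linarith
        positivity
      linarith
  have r3 := second_le_interior htlt htl dt (d := Vtt s t y - 4 * M * exp (δ * s) * (-23)) (by
    have a1 := (h.htt s hs t ht y).mono (Icc_subset_Icc_left ht'.1 : Icc t' t1 ⊆ Icc t0 t1)
    have a2 := (hgd2 (t - t')).comp_sub_const t t'
    exact a1.sub (a2.const_mul (4 * M * exp (δ * s))).hasDerivWithinAt) mt
  have dt' : ∀ t' ∈ Icc t0 t, HasDerivWithinAt (fun t' => V s t y - V s t' y - (4 * M * exp (δ * s) * g (t - t') + ε * (S - s)))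
      (- Vt s t' y + 4 * M * exp (δ * s) * (23 * (2 - (t - t')))) (Icc t0 t) t' := fun t' htt => by
    have a1 := (h.ht s hs t' ⟨htt.1, htt.2.trans ht.2⟩ y).mono (Icc_subset_Icc_right ht.2)
    have a2 : HasDerivAt (fun t' => g (t - t')) (-(23 * (2 - (t - t')))) t' := (hgd (t - t')).comp_const_sub t t'
    exact ((a1.const_sub _).sub ((a2.const_mul (4 * M * exp (δ * s))).add_const _).hasDerivWithinAt).congr_deriv (by ring)
  have mt' : ∀ t'' ∈ Icc t0 t, V s t y - V s t'' y - (4 * M * exp (δ * s) * g (t - t'') + ε * (S - s)) ≤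
      V s t y - V s t' y - (4 * M * exp (δ * s) * g (t - t') + ε * (S - s)) := fun t'' h'' =>
    hmax s hs (t, t'') ⟨ht, ⟨h''.1, h''.2.trans ht.2⟩, h''.2⟩ y
  have htl' : t0 < t' := by
    rcases ht'.1.lt_or_eq with h1 | h1
    · exact h1
    · exfalso
      have := deriv_le_of_max_right htlt ((dt' t' ⟨ht'.1, htlt.le⟩).mono (Icc_subset_Icc_left ht'.1))
        (fun t'' h'' => mt' t'' ⟨ht'.1.trans h''.1, h''.2⟩)
      have e : Vt s t' y = 0 := by rw [← h1]; exact h.n0 s hsS y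
      rw [e] at this
      have : 0 < 4 * M * exp (δ * s) * (23 * (2 - (t - t'))) := by
        have : 0 < 2 - (t - t') := by linarith
        positivity
      linarith
  have r4 := second_le_interior htl' htlt dt' (d := - Vtt s t' y + 4 * M * exp (δ * s) * 23) (by
    have a1 := (h.htt s hs t' ht' y).mono (Icc_subset_Icc_right ht.2 : Icc t0 t ⊆ Icc t0 t1)
    have a2 := (hgd2 (t - t')).comp_const_sub t t'
    exact (a1.neg.add (a2.const_mul (4 * M * exp (δ * s))).hasDerivWithinAt).congr_deriv (by ring)) mt'
  have q1 := abs_le.1 (h.eqn s hs t ht y)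
  have q2 := abs_le.1 (h.eqn s hs t' ht' y)
  have r2' : exp (2 * s) * (Vyy s t y - Vyy s t' y) ≤ 0 := mul_nonpos_of_nonneg_of_nonpos (exp_pos _).le r2
  have hδ2 : 4 * M * (δ * (δ * exp (δ * s))) * g (t - t') ≤ 4 * M * exp (δ * s) * 44.9 := by
    have : δ * δ ≤ 1 := by nlinarith
    calc 4 * M * (δ * (δ * exp (δ * s))) * g (t - t') = (4 * M * exp (δ * s) * g (t - t')) * (δ * δ) := by ring
      _ ≤ (4 * M * exp (δ * s) * g (t - t')) * 1 := by gcongr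
      _ ≤ 4 * M * exp (δ * s) * 44.9 := by rw [mul_one]; gcongr
  have hME := mul_pos hM hE
  nlinarith

end


section
variable {V Vs Vss Vt Vtt Vy Vyy : ℝ → ℝ → ℝ → ℝ} {t0 t1 S c0 M δ B : ℝ}

lemma yosc_key {δ s K : ℝ} (hδ : 0 < δ) (hδ1 : δ < 1) (hK0 : 0 < K) :
    2 * (exp (δ / 2 * s) ^ 2 - exp (δ / 2 * s) / 2) - 4 * (K + 4 ^ (4 / δ)) * exp (2 * s) ≤ - 2 * exp (δ / 2 * s) ^ 2 := by
  have l1 : exp (δ / 2 * s) ^ 2 = exp (δ * s) := by rw [← exp_nat_mul]; congr 1; push_cast; ring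
  have h4 : (0:ℝ) < 4 ^ (4 / δ) := by positivity
  set N : ℝ := K + 4 ^ (4 / δ) with hN
  have hN0 : 0 < N := by positivity
  have hNe : 0 < N * exp (2 * s) := by positivity
  set q := exp (δ / 2 * s) with hq
  have hq0 : 0 < q := exp_pos _
  rcases le_total q (1 / 4) with hq4 | hq4
  · have h1 : 0 ≤ q * (1 - 4 * q) := mul_nonneg hq0.le (by linarith)
    have h2 : q * (1 - 4 * q) = q - 4 * q ^ 2 := by ring
    linarith
  · have e1 : q ^ 2 ≤ 4 ^ (4 / δ) * exp (2 * s) := by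
      have l2 : (4:ℝ) ^ (4 / δ) = exp (Real.log 4 * (4 / δ)) := rpow_def_of_pos (by norm_num) _
      rw [l1, l2, ← exp_add, exp_le_exp]
      have l3 : - Real.log 4 ≤ δ / 2 * s := by
        have := Real.log_le_log (by norm_num) hq4
        rw [hq, log_exp, one_div, Real.log_inv] at this
        exact this
      have l4 : 0 < Real.log 4 := Real.log_pos (by norm_num)
      have l5 : - (2 * Real.log 4 / δ) ≤ s := by
        rw [neg_le_iff_add_nonneg, ← mul_nonneg_iff_of_pos_left hδ]
        have : δ * (s + 2 * Real.log 4 / δ) = δ * s + 2 * Real.log 4 := by field_simp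
        rw [this]; linarith
      have l6 : (2 - δ) * -(2 * Real.log 4 / δ) ≤ (2 - δ) * s := mul_le_mul_of_nonneg_left l5 (by linarith)
      have l7 : Real.log 4 * (4 / δ) = 2 * (2 * Real.log 4 / δ) := by ring
      have l8 : δ * (2 * Real.log 4 / δ) = 2 * Real.log 4 := by field_simp
      have l9 : (2 - δ) * -(2 * Real.log 4 / δ) = - (2 * (2 * Real.log 4 / δ)) + δ * (2 * Real.log 4 / δ) := by ring
      have l10 : (2 - δ) * s = 2 * s - δ * s := by ring
      linarith
    have e2 : 4 ^ (4 / δ) * exp (2 * s) ≤ N * exp (2 * s) := mul_le_mul_of_nonneg_right (by linarith) (exp_pos _).le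
    linarith

set_option maxHeartbeats 1000000 in
lemma Pol.yosc (h : Pol V Vs Vss Vt Vtt Vy Vyy t0 t1 S c0 M δ B) (hM : 0 < M) (hδ : 0 < δ) (hδ1 : δ < 1)
    (h01 : t0 < t1) (hS0 : 0 < S) :
    ∀ s ≤ S, ∀ t ∈ Icc t0 t1, ∀ σ ∈ Icc 0 (2 * π), ∀ y, V s t (y + σ) - V s t y ≤
      (4 / δ ^ 2 + 64 * (2 / δ ^ 2 + 4 ^ (4 / δ))) * M * max 1 (exp (δ * s)) := by
  set g : ℝ → ℝ := fun σ => 1 + σ * (2 * π - σ) with hg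
  have hpi : 0 < π := pi_pos
  have hpi4 : π < 3.15 := pi_lt_d2
  set K : ℝ := 2 / δ ^ 2 with hK
  have hK0 : 0 < K := by positivity
  have hKd : K * δ ^ 2 = 2 := by rw [hK]; field_simp
  set N : ℝ := K + 4 ^ (4 / δ) with hN
  have h4 : (0:ℝ) < 4 ^ (4 / δ) := by positivity
  have hN0 : 0 < N := by positivity
  have g1 : ∀ σ ∈ Icc 0 (2 * π), 1 ≤ g σ := fun σ hσ => by
    simp only [hg]; have := mul_nonneg hσ.1 (sub_nonneg.2 hσ.2); linarith
  have g2 : ∀ σ ∈ Icc 0 (2 * π), g σ ≤ 16 := fun σ hσ => by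
    simp only [hg]; nlinarith [sq_nonneg (σ - π)]
  have hgd : ∀ σ, HasDerivAt g (2 * π - 2 * σ) σ := fun σ => by
    have h1 := ((hasDerivAt_id σ).mul ((hasDerivAt_id σ).const_sub (2 * π))).const_add 1
    exact h1.congr_deriv (by simp; ring)
  have hgd2 : ∀ σ, HasDerivAt (fun σ : ℝ => 2 * π - 2 * σ) (-2) σ := fun σ => by
    have h1 := ((hasDerivAt_id σ).const_mul 2).const_sub (2 * π)
    exact h1.congr_deriv (by norm_num)
  have eq2 : ∀ s, exp (δ / 2 * s) ^ 2 = exp (δ * s) := fun s => by rw [← exp_nat_mul]; congr 1; push_cast; ring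
  have qpos : ∀ s, 0 < exp (δ / 2 * s) := fun s => exp_pos _
  have qS : 1 < exp (δ / 2 * S) := by rw [one_lt_exp_iff]; positivity
  set p : ℝ → ℝ := fun s => K * (exp (δ * s) - 2 * exp (δ / 2 * s)) with hp
  have p1 : ∀ s, -K ≤ p s := fun s => by
    simp only [hp]; rw [← eq2]; nlinarith [sq_nonneg (exp (δ / 2 * s) - 1)]
  have p2 : ∀ s, p s ≤ K * exp (δ * s) := fun s => by
    simp only [hp]; nlinarith [mul_pos hK0 (qpos s)]
  set e0 : ℝ := 2 * M * (K * (δ * exp (δ * S) - 2 * (δ / 2 * exp (δ / 2 * S)))) with he0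
  have he00 : 0 < e0 := by
    have : 0 < δ * exp (δ * S) - 2 * (δ / 2 * exp (δ / 2 * S)) := by
      rw [← eq2]; nlinarith [mul_pos hδ (mul_pos (qpos S) (sub_pos.2 qS))]
    positivity
  suffices H : ∀ ε, 0 < ε → ε < e0 → ∀ s ≤ S, ∀ t ∈ Icc t0 t1, ∀ σ ∈ Icc 0 (2 * π), ∀ y,
      V s t (y + σ) - V s t y ≤ 2 * M * (p s + N * g σ) + ε * (S - s) by
    intro s hs t ht σ hσ y
    have h1 : V s t (y + σ) - V s t y ≤ 2 * M * (p s + N * g σ) :=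
      le_of_eps e0 he00 (k := S - s) fun ε h0 h1 => H ε h0 h1 s hs t ht σ hσ y
    have m1 : 1 ≤ max 1 (exp (δ * s)) := le_max_left _ _
    have m2 : exp (δ * s) ≤ max 1 (exp (δ * s)) := le_max_right _ _
    calc _ ≤ _ := h1
      _ ≤ 2 * M * (K * max 1 (exp (δ * s)) + N * (16 * max 1 (exp (δ * s)))) := by
        gcongr
        · exact (p2 s).trans (by gcongr)
        · linarith [g2 σ hσ]
      _ ≤ _ := by
        have e4 : 4 / δ ^ 2 = 2 * K := by rw [hK]; ring
        rw [e4]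
        have : 0 ≤ N * M * max 1 (exp (δ * s)) := by positivity
        nlinarith
  intro ε hε hε1
  by_contra hcon
  push Not at hcon
  obtain ⟨s1, hs1, r1, hr1, σ1, hσ1, y1, hpos1⟩ := hcon
  have hgc : Continuous g := by simp only [hg]; fun_prop
  have hpc : Continuous p := by simp only [hp]; fun_prop
  have hB0 : 0 ≤ B := (abs_nonneg _).trans (h.bdd s1 hs1 r1 hr1 y1)
  have bpos : ∀ s, ∀ σ ∈ Icc 0 (2 * π), 0 < p s + N * g σ := fun s σ hσ => by
    nlinarith [p1 s, g1 σ hσ, mul_le_mul_of_nonneg_left (g1 σ hσ) hN0.le]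
  obtain ⟨s, hs, ⟨t, σ⟩, ⟨ht, hσ⟩, y, hpos, hmax⟩ := exists_max (isCompact_Icc.prod isCompact_Icc)
    (T := Icc t0 t1 ×ˢ Icc 0 (2 * π))
    (fun s x y => V s x.1 (y + x.2) - V s x.1 y - (2 * M * (p s + N * g x.2) + ε * (S - s))) (S := S)
    (by
      refine ContinuousOn.sub (ContinuousOn.sub ?_ ?_) (by fun_prop)
      · exact h.contV (by fun_prop) (by fun_prop) (by fun_prop) fun x hx => ⟨hx.1, hx.2.1.1⟩
      · exact h.contV (by fun_prop) (by fun_prop) (by fun_prop) fun x hx => ⟨hx.1, hx.2.1.1⟩)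
    (fun s hs x hx y => by
      beta_reduce; rw [h.per s hs _ hx.1, show y + 2 * π + x.2 = y + x.2 + 2 * π by ring, h.per s hs _ hx.1])
    ⟨S - 2 * B / ε, fun s hs0 hs x hx y => by
      have h1 := abs_le.1 (h.bdd s hs _ hx.1 (y + x.2))
      have h2 := abs_le.1 (h.bdd s hs _ hx.1 y)
      have h3 : 2 * B ≤ ε * (S - s) := by
        have : 2 * B / ε ≤ S - s := by linarith
        rw [div_le_iff₀ hε] at this; linarith
      have h5 := mul_pos (mul_pos two_pos hM) (bpos s x.2 hx.2)
      beta_reduce; linarith⟩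
    ⟨s1, hs1, (r1, σ1), ⟨hr1, hσ1⟩, y1, by beta_reduce; linarith⟩
  dsimp only at ht hσ hpos hmax
  have hE := exp_pos (δ * s)
  have hB := mul_pos (mul_pos two_pos hM) (bpos s σ hσ)
  have hεS : 0 ≤ ε * (S - s) := mul_nonneg hε.le (by linarith)
  have hσ0 : 0 < σ := by
    rcases hσ.1.lt_or_eq with h1 | h1
    · exact h1
    · subst h1; simp at hpos; linarith
  have hσ2 : σ < 2 * π := by
    rcases hσ.2.lt_or_eq with h1 | h1
    · exact h1
    · subst h1; rw [h.per s hs t ht] at hpos; linarith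
  have dp : ∀ s, HasDerivAt p (K * (δ * exp (δ * s) - 2 * (δ / 2 * exp (δ / 2 * s)))) s := fun s =>
    ((hexp δ s).sub ((hexp (δ / 2) s).const_mul 2)).const_mul K
  have ds : ∀ s, HasDerivAt (fun s => 2 * M * (p s + N * g σ) + ε * (S - s))
      (2 * M * (K * (δ * exp (δ * s) - 2 * (δ / 2 * exp (δ / 2 * s)))) - ε) s := fun s => by
    have := (((dp s).add_const (N * g σ)).const_mul (2 * M)).add (((hasDerivAt_id s).const_sub S).const_mul ε)
    exact this.congr_deriv (by ring)
  have dss : HasDerivAt (fun s => 2 * M * (K * (δ * exp (δ * s) - 2 * (δ / 2 * exp (δ / 2 * s)))) - ε)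
      (2 * M * (K * (δ * (δ * exp (δ * s)) - 2 * (δ / 2 * (δ / 2 * exp (δ / 2 * s)))))) s :=
    (((((hexp δ s).const_mul δ).sub (((hexp (δ / 2) s).const_mul (δ / 2)).const_mul 2)).const_mul K).const_mul (2 * M)).sub_const ε
  have hsd : ∀ s ≤ S, HasDerivWithinAt (fun s => V s t (y + σ) - V s t y - (2 * M * (p s + N * g σ) + ε * (S - s)))
      (Vs s t (y + σ) - Vs s t y - (2 * M * (K * (δ * exp (δ * s) - 2 * (δ / 2 * exp (δ / 2 * s)))) - ε)) (Iic S) s := fun s hs =>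
    ((h.hs s hs t ht _).sub (h.hs s hs t ht y)).sub (ds s).hasDerivWithinAt
  have hsS : s < S := by
    rcases hs.lt_or_eq with h1 | h1
    · exact h1
    · exfalso
      have := s_first (hsd S le_rfl) (fun s' hs' => by
        have := hmax s' hs' (t, σ) ⟨ht, hσ⟩ y
        rw [h1] at this; exact this)
      rw [h.hS t ht, h.hS t ht] at this
      linarith
  have q1 := s_second hsS hsd (((h.hss s hs t ht _).sub (h.hss s hs t ht y)).sub dss.hasDerivWithinAt)
    (fun s' hs' => hmax s' hs' (t, σ) ⟨ht, hσ⟩ y)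
  have q2 := second_le_of_max h01 ht (g := fun t => V s t (y + σ) - V s t y - (2 * M * (p s + N * g σ) + ε * (S - s)))
    (fun t ht => ((h.ht s hs t ht _).sub (h.ht s hs t ht y)).sub_const _)
    (by
      rintro (h1 | h1)
      · simp [h1, h.n0 s hsS]
      · simp [h1, h.n1 s hsS])
    (((h.htt s hs t ht _).sub (h.htt s hs t ht y)))
    (fun t' ht' => hmax s hs (t', σ) ⟨ht', hσ⟩ y)
  have q3 := second_le_interior hσ0 hσ2 (g := fun σ => V s t (y + σ) - V s t y - (2 * M * (p s + N * g σ) + ε * (S - s)))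
    (g' := fun σ => Vy s t (y + σ) - 2 * M * (N * (2 * π - 2 * σ))) (d := Vyy s t (y + σ) - 2 * M * (N * (-2)))
    (fun σ _ => by
      have a1 := (h.hy s hs t ht (y + σ)).comp_const_add y σ
      exact ((a1.sub_const _).sub (((((hgd σ).const_mul N).const_add _).const_mul _).add_const _)).hasDerivWithinAt)
    (by
      have a1 := (h.hyy s hs t ht (y + σ)).comp_const_add y σ
      exact (a1.sub (((hgd2 σ).const_mul N).const_mul (2 * M))).hasDerivWithinAt)
    (fun σ' hσ' => hmax s hs (t, σ') ⟨ht, hσ'⟩ y)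
  have q4 := second_le_interior (a := y + σ - 2 * π) (b := y + σ) (p := y) (by linarith) (by linarith)
    (g := fun y' => V s t (y + σ) - V s t y' - (2 * M * (p s + N * g (y + σ - y')) + ε * (S - s)))
    (g' := fun y' => - Vy s t y' + 2 * M * (N * (2 * π - 2 * (y + σ - y')))) (d := - Vyy s t y + 2 * M * (N * 2))
    (fun y' _ => by
      have a1 := h.hy s hs t ht y'
      have a2 := (hgd (y + σ - y')).comp_const_sub (y + σ) y'
      exact ((a1.const_sub _).sub ((((a2.const_mul N).const_add _).const_mul _).add_const _)).hasDerivWithinAt.congr_deriv (by ring))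
    (by
      have a1 := h.hyy s hs t ht y
      have a2 := (hgd2 (y + σ - y)).comp_const_sub (y + σ) y
      exact (a1.neg.add ((a2.const_mul N).const_mul (2 * M))).hasDerivWithinAt.congr_deriv (by ring))
    (fun y' hy' => by
      have := hmax s hs (t, y + σ - y') ⟨ht, by linarith [hy'.2], by linarith [hy'.1]⟩ y'
      beta_reduce
      dsimp only at this
      rwa [show y' + (y + σ - y') = y + σ by ring, ← show y + σ - y = σ by ring, show y + (y + σ - y) = y + σ by ring] at this)
  have w1 := abs_le.1 (h.eqn s hs t ht (y + σ))
  have w2 := abs_le.1 (h.eqn s hs t ht y)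
  set q := exp (δ / 2 * s) with hq
  have hq0 : 0 < q := exp_pos _
  have hqq : exp (δ * s) = q ^ 2 := (eq2 s).symm
  have hy2 : exp (2 * s) * (Vyy s t (y + σ) - Vyy s t y) ≤ exp (2 * s) * (-(8 * M * N)) :=
    mul_le_mul_of_nonneg_left (by linarith) (exp_pos _).le
  have key : 2 * (q ^ 2 - q / 2) - 4 * N * exp (2 * s) ≤ - 2 * q ^ 2 := yosc_key hδ hδ1 hK0
  have ek : 2 * M * (K * (δ * (δ * exp (δ * s)) - 2 * (δ / 2 * (δ / 2 * q)))) = 2 * M * (2 * (q ^ 2 - q / 2)) := by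
    rw [hqq]; linear_combination (2 * M * (q ^ 2 - q / 2)) * hKd
  rw [ek] at q1
  have key' := mul_le_mul_of_nonneg_left key (by positivity : 0 ≤ 2 * M)
  rw [hqq] at w1 w2
  have hMq : 0 < M * q ^ 2 := by positivity
  linarith

lemma Pol.onept (h : Pol V Vs Vss Vt Vtt Vy Vyy t0 t1 S c0 M δ B) (hM : 0 < M) (hδ : 0 < δ)
    (h01 : t0 < t1) {s1 m1 : ℝ} (hs1 : s1 < S) (hm1 : ∀ t ∈ Icc t0 t1, ∀ y, V s1 t y ≤ m1) :
    ∀ s ≤ s1, ∀ t ∈ Icc t0 t1, ∀ y, V s t y ≤ m1 + 2 / δ ^ 2 * M * exp (δ * s1) := by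
  set K : ℝ := 2 / δ ^ 2 with hK
  have hK0 : 0 < K := by positivity
  have hKd : K * δ ^ 2 = 2 := by rw [hK]; field_simp
  suffices H : ∀ ε, 0 < ε → ε < 1 → ∀ s ≤ s1, ∀ t ∈ Icc t0 t1, ∀ y,
      V s t y ≤ m1 + K * M * (exp (δ * s1) - exp (δ * s)) + ε * (s1 - s) by
    intro s hs t ht y
    have h1 : V s t y ≤ m1 + K * M * (exp (δ * s1) - exp (δ * s)) :=
      le_of_eps 1 one_pos (k := s1 - s) fun ε h0 h1 => H ε h0 h1 s hs t ht y
    have : 0 < K * M * exp (δ * s) := by positivity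
    nlinarith
  intro ε hε hε1
  by_contra hcon
  push Not at hcon
  obtain ⟨s2, hs2, r1, hr1, y1, hpos1⟩ := hcon
  have emono : ∀ s ≤ s1, 0 ≤ K * M * (exp (δ * s1) - exp (δ * s)) := fun s hs => by
    have : exp (δ * s) ≤ exp (δ * s1) := by gcongr
    exact mul_nonneg (by positivity) (by linarith)
  obtain ⟨s, hs, t, ht, y, hpos, hmax⟩ := exists_max (isCompact_Icc (a := t0) (b := t1))
    (fun s t y => V s t y - (m1 + K * M * (exp (δ * s1) - exp (δ * s)) + ε * (s1 - s))) (S := s1)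
    (by
      refine ContinuousOn.sub ?_ (by fun_prop)
      · exact h.contV (by fun_prop) (by fun_prop) (by fun_prop) fun x hx => ⟨le_trans hx.1 hs1.le, hx.2.1⟩)
    (fun s hs x hx y => by beta_reduce; rw [h.per s (hs.trans hs1.le) _ hx])
    ⟨s1 - (B + |m1|) / ε, fun s hs0 hs x hx y => by
      have h1 := abs_le.1 (h.bdd s (hs.trans hs1.le) _ hx y)
      have h3 : B + |m1| ≤ ε * (s1 - s) := by
        have : (B + |m1|) / ε ≤ s1 - s := by linarith
        rw [div_le_iff₀ hε] at this; linarith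
      have := neg_abs_le m1
      beta_reduce; linarith [emono s hs]⟩
    ⟨s2, hs2, r1, hr1, y1, by beta_reduce; linarith⟩
  beta_reduce at hpos hmax
  have hss : s < s1 := by
    rcases hs.lt_or_eq with h1 | h1
    · exact h1
    · exfalso
      subst h1
      have := hm1 t ht y
      simp at hpos; linarith
  have hsS : s ≤ S := hss.le.trans hs1.le
  have dd : ∀ s, HasDerivAt (fun s => m1 + K * M * (exp (δ * s1) - exp (δ * s)) + ε * (s1 - s))
      (- (K * M * (δ * exp (δ * s))) - ε) s := fun s => by
    have := ((((hexp δ s).const_sub (exp (δ * s1))).const_mul (K * M)).const_add m1).add (((hasDerivAt_id s).const_sub s1).const_mul ε)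
    exact this.congr_deriv (by ring)
  have q1 := s_second hss (g := fun s => V s t y - (m1 + K * M * (exp (δ * s1) - exp (δ * s)) + ε * (s1 - s)))
    (fun s hs => ((h.hs s (hs.trans hs1.le) t ht y).mono (Iic_subset_Iic.2 hs1.le)).sub (dd s).hasDerivWithinAt)
    (d := Vss s t y - (-(K * M * (δ * (δ * exp (δ * s))))))
    (((h.hss s hsS t ht y).mono (Iic_subset_Iic.2 hs1.le)).sub
      (((((hexp δ s).const_mul δ).const_mul (K * M)).neg).sub_const ε).hasDerivWithinAt)
    (fun s' hs' => hmax s' hs' t ht y)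
  have q2 := second_le_of_max h01 ht (g := fun t => V s t y - (m1 + K * M * (exp (δ * s1) - exp (δ * s)) + ε * (s1 - s)))
    (fun t ht => (h.ht s hsS t ht y).sub_const _)
    (by
      rintro (h1 | h1)
      · simp [h1, h.n0 s (hss.trans hs1)]
      · simp [h1, h.n1 s (hss.trans hs1)])
    (h.htt s hsS t ht y)
    (fun t' ht' => hmax s hs t' ht' y)
  have q3 := y_second (p := y) (g := fun y => V s t y - (m1 + K * M * (exp (δ * s1) - exp (δ * s)) + ε * (s1 - s)))
    (fun y => (h.hy s hsS t ht y).sub_const _) (h.hyy s hsS t ht y) (fun y' => hmax s hs t ht y')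
  have w := abs_le.1 (h.eqn s hsS t ht y)
  have ek : K * M * (δ * (δ * exp (δ * s))) = 2 * (M * exp (δ * s)) := by rw [← hKd]; ring
  rw [ek] at q1
  have : exp (2 * s) * Vyy s t y ≤ 0 := mul_nonpos_of_nonneg_of_nonpos (exp_pos _).le q3
  have : 0 < M * exp (δ * s) := by positivity
  linarith

lemma Pol.bound (h : Pol V Vs Vss Vt Vtt Vy Vyy t0 t1 S c0 M δ B) (hM : 0 < M) (hδ : 0 < δ) (hδ1 : δ < 1)
    (h01 : t0 < t1) (hπ : t1 - t0 ≤ π / 2) (hS0 : 0 < S)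
    (hlim : ∃ t ∈ Icc t0 t1, Tendsto (fun s => V s t 0) atBot (𝓝 0)) :
    ∀ s < S, ∀ t ∈ Icc t0 t1, ∀ y, |V s t y| ≤
      (180 + (4 / δ ^ 2 + 64 * (2 / δ ^ 2 + 4 ^ (4 / δ))) + 2 / δ ^ 2) * M * max 1 (exp (δ * s)) := by
  suffices H : ∀ {V Vs Vss Vt Vtt Vy Vyy : ℝ → ℝ → ℝ → ℝ} {c0 : ℝ}, Pol V Vs Vss Vt Vtt Vy Vyy t0 t1 S c0 M δ B →
      (∃ t ∈ Icc t0 t1, Tendsto (fun s => V s t 0) atBot (𝓝 0)) → ∀ s < S, ∀ t ∈ Icc t0 t1, ∀ y, - V s t y ≤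
      (180 + (4 / δ ^ 2 + 64 * (2 / δ ^ 2 + 4 ^ (4 / δ))) + 2 / δ ^ 2) * M * max 1 (exp (δ * s)) by
    intro s hs t ht y
    have h1 := H h hlim s hs t ht y
    obtain ⟨t', ht', hl⟩ := hlim
    have h2 := H h.neg ⟨t', ht', by simpa using hl.neg⟩ s hs t ht y
    rw [abs_le]; constructor <;> linarith
  intro V Vs Vss Vt Vtt Vy Vyy c0 h hlim s hs t ht y
  obtain ⟨t', ht', hl⟩ := hlim
  set K2 := 4 / δ ^ 2 + 64 * (2 / δ ^ 2 + 4 ^ (4 / δ)) with hK2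
  set W := max 1 (exp (δ * s)) with hW
  have hW1 : exp (δ * s) ≤ W := le_max_right _ _
  have hosc : ∀ t2 ∈ Icc t0 t1, ∀ y2, V s t2 y2 ≤ V s t y + (180 + K2) * M * W := by
    intro t2 ht2 y2
    obtain ⟨y3, hy3, e3⟩ := Function.Periodic.exists_mem_Ico (f := fun y => V s t2 y) (fun y => h.per s hs.le t2 ht2 y)
      (by positivity : 0 < 2 * π) y2 y
    have a1 := h.yosc hM hδ hδ1 h01 hS0 s hs.le t2 ht2 (y3 - y) ⟨by linarith [hy3.1], by linarith [hy3.2]⟩ y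
    rw [add_sub_cancel] at a1
    have a2 : V s t2 y - V s t y ≤ 180 * M * exp (δ * s) := by
      rcases le_total t t2 with h1 | h1
      · exact h.theta hM hδ hδ1 hπ s hs.le t2 ht2 t ht h1 y
      · have := h.neg.theta hM hδ hδ1 hπ s hs.le t ht t2 ht2 h1 y
        linarith
    have a3 : 180 * M * exp (δ * s) ≤ 180 * M * W := by gcongr
    have e3 : V s t2 y2 = V s t2 y3 := e3
    rw [e3]
    have : (180 + K2) * M * W = 180 * M * W + K2 * M * W := by ring
    linarith
  have h1 := h.onept hM hδ h01 hs hosc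
  have h2 : 0 ≤ V s t y + (180 + K2) * M * W + 2 / δ ^ 2 * M * exp (δ * s) := by
    refine le_of_tendsto hl ?_
    filter_upwards [eventually_le_atBot s] with s' hs'
    exact h1 s' hs' t' ht' 0
  have h3 : 2 / δ ^ 2 * M * exp (δ * s) ≤ 2 / δ ^ 2 * M * W := by gcongr
  have : (180 + K2 + 2 / δ ^ 2) * M * W = (180 + K2) * M * W + 2 / δ ^ 2 * M * W := by ring
  linarith

end


lemma rx_eq (x : V3) : rx x = ‖(⟨x 0, x 2⟩ : ℂ)‖ := by
  rw [rx, Complex.norm_def, Complex.normSq_mk]; congr 1; ring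

lemma rx_nonneg (x : V3) : 0 ≤ rx x := Real.sqrt_nonneg _

lemma rx_sq (x : V3) : rx x ^ 2 = x 0 ^ 2 + x 2 ^ 2 := Real.sq_sqrt (by positivity)

lemma rx_add_le (x y : V3) : rx (x + y) ≤ rx x + rx y := by
  rw [rx_eq, rx_eq, rx_eq]
  have : (⟨(x + y) 0, (x + y) 2⟩ : ℂ) = ⟨x 0, x 2⟩ + ⟨y 0, y 2⟩ := by
    apply Complex.ext <;> simp
  rw [this]; exact norm_add_le _ _

lemma rx_smul (a : ℝ) (x : V3) : rx (a • x) = |a| * rx x := by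
  rw [rx, rx]
  have : (a • x) 0 ^ 2 + (a • x) 2 ^ 2 = a ^ 2 * (x 0 ^ 2 + x 2 ^ 2) := by simp; ring
  rw [this, Real.sqrt_mul (sq_nonneg a), Real.sqrt_sq_eq_abs]

lemma continuous_rx : Continuous rx := by
  unfold rx; fun_prop

lemma rx_le_norm (x : V3) : rx x ≤ ‖x‖ := by
  rw [EuclideanSpace.norm_eq, rx]
  apply Real.sqrt_le_sqrt
  simp [Fin.sum_univ_three]; positivity

lemma rx_pos_iff (x : V3) : 0 < rx x ↔ x ∉ edge := by
  rw [rx, Real.sqrt_pos]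
  constructor
  · rintro h ⟨h0, h2⟩; simp [h0, h2] at h
  · intro h
    by_contra hc
    exact h ⟨by nlinarith [sq_nonneg (x 0), sq_nonneg (x 2)], by nlinarith [sq_nonneg (x 0), sq_nonneg (x 2)]⟩

lemma abs_le_rx0 (x : V3) : |x 0| ≤ rx x := Real.abs_le_sqrt (by nlinarith [sq_nonneg (x 2)])
lemma abs_le_rx2 (x : V3) : |x 2| ≤ rx x := Real.abs_le_sqrt (by nlinarith [sq_nonneg (x 0)])

/-- an interior point -/
def qpt (b : ℝ) : V3 := ee 0 + (b + 1) • ee 2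

lemma qpt0 (b : ℝ) : qpt b 0 = 1 := by simp [qpt, ee_apply]
lemma qpt1 (b : ℝ) : qpt b 1 = 0 := by simp [qpt, ee_apply]
lemma qpt2 (b : ℝ) : qpt b 2 = b + 1 := by simp [qpt, ee_apply]

lemma convex_QL (b L : ℝ) : Convex ℝ (wedgeQL b L) := by
  intro x hx y hy s t hs ht hst
  obtain ⟨⟨hx0, hx2⟩, hx3⟩ := hx
  obtain ⟨⟨hy0, hy2⟩, hy3⟩ := hy
  have hpos : ∀ a c : ℝ, 0 < a → 0 < c → 0 < s * a + t * c := fun a c ha hc => by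
    rcases hs.lt_or_eq with h | h
    · have := mul_pos h ha; have := mul_nonneg ht hc.le; linarith
    · subst h; have : t = 1 := by linarith
      subst this; simpa using hc
  refine ⟨⟨?_, ?_⟩, ?_⟩
  · simpa using hpos _ _ hx0 hy0
  · have := hpos _ _ (sub_pos.2 hx2) (sub_pos.2 hy2)
    simp; linarith
  · have h1 := rx_add_le (s • x) (t • y)
    rw [rx_smul, rx_smul, abs_of_nonneg hs, abs_of_nonneg ht] at h1
    have := hpos _ _ (sub_pos.2 hx3) (sub_pos.2 hy3)
    have e : (s + t) * L = L := by rw [hst, one_mul]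
    change rx (s • x + t • y) < L
    linarith

lemma isOpen_Q (b : ℝ) : IsOpen (wedgeQ b) := by
  have : wedgeQ b = {y : V3 | 0 < y 0} ∩ {y : V3 | b * y 0 < y 2} := rfl
  rw [this]
  exact (isOpen_lt (by fun_prop) (by fun_prop)).inter (isOpen_lt (by fun_prop) (by fun_prop))

lemma isOpen_QL (b L : ℝ) : IsOpen (wedgeQL b L) :=
  (isOpen_Q b).inter (isOpen_lt continuous_rx continuous_const)

/-- closed description -/
def CQ (b : ℝ) : Set V3 := {y | 0 ≤ y 0 ∧ b * y 0 ≤ y 2}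

lemma isClosed_CQ (b : ℝ) : IsClosed (CQ b) :=
  (isClosed_le (by fun_prop) (by fun_prop) : IsClosed {y : V3 | 0 ≤ y 0}).inter
    (isClosed_le (by fun_prop) (by fun_prop) : IsClosed {y : V3 | b * y 0 ≤ y 2})

lemma add_qpt_mem {b : ℝ} {x : V3} (hx : x ∈ CQ b) {t : ℝ} (ht : 0 < t) : x + t • qpt b ∈ wedgeQ b := by
  constructor
  · simp [qpt0]; linarith [hx.1]
  · simp [qpt0, qpt2]; linarith [hx.2]

lemma closure_QL {b L : ℝ} (hL : 0 < L) : closure (wedgeQL b L) = {y | y ∈ CQ b ∧ rx y ≤ L} := by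
  apply Subset.antisymm
  · apply closure_minimal
    · rintro x ⟨⟨h0, h2⟩, h3⟩; exact ⟨⟨h0.le, h2.le⟩, h3.le⟩
    · exact (isClosed_CQ b).inter (isClosed_le continuous_rx continuous_const)
  · rintro x ⟨hx, hr⟩
    have hm : ∀ t : ℝ, 0 < t → t < 1 / (1 + rx (qpt b) / L) → (1 - t * (1 + rx (qpt b) / L)) • x + t • qpt b ∈ wedgeQL b L := by
      intro t ht ht1
      have hq : 0 ≤ rx (qpt b) / L := div_nonneg (rx_nonneg _) hL.le
      rw [lt_div_iff₀ (by linarith)] at ht1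
      have hp : 0 ≤ 1 - t * (1 + rx (qpt b) / L) := by linarith
      refine ⟨add_qpt_mem ⟨?_, ?_⟩ ht, ?_⟩
      · simpa using mul_nonneg hp hx.1
      · have := mul_nonneg hp (sub_nonneg.2 hx.2)
        simp only [PiLp.smul_apply, smul_eq_mul]; linarith
      · have h1 := rx_add_le ((1 - t * (1 + rx (qpt b) / L)) • x) (t • qpt b)
        rw [rx_smul, rx_smul, abs_of_nonneg hp, abs_of_pos ht] at h1
        have h2 := mul_le_mul_of_nonneg_left hr hp
        have e : (1 - t * (1 + rx (qpt b) / L)) * L = L - t * L - t * rx (qpt b) := by field_simp; ring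
        have := mul_pos ht hL
        linarith
    have hlim : Tendsto (fun t : ℝ => (1 - t * (1 + rx (qpt b) / L)) • x + t • qpt b) (𝓝[>] 0) (𝓝 x) := by
      have : Continuous (fun t : ℝ => (1 - t * (1 + rx (qpt b) / L)) • x + t • qpt b) := by fun_prop
      have := this.tendsto 0
      simp at this
      exact this.mono_left nhdsWithin_le_nhds
    refine mem_closure_of_tendsto hlim ?_
    have hq : 0 ≤ rx (qpt b) / L := div_nonneg (rx_nonneg _) hL.le
    filter_upwards [Ioo_mem_nhdsGT (by positivity : (0:ℝ) < 1 / (1 + rx (qpt b) / L))] with t ht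
    exact hm t ht.1 ht.2

lemma closure_Q (b : ℝ) : closure (wedgeQ b) = CQ b := by
  apply Subset.antisymm
  · apply closure_minimal
    · rintro x ⟨h0, h2⟩; exact ⟨h0.le, h2.le⟩
    · exact isClosed_CQ b
  · intro x hx
    have hlim : Tendsto (fun t : ℝ => x + t • qpt b) (𝓝[>] 0) (𝓝 x) := by
      have : Continuous (fun t : ℝ => x + t • qpt b) := by fun_prop
      have := this.tendsto 0
      simp at this
      exact this.mono_left nhdsWithin_le_nhds
    refine mem_closure_of_tendsto hlim ?_
    filter_upwards [self_mem_nhdsWithin] with t ht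
    exact add_qpt_mem hx ht

lemma mem_SL {b L : ℝ} (hL : 0 < L) {x : V3} : x ∈ SL b L ↔ (0 ≤ x 0 ∧ b * x 0 ≤ x 2) ∧ rx x ≤ L ∧ 0 < rx x := by
  rw [SL, closure_QL hL, rx_pos_iff]
  constructor
  · rintro ⟨⟨h1, h2⟩, h3⟩; exact ⟨h1, h2, h3⟩
  · rintro ⟨h1, h2, h3⟩; exact ⟨⟨h1, h2⟩, h3⟩

lemma mem_SQ {b : ℝ} {x : V3} : x ∈ SQ b ↔ (0 ≤ x 0 ∧ b * x 0 ≤ x 2) ∧ 0 < rx x := by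
  rw [SQ, closure_Q, rx_pos_iff]; rfl

lemma isOpen_edgeC : IsOpen (edgeᶜ) := by
  have : edgeᶜ = {x : V3 | 0 < rx x} := by ext x; exact (rx_pos_iff x).symm
  rw [this]; exact isOpen_lt continuous_const continuous_rx

lemma QL_subset_SL {b L : ℝ} : wedgeQL b L ⊆ SL b L := fun x hx =>
  ⟨subset_closure hx, fun h => by have := hx.1.1; rw [h.1] at this; exact lt_irrefl _ this⟩

lemma Q_subset_SQ {b : ℝ} : wedgeQ b ⊆ SQ b := fun x hx =>
  ⟨subset_closure hx, fun h => by have := hx.1; rw [h.1] at this; exact lt_irrefl _ this⟩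

lemma QL_nonempty (b : ℝ) {L : ℝ} (hL : 0 < L) : (wedgeQL b L).Nonempty := by
  have h0 : (0 : V3) ∈ closure (wedgeQL b L) := by
    rw [closure_QL hL]; exact ⟨⟨by simp, by simp⟩, by simp [rx, hL.le]⟩
  exact closure_nonempty_iff.1 ⟨0, h0⟩

lemma unique_SL (b : ℝ) {L : ℝ} (hL : 0 < L) : UniqueDiffOn ℝ (SL b L) := by
  have h1 : UniqueDiffOn ℝ (closure (wedgeQL b L)) := by
    apply uniqueDiffOn_convex (convex_QL b L).closure
    obtain ⟨x, hx⟩ := QL_nonempty b hL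
    exact ⟨x, interior_mono subset_closure (by rwa [(isOpen_QL b L).interior_eq])⟩
  exact h1.inter isOpen_edgeC

lemma convex_CQ (b : ℝ) : Convex ℝ (CQ b) := by
  intro x hx y hy s t hs ht hst
  constructor
  · have h1 := mul_nonneg hs hx.1
    have h2 := mul_nonneg ht hy.1
    simp; linarith
  · have h1 := mul_nonneg hs (sub_nonneg.2 hx.2)
    have h2 := mul_nonneg ht (sub_nonneg.2 hy.2)
    simp; linarith

lemma unique_SQ (b : ℝ) : UniqueDiffOn ℝ (SQ b) := by
  have h1 : UniqueDiffOn ℝ (closure (wedgeQ b)) := by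
    rw [closure_Q]
    apply uniqueDiffOn_convex (convex_CQ b)
    obtain ⟨x, hx⟩ := QL_nonempty b one_pos
    refine ⟨x, interior_mono (s := wedgeQ b) ?_ (by rw [(isOpen_Q b).interior_eq]; exact hx.1)⟩
    rw [← closure_Q]; exact subset_closure
  exact h1.inter isOpen_edgeC

lemma SL_subset_SQ {b L : ℝ} : SL b L ⊆ SQ b := fun x hx =>
  ⟨closure_mono (fun y hy => hy.1) hx.1, hx.2⟩

/-- the dense subset avoiding `r = 1` -/
def D1 (b L : ℝ) : Set V3 := {y ∈ wedgeQL b L | rx y ≠ 1}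

lemma D1_dense {b L : ℝ} {x : V3} (hx : x ∈ closure (wedgeQL b L)) : x ∈ closure (D1 b L) := by
  suffices h : wedgeQL b L ⊆ closure (D1 b L) from closure_minimal h isClosed_closure hx
  intro x hx
  by_cases h1 : rx x = 1
  · have hlim : Tendsto (fun t : ℝ => t • x) (𝓝[<] 1) (𝓝 x) := by
      have : Continuous (fun t : ℝ => t • x) := by fun_prop
      have := this.tendsto 1
      simp at this
      exact this.mono_left nhdsWithin_le_nhds
    refine mem_closure_of_tendsto hlim ?_
    filter_upwards [Ioo_mem_nhdsLT (by norm_num : (0:ℝ) < 1)] with t ht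
    have e : rx (t • x) = t := by rw [rx_smul, h1, abs_of_pos ht.1, mul_one]
    refine ⟨⟨⟨?_, ?_⟩, ?_⟩, ?_⟩
    · simpa using mul_pos ht.1 hx.1.1
    · have := mul_pos ht.1 (sub_pos.2 hx.1.2)
      simp; linarith
    · change rx (t • x) < L
      rw [e]; have := hx.2; rw [h1] at this; linarith [ht.2]
    · rw [e]; exact ht.2.ne
  · exact subset_closure ⟨hx, h1⟩

lemma D1_subset_SL {b L : ℝ} : D1 b L ⊆ SL b L := fun _ hx => QL_subset_SL hx.1


lemma pdW_cd {S : Set V3} (hS : UniqueDiffOn ℝ S) {v : V3 → ℝ} {n m : ℕ} (hv : ContDiffOn ℝ n v S) (hm : m + 1 ≤ n) (i : Fin 3) :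
    ContDiffOn ℝ m (pdW S i v) S := by
  have h1 : ContDiffOn ℝ m (fderivWithin ℝ v S) S := hv.fderivWithin hS (by exact_mod_cast hm)
  exact h1.clm_apply contDiffOn_const

lemma pdW_fd {S : Set V3} {v : V3 → ℝ} {n : ℕ} (hv : ContDiffOn ℝ n v S) (hn : 1 ≤ n) {x : V3} (hx : x ∈ S) :
    HasFDerivWithinAt v (LL fun i => pdW S i v x) S x := by
  have h := (hv.differentiableOn (by exact_mod_cast Nat.one_le_iff_ne_zero.1 hn) x hx).hasFDerivWithinAt
  rw [eq_LL (fderivWithin ℝ v S x)] at h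
  exact h

lemma curve_deriv {S : Set V3} {w : V3 → ℝ} {g : Fin 3 → ℝ} {c : ℝ → V3} {c' : V3} {I : Set ℝ} {s : ℝ}
    (hw : HasFDerivWithinAt w (LL g) S (c s)) (hc : HasDerivWithinAt c c' I s) (hm : MapsTo c I S) :
    HasDerivWithinAt (fun s => w (c s)) (g 0 * c' 0 + g 1 * c' 1 + g 2 * c' 2) I s := by
  have := hw.comp_hasDerivWithinAt s hc hm
  refine this.congr_deriv ?_
  rw [LL_apply, Fin.sum_univ_three]

/-- polar coordinates -/
def cart (s t y : ℝ) : V3 := (exp s * cos t) • ee 0 + y • ee 1 + (exp s * sin t) • ee 2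

lemma cart0 (s t y : ℝ) : cart s t y 0 = exp s * cos t := by simp [cart, ee_apply]
lemma cart1 (s t y : ℝ) : cart s t y 1 = y := by simp [cart, ee_apply]
lemma cart2 (s t y : ℝ) : cart s t y 2 = exp s * sin t := by simp [cart, ee_apply]

lemma rx_cart (s t y : ℝ) : rx (cart s t y) = exp s := by
  rw [rx, cart0, cart2]
  have : (exp s * cos t) ^ 2 + (exp s * sin t) ^ 2 = exp s ^ 2 := by
    linear_combination (exp s ^ 2) * (sin_sq_add_cos_sq t)
  rw [this, Real.sqrt_sq (exp_pos s).le]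

lemma cart_ds (s t y : ℝ) : HasDerivAt (fun s => cart s t y) (cart s t 0) s := by
  have h1 := ((Real.hasDerivAt_exp s).mul_const (cos t)).smul_const (ee 0)
  have h2 := ((Real.hasDerivAt_exp s).mul_const (sin t)).smul_const (ee 2)
  exact ((h1.add_const (y • ee 1)).add h2).congr_deriv (by simp [cart])

lemma cart_dt (s t y : ℝ) : HasDerivAt (fun t => cart s t y) ((-(exp s * sin t)) • ee 0 + (exp s * cos t) • ee 2) t := by
  have h1 := ((Real.hasDerivAt_cos t).const_mul (exp s)).smul_const (ee 0)
  have h2 := ((Real.hasDerivAt_sin t).const_mul (exp s)).smul_const (ee 2)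
  exact ((h1.add_const (y • ee 1)).add h2).congr_deriv (by simp)

lemma cart_dy (s t y : ℝ) : HasDerivAt (fun y => cart s t y) (ee 1) y := by
  have h1 := ((hasDerivAt_id y).smul_const (ee 1)).const_add ((exp s * cos t) • ee 0)
  exact (h1.add_const ((exp s * sin t) • ee 2)).congr_deriv (by simp)

lemma cart_cont : Continuous fun p : ℝ × ℝ × ℝ => cart p.1 p.2.1 p.2.2 := by
  unfold cart; fun_prop

lemma ang (b t : ℝ) : cos (arctan b) * (sin t - b * cos t) = sin (t - arctan b) := by
  rw [sin_sub]
  have h1 : sin (arctan b) = b * cos (arctan b) := by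
    have := Real.tan_arctan b
    rw [tan_eq_sin_div_cos, div_eq_iff (cos_arctan_pos b).ne'] at this
    exact this
  rw [h1]; ring

lemma cart_mem {b L s t y : ℝ} (hb : 0 < b) (hL : 0 < L) (hs : s ≤ Real.log L) (ht : t ∈ Icc (arctan b) (π / 2)) :
    cart s t y ∈ SL b L := by
  have hθ : 0 < arctan b := by rw [← arctan_zero]; exact arctan_strictMono hb
  rw [mem_SL hL, cart0, cart2, rx_cart]
  have hc : 0 ≤ cos t := cos_nonneg_of_neg_pi_div_two_le_of_le (by linarith [ht.1, pi_pos]) ht.2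
  refine ⟨⟨mul_nonneg (exp_pos s).le hc, ?_⟩, ?_, exp_pos s⟩
  · have h1 := ang b t
    have h2 : 0 ≤ sin (t - arctan b) := sin_nonneg_of_nonneg_of_le_pi (by linarith [ht.1]) (by linarith [ht.2, pi_pos])
    have h3 : 0 ≤ sin t - b * cos t := by
      rw [← h1] at h2; exact nonneg_of_mul_nonneg_right h2 (cos_arctan_pos b)
    have := mul_nonneg (exp_pos s).le h3
    linarith
  · rwa [← le_log_iff_exp_le hL]

lemma exists_cart {b L : ℝ} (hb : 0 < b) (hL : 0 < L) {x : V3} (hx : x ∈ SL b L) :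
    ∃ t ∈ Icc (arctan b) (π / 2), x = cart (Real.log (rx x)) t (x 1) := by
  obtain ⟨⟨h0, h2⟩, h3, h4⟩ := (mem_SL hL).1 hx
  have hx2 : 0 ≤ x 2 := le_trans (mul_nonneg hb.le h0) h2
  have hle : x 0 / rx x ≤ 1 := by rw [div_le_one h4]; exact (le_abs_self _).trans (abs_le_rx0 x)
  have hge : 0 ≤ x 0 / rx x := div_nonneg h0 h4.le
  have hc : cos (arccos (x 0 / rx x)) = x 0 / rx x := cos_arccos (by linarith) hle
  have hs : sin (arccos (x 0 / rx x)) = x 2 / rx x := by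
    rw [sin_arccos, Real.sqrt_eq_iff_mul_self_eq (by nlinarith) (by positivity)]
    have := rx_sq x
    field_simp; linarith
  have ht : arccos (x 0 / rx x) ≤ π / 2 := arccos_le_pi_div_two.2 hge
  refine ⟨arccos (x 0 / rx x), ⟨?_, ht⟩, ?_⟩
  · by_contra hcon
    push Not at hcon
    have h5 := ang b (arccos (x 0 / rx x))
    have h6 : sin (arccos (x 0 / rx x) - arctan b) < 0 :=
      sin_neg_of_neg_of_neg_pi_lt (by linarith) (by linarith [arccos_nonneg (x 0 / rx x), arctan_lt_pi_div_two b, pi_pos])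
    rw [← h5, hc, hs] at h6
    have h7 : 0 ≤ x 2 / rx x - b * (x 0 / rx x) := by
      have : x 2 / rx x - b * (x 0 / rx x) = (x 2 - b * x 0) / rx x := by ring
      rw [this]; exact div_nonneg (by linarith) h4.le
    have := mul_nonneg (cos_arctan_pos b).le h7
    linarith
  · rw [cart, hc, hs, exp_log h4, mul_div_cancel₀ _ h4.ne', mul_div_cancel₀ _ h4.ne']
    exact v3_eq_sum x

lemma polar_bound {b L : ℝ} (hb : 0 < b) (hL : 4 ≤ L) {f v : V3 → ℝ} {M δ : ℝ} (hM : 0 < M) (hδ : 0 < δ) (hδ1 : δ < 1)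
    (hf : ContinuousOn f (SL b L)) (hfb : ∀ x ∈ SL b L, rx x ^ 2 * |f x| ≤ M * rx x ^ δ)
    (hv : IsCutoffSolution b L f v) {B : ℝ} (hB : ∀ x ∈ wedgeQL b L, |v x| ≤ B) :
    (∀ x ∈ SL b L, lapW (SL b L) v x = f x) ∧
    ∀ x ∈ SL b L, rx x < L → |v x| ≤
      (180 + (4 / δ ^ 2 + 64 * (2 / δ ^ 2 + 4 ^ (4 / δ))) + 2 / δ ^ 2) * M * max 1 (rx x ^ δ) := by
  have hL0 : 0 < L := by linarith
  obtain ⟨hv2, hlap, hn0, hn1, hnr, hper, hlim⟩ := hv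
  set S := SL b L with hS
  have hU : UniqueDiffOn ℝ S := unique_SL b hL0
  have hθ : 0 < arctan b := by rw [← arctan_zero]; exact arctan_strictMono hb
  have hθ2 := arctan_lt_pi_div_two b
  set G : Fin 3 → V3 → ℝ := fun i => pdW S i v with hG
  have hGc : ∀ i, ContDiffOn ℝ (1:ℕ) (G i) S := fun i => pdW_cd hU (n := 2) hv2 le_rfl i
  set H : Fin 3 → Fin 3 → V3 → ℝ := fun i j => pdW S j (G i) with hH
  have hHc : ∀ i j, ContinuousOn (H i j) S := fun i j => (pdW_cd hU (m := 0) (hGc i) le_rfl j).continuousOn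
  have dv : ∀ x ∈ S, HasFDerivWithinAt v (LL fun i => G i x) S x := fun x hx => pdW_fd (n := 2) hv2 (by norm_num) hx
  have dG : ∀ i, ∀ x ∈ S, HasFDerivWithinAt (G i) (LL fun j => H i j x) S x := fun i x hx => pdW_fd (hGc i) le_rfl hx
  have hlap' : ∀ x ∈ S, H 0 0 x + H 1 1 x + H 2 2 x = f x := by
    intro x hx
    have hcl : x ∈ closure (wedgeQL b L) := hx.1
    have c1 : ContinuousWithinAt (fun x => H 0 0 x + H 1 1 x + H 2 2 x) (wedgeQL b L) x :=
      ((((hHc 0 0).add (hHc 1 1)).add (hHc 2 2)) x hx).mono QL_subset_SL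
    have c2 : ContinuousWithinAt f (wedgeQL b L) x := (hf x hx).mono QL_subset_SL
    have e : ∀ y ∈ wedgeQL b L, H 0 0 y + H 1 1 y + H 2 2 y = f y := fun y hy => by
      rw [← hlap y hy, lapW, Fin.sum_univ_three]
    exact le_antisymm (c1.closure_le hcl c2 fun y hy => (e y hy).le) (c2.closure_le hcl c1 fun y hy => (e y hy).ge)
  refine ⟨fun x hx => by rw [← hlap' x hx, lapW, Fin.sum_univ_three], ?_⟩
  have hvb : ∀ x ∈ S, |v x| ≤ B := fun x hx =>
    ContinuousWithinAt.closure_le hx.1 ((hv2.continuousOn x hx).mono QL_subset_SL).abs continuousWithinAt_const hB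
  have mem : ∀ s ≤ Real.log L, ∀ t ∈ Icc (arctan b) (π / 2), ∀ y, cart s t y ∈ S := fun s hs t ht y => cart_mem hb hL0 hs ht
  have ms : ∀ t ∈ Icc (arctan b) (π / 2), ∀ y, MapsTo (fun s => cart s t y) (Iic (Real.log L)) S := fun t ht y s hs => mem s hs t ht y
  have mt : ∀ s ≤ Real.log L, ∀ y, MapsTo (fun t => cart s t y) (Icc (arctan b) (π / 2)) S := fun s hs y t ht => mem s hs t ht y
  have my : ∀ s ≤ Real.log L, ∀ t ∈ Icc (arctan b) (π / 2), MapsTo (fun y => cart s t y) univ S := fun s hs t ht y _ => mem s hs t ht y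
  have hpol : Pol (fun s t y => v (cart s t y))
      (fun s t y => exp s * (cos t * G 0 (cart s t y) + sin t * G 2 (cart s t y)))
      (fun s t y => exp s * (cos t * G 0 (cart s t y) + sin t * G 2 (cart s t y)) +
        exp s * (cos t * (H 0 0 (cart s t y) * (exp s * cos t) + H 0 1 (cart s t y) * 0 + H 0 2 (cart s t y) * (exp s * sin t))
          + sin t * (H 2 0 (cart s t y) * (exp s * cos t) + H 2 1 (cart s t y) * 0 + H 2 2 (cart s t y) * (exp s * sin t))))
      (fun s t y => exp s * (-sin t * G 0 (cart s t y) + cos t * G 2 (cart s t y)))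
      (fun s t y => exp s * ((-cos t * G 0 (cart s t y) + -sin t * (H 0 0 (cart s t y) * (-(exp s * sin t)) + H 0 1 (cart s t y) * 0 + H 0 2 (cart s t y) * (exp s * cos t)))
          + (-sin t * G 2 (cart s t y) + cos t * (H 2 0 (cart s t y) * (-(exp s * sin t)) + H 2 1 (cart s t y) * 0 + H 2 2 (cart s t y) * (exp s * cos t)))))
      (fun s t y => G 1 (cart s t y)) (fun s t y => H 1 1 (cart s t y))
      (arctan b) (π / 2) (Real.log L) (L * cutoffConst b L f) M δ B := by
    have es : ∀ s t, (cart s t 0) 1 = 0 := fun s t => cart1 s t 0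
    have t0 : ∀ s t : ℝ, ((-(exp s * sin t)) • ee 0 + (exp s * cos t) • ee 2 : V3) 0 = -(exp s * sin t) := fun s t => by simp [ee_apply]
    have t1 : ∀ s t : ℝ, ((-(exp s * sin t)) • ee 0 + (exp s * cos t) • ee 2 : V3) 1 = 0 := fun s t => by simp [ee_apply]
    have t2 : ∀ s t : ℝ, ((-(exp s * sin t)) • ee 0 + (exp s * cos t) • ee 2 : V3) 2 = exp s * cos t := fun s t => by simp [ee_apply]
    constructor
    · refine hv2.continuousOn.comp cart_cont.continuousOn ?_
      rintro ⟨s, t, y⟩ ⟨hs, ht, -⟩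
      exact mem s hs t ht y
    · intro s hs t ht y
      have := curve_deriv (c := fun s => cart s t y) (dv _ (mem s hs t ht y)) (cart_ds s t y).hasDerivWithinAt (ms t ht y)
      rw [cart0, cart1, cart2] at this
      exact this.congr_deriv (by ring)
    · intro s hs t ht y
      have h0 := curve_deriv (c := fun s => cart s t y) (dG 0 _ (mem s hs t ht y)) (cart_ds s t y).hasDerivWithinAt (ms t ht y)
      have h2 := curve_deriv (c := fun s => cart s t y) (dG 2 _ (mem s hs t ht y)) (cart_ds s t y).hasDerivWithinAt (ms t ht y)
      rw [cart0, cart1, cart2] at h0 h2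
      exact (Real.hasDerivAt_exp s).hasDerivWithinAt.mul ((h0.const_mul (cos t)).add (h2.const_mul (sin t)))
    · intro s hs t ht y
      have := curve_deriv (c := fun t => cart s t y) (dv _ (mem s hs t ht y)) (cart_dt s t y).hasDerivWithinAt (mt s hs y)
      rw [t0, t1, t2] at this
      exact this.congr_deriv (by ring)
    · intro s hs t ht y
      have h0 := curve_deriv (c := fun t => cart s t y) (dG 0 _ (mem s hs t ht y)) (cart_dt s t y).hasDerivWithinAt (mt s hs y)
      have h2 := curve_deriv (c := fun t => cart s t y) (dG 2 _ (mem s hs t ht y)) (cart_dt s t y).hasDerivWithinAt (mt s hs y)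
      rw [t0, t1, t2] at h0 h2
      exact (((hasDerivAt_sin t).neg.hasDerivWithinAt.mul h0).add ((hasDerivAt_cos t).hasDerivWithinAt.mul h2)).const_mul (exp s)
    · intro s hs t ht y
      have := curve_deriv (c := fun y => cart s t y) (dv _ (mem s hs t ht y)) (cart_dy s t y).hasDerivWithinAt (my s hs t ht)
      exact (hasDerivWithinAt_univ.1 this).congr_deriv (by simp [ee_apply])
    · intro s hs t ht y
      have := curve_deriv (c := fun y => cart s t y) (dG 1 _ (mem s hs t ht y)) (cart_dy s t y).hasDerivWithinAt (my s hs t ht)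
      exact (hasDerivWithinAt_univ.1 this).congr_deriv (by simp [ee_apply])
    · intro s hs t ht y
      have h1 := hfb _ (mem s hs t ht y)
      have h2 := hlap' _ (mem s hs t ht y)
      rw [rx_cart] at h1
      have e1 : exp s ^ δ = exp (δ * s) := by rw [← exp_mul, mul_comm]
      have e2 : exp (2 * s) = exp s ^ 2 := by rw [← exp_nat_mul]; norm_num
      rw [e1] at h1
      refine le_trans (le_of_eq ?_) h1
      rw [← abs_of_nonneg (sq_nonneg (exp s)), ← abs_mul, ← h2, e2]
      congr 1
      linear_combination (exp s ^ 2 * (H 0 0 (cart s t y) + H 2 2 (cart s t y))) * sin_sq_add_cos_sq t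
    · intro t ht y
      have := hnr _ (mem _ le_rfl t ht y) (by rw [rx_cart, exp_log hL0])
      rw [cart0, cart2, exp_log hL0, mul_div_cancel_left₀ _ hL0.ne', mul_div_cancel_left₀ _ hL0.ne'] at this
      beta_reduce
      rw [exp_log hL0, ← this]
    · intro s hs y
      have hr : exp s < L := by rwa [← lt_log_iff_exp_lt hL0]
      have h1 : sin (arctan b) = b * cos (arctan b) := by
        have := ang b (arctan b)
        simp [(cos_arctan_pos b).ne'] at this
        linarith
      have := hn0 _ (mem s hs.le _ ⟨le_rfl, hθ2.le⟩ y) (by rw [cart0, cart2, h1]; ring) (by rwa [rx_cart])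
      beta_reduce
      rw [h1]
      linear_combination (-exp s * cos (arctan b)) * this
    · intro s hs y
      have hr : exp s < L := by rwa [← lt_log_iff_exp_lt hL0]
      have := hn1 _ (mem s hs.le _ ⟨hθ2.le, le_rfl⟩ y) (by rw [cart0]; simp) (by rwa [rx_cart])
      beta_reduce
      change G 0 _ = 0 at this
      rw [this]; simp
    · intro s hs t ht y
      have := hper _ (mem s hs t ht y).1
      beta_reduce
      rw [← this]
      congr 1
      have : (EuclideanSpace.single 1 (2 * π) : V3) = (2 * π) • ee 1 := by
        ext j; fin_cases j <;> simp [ee_apply]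
      rw [this, cart, cart]; module
    · intro s hs t ht y
      exact hvb _ (mem s hs t ht y)
  have hb1 := hpol.bound hM hδ hδ1 hθ2 (by linarith) (Real.log_pos (by linarith)) ⟨π / 2, ⟨hθ2.le, le_rfl⟩, by
    refine hlim.comp ?_
    rw [tendsto_nhdsWithin_iff]
    constructor
    · have : Continuous fun r : ℝ => (r * cos (π / 2)) • ee 0 + (0:ℝ) • ee 1 + (r * sin (π / 2)) • ee 2 := by fun_prop
      have := (this.tendsto 0).comp tendsto_exp_atBot
      simpa [Function.comp_def, cart] using this
    · filter_upwards [Iic_mem_atBot (Real.log L)] with s hs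
      exact mem s hs _ ⟨hθ2.le, le_rfl⟩ 0⟩
  intro x hx hxL
  obtain ⟨t, ht, he⟩ := exists_cart hb hL0 hx
  have hx0 := ((mem_SL hL0).1 hx).2.2
  have := hb1 (Real.log (rx x)) (Real.log_lt_log hx0 hxL) t ht (x 1)
  beta_reduce at this
  rw [← he, mul_comm δ, exp_mul, exp_log hx0] at this
  exact this


lemma iter_succ_dist {F : Type} [NormedAddCommGroup F] [NormedSpace ℝ F] {S : Set V3} (hS : UniqueDiffOn ℝ S) {u : V3 → F} {x y : V3} (hx : x ∈ S) (hy : y ∈ S) (n : ℕ) :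
    ‖iteratedFDerivWithin ℝ (n + 1) u S x - iteratedFDerivWithin ℝ (n + 1) u S y‖ =
      ‖iteratedFDerivWithin ℝ n (fderivWithin ℝ u S) S x - iteratedFDerivWithin ℝ n (fderivWithin ℝ u S) S y‖ := by
  rw [iteratedFDerivWithin_succ_eq_comp_right hS hx, iteratedFDerivWithin_succ_eq_comp_right hS hy,
    Function.comp_apply, Function.comp_apply]
  erw [← LinearIsometryEquiv.map_sub, LinearIsometryEquiv.norm_map]

lemma iter_zero_dist {F : Type} [NormedAddCommGroup F] [NormedSpace ℝ F] {S : Set V3} {u : V3 → F} {x y : V3} :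
    ‖iteratedFDerivWithin ℝ 0 u S x - iteratedFDerivWithin ℝ 0 u S y‖ = ‖u x - u y‖ := by
  rw [iteratedFDerivWithin_zero_eq_comp, Function.comp_apply, Function.comp_apply, ← map_sub, LinearIsometryEquiv.norm_map]

def IB (S : Set V3) (α : ℝ) (n : ℕ) (u : V3 → ℝ) (A : ℝ) : Prop :=
  ContDiffOn ℝ n u S ∧ (∀ j ≤ n, ∀ x ∈ S, ‖iteratedFDerivWithin ℝ j u S x‖ ≤ A) ∧
    ∀ x ∈ S, ∀ y ∈ S, ‖iteratedFDerivWithin ℝ n u S x - iteratedFDerivWithin ℝ n u S y‖ ≤ A * ‖x - y‖ ^ α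

lemma CB_of_IB {S : Set V3} {α : ℝ} (hα0 : 0 < α) (hα1 : α < 1) (hS : UniqueDiffOn ℝ S) (hc : Convex ℝ S) (hd : ∀ x ∈ S, ∀ y ∈ S, ‖x - y‖ ≤ 100) :
    ∀ {n : ℕ} {u : V3 → ℝ} {A : ℝ}, 0 ≤ A → IB S α n u A → CB S α n u (100 * A)
  | 0, u, A, hA, h => by
    refine ⟨fun x hx => ?_, fun x hx y hy => ?_⟩
    · have := h.2.1 0 le_rfl x hx
      rw [norm_iteratedFDerivWithin_zero, Real.norm_eq_abs] at this
      linarith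
    · have := h.2.2 x hx y hy
      rw [iter_zero_dist, Real.norm_eq_abs] at this
      have h0 : 0 ≤ A * ‖x - y‖ ^ α := by positivity
      linarith
  | n + 1, u, A, hA, h => by
    obtain ⟨h1, h2, h3⟩ := h
    have hdiff : ∀ x ∈ S, HasFDerivWithinAt u (fderivWithin ℝ u S x) S x := fun x hx =>
      (h1.differentiableOn (by simp) x hx).hasFDerivWithinAt
    have hfb : ∀ x ∈ S, ‖fderivWithin ℝ u S x‖ ≤ A := fun x hx => by
      have := h2 1 (by omega) x hx
      rw [← norm_iteratedFDerivWithin_fderivWithin hS hx, norm_iteratedFDerivWithin_zero] at this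
      exact this
    refine ⟨⟨fun x hx => ?_, fun x hx y hy => ?_⟩, fun i x => fderivWithin ℝ u S x (ee i), fun x hx => ?_, fun i => ?_⟩
    · have := h2 0 (by omega) x hx
      rw [norm_iteratedFDerivWithin_zero, Real.norm_eq_abs] at this
      linarith
    · have h4 := hc.norm_image_sub_le_of_norm_hasFDerivWithin_le hdiff hfb hy hx
      rw [Real.norm_eq_abs] at h4
      have h5 := hd x hx y hy
      have h6 : ‖x - y‖ ≤ 100 * ‖x - y‖ ^ α := by
        rcases (norm_nonneg (x - y)).lt_or_eq with h7 | h7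
        · calc ‖x - y‖ = ‖x - y‖ ^ (1 - α) * ‖x - y‖ ^ α := by rw [← rpow_add h7]; simp
            _ ≤ 100 * ‖x - y‖ ^ α := by
              gcongr
              calc ‖x - y‖ ^ (1 - α) ≤ 100 ^ (1 - α) := by gcongr
                _ ≤ 100 ^ (1:ℝ) := rpow_le_rpow_of_exponent_le (by norm_num) (by linarith)
                _ = 100 := by simp
        · rw [← h7]; positivity
      calc _ ≤ _ := h4
        _ ≤ A * (100 * ‖x - y‖ ^ α) := by gcongr
        _ = _ := by ring
    · rw [← eq_LL]; exact hdiff x hx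
    · have hg : ContDiffOn ℝ n (fderivWithin ℝ u S) S := h1.fderivWithin hS (by exact_mod_cast le_rfl)
      have e : ∀ j ≤ n, ∀ x ∈ S, iteratedFDerivWithin ℝ j (fun x => fderivWithin ℝ u S x (ee i)) S x =
          (ContinuousLinearMap.apply ℝ ℝ (ee i)).compContinuousMultilinearMap (iteratedFDerivWithin ℝ j (fderivWithin ℝ u S) S x) := fun j hj x hx =>
        (ContinuousLinearMap.apply ℝ ℝ (ee i)).iteratedFDerivWithin_comp_left (hg x hx) hS hx (by exact_mod_cast hj)
      have hn : ‖(ContinuousLinearMap.apply ℝ ℝ (ee i) : (V3 →L[ℝ] ℝ) →L[ℝ] ℝ)‖ ≤ 1 := by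
        refine ContinuousLinearMap.opNorm_le_bound _ zero_le_one fun T => ?_
        have := T.le_opNorm (ee i)
        rw [norm_ee, mul_one] at this
        simpa using this
      refine CB_of_IB hα0 hα1 hS hc hd hA ⟨hg.clm_apply contDiffOn_const, fun j hj x hx => ?_, fun x hx y hy => ?_⟩
      · rw [e j hj x hx]
        refine (ContinuousLinearMap.norm_compContinuousMultilinearMap_le _ _).trans ?_
        have := h2 (j + 1) (by omega) x hx
        rw [← norm_iteratedFDerivWithin_fderivWithin hS hx] at this
        calc _ ≤ 1 * A := by gcongr
          _ = A := one_mul _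
      · rw [e n le_rfl x hx, e n le_rfl y hy]
        have es : (ContinuousLinearMap.apply ℝ ℝ (ee i)).compContinuousMultilinearMap (iteratedFDerivWithin ℝ n (fderivWithin ℝ u S) S x) -
          (ContinuousLinearMap.apply ℝ ℝ (ee i)).compContinuousMultilinearMap (iteratedFDerivWithin ℝ n (fderivWithin ℝ u S) S y) =
          (ContinuousLinearMap.apply ℝ ℝ (ee i)).compContinuousMultilinearMap (iteratedFDerivWithin ℝ n (fderivWithin ℝ u S) S x - iteratedFDerivWithin ℝ n (fderivWithin ℝ u S) S y) := by
          ext m; simp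
        rw [es]
        refine (ContinuousLinearMap.norm_compContinuousMultilinearMap_le _ _).trans ?_
        have := h3 x hx y hy
        rw [iter_succ_dist hS hx hy] at this
        calc _ ≤ 1 * (A * ‖x - y‖ ^ α) := by gcongr
          _ = _ := one_mul _

lemma BH.cont {S : Set V3} {α A : ℝ} (hα0 : 0 < α) {u : V3 → ℝ} (h : BH S α u A) : ContinuousOn u S := by
  intro x hx
  rw [ContinuousWithinAt, tendsto_iff_norm_sub_tendsto_zero]
  have hc : Tendsto (fun y : V3 => A * ‖y - x‖ ^ α) (𝓝[S] x) (𝓝 0) := by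
    have : Continuous (fun y : V3 => A * ‖y - x‖ ^ α) :=
      continuous_const.mul ((continuous_id.sub continuous_const).norm.rpow_const fun _ => Or.inr hα0.le)
    have h2 := this.tendsto x
    simp [zero_rpow hα0.ne'] at h2
    exact h2.mono_left nhdsWithin_le_nhds
  refine squeeze_zero' (Eventually.of_forall fun _ => norm_nonneg _) ?_ hc
  filter_upwards [self_mem_nhdsWithin] with y hy
  exact h.2 y hy x hx

/-- `t ↦ t • proj i` -/
def PP (i : Fin 3) : ℝ →L[ℝ] (V3 →L[ℝ] ℝ) := ContinuousLinearMap.toSpanSingleton ℝ (EuclideanSpace.proj i : V3 →L[ℝ] ℝ)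

lemma PP_norm (i : Fin 3) : ‖PP i‖ ≤ 1 := by
  rw [PP, ContinuousLinearMap.norm_toSpanSingleton]
  exact ContinuousLinearMap.opNorm_le_bound _ zero_le_one fun z => by
    simpa using PiLp.norm_apply_le z i

lemma LL_PP (c : Fin 3 → ℝ) : LL c = PP 0 (c 0) + PP 1 (c 1) + PP 2 (c 2) := by
  simp [LL, PP, Fin.sum_univ_three]

lemma IB_of_CB {S : Set V3} {α : ℝ} (hα0 : 0 < α) (hS : UniqueDiffOn ℝ S) :
    ∀ {n : ℕ} {u : V3 → ℝ} {A : ℝ}, CB S α n u A → ContDiffOn ℝ n u S ∧ ∀ j ≤ n,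
      (∀ x ∈ S, ‖iteratedFDerivWithin ℝ j u S x‖ ≤ 3 ^ j * A) ∧
      ∀ x ∈ S, ∀ y ∈ S, ‖iteratedFDerivWithin ℝ j u S x - iteratedFDerivWithin ℝ j u S y‖ ≤ 3 ^ j * (A * ‖x - y‖ ^ α)
  | 0, u, A, h => by
    refine ⟨by exact_mod_cast contDiffOn_zero.2 (BH.cont hα0 h), fun j hj => ?_⟩
    obtain rfl : j = 0 := by omega
    refine ⟨fun x hx => ?_, fun x hx y hy => ?_⟩
    · rw [norm_iteratedFDerivWithin_zero]; simpa using h.1 x hx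
    · rw [iter_zero_dist]; simpa using h.2 x hx y hy
  | n + 1, u, A, h => by
    obtain ⟨h0, g, hg, hgC⟩ := h
    have ih := fun i => IB_of_CB hα0 hS (hgC i)
    have e : ∀ x ∈ S, fderivWithin ℝ u S x = (PP 0 ∘ g 0 + PP 1 ∘ g 1 + PP 2 ∘ g 2) x := fun x hx => by
      rw [(hg x hx).fderivWithin (hS x hx), LL_PP]; rfl
    have cg : ∀ i, ContDiffOn ℝ n (PP i ∘ g i) S := fun i => (PP i).contDiff.comp_contDiffOn (ih i).1
    have hcd : ContDiffOn ℝ n (fderivWithin ℝ u S) S := (((cg 0).add (cg 1)).add (cg 2)).congr e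
    refine ⟨?_, fun j hj => ?_⟩
    · push_cast
      rw [contDiffOn_succ_iff_fderivWithin hS]
      exact ⟨fun x hx => (hg x hx).differentiableWithinAt, by simp, hcd⟩
    · rcases j with _ | j
      · refine ⟨fun x hx => ?_, fun x hx y hy => ?_⟩
        · rw [norm_iteratedFDerivWithin_zero]; simpa using h0.1 x hx
        · rw [iter_zero_dist]; simpa using h0.2 x hx y hy
      have hj : j ≤ n := by omega
      have it : ∀ x ∈ S, iteratedFDerivWithin ℝ j (fderivWithin ℝ u S) S x =
          (PP 0).compContinuousMultilinearMap (iteratedFDerivWithin ℝ j (g 0) S x) +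
          (PP 1).compContinuousMultilinearMap (iteratedFDerivWithin ℝ j (g 1) S x) +
          (PP 2).compContinuousMultilinearMap (iteratedFDerivWithin ℝ j (g 2) S x) := fun x hx => by
        have hj' : (j : WithTop ℕ∞) ≤ n := by exact_mod_cast hj
        rw [iteratedFDerivWithin_congr e hx,
          iteratedFDerivWithin_add_apply (f := PP 0 ∘ g 0 + PP 1 ∘ g 1) (((cg 0).add (cg 1)).of_le hj' x hx) ((cg 2).of_le hj' x hx) hS hx,
          iteratedFDerivWithin_add_apply ((cg 0).of_le hj' x hx) ((cg 1).of_le hj' x hx) hS hx,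
          (PP 0).iteratedFDerivWithin_comp_left ((ih 0).1 x hx) hS hx hj',
          (PP 1).iteratedFDerivWithin_comp_left ((ih 1).1 x hx) hS hx hj',
          (PP 2).iteratedFDerivWithin_comp_left ((ih 2).1 x hx) hS hx hj']
      have pn : ∀ i, ∀ T : ContinuousMultilinearMap ℝ (fun _ : Fin j => V3) ℝ, ‖(PP i).compContinuousMultilinearMap T‖ ≤ ‖T‖ := fun i T =>
        (ContinuousLinearMap.norm_compContinuousMultilinearMap_le _ _).trans (by
          calc _ ≤ 1 * ‖T‖ := by gcongr; exact PP_norm i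
            _ = _ := one_mul _)
      refine ⟨fun x hx => ?_, fun x hx y hy => ?_⟩
      · rw [← norm_iteratedFDerivWithin_fderivWithin hS hx, it x hx]
        have b : ∀ i, ‖(PP i).compContinuousMultilinearMap (iteratedFDerivWithin ℝ j (g i) S x)‖ ≤ 3 ^ j * A := fun i =>
          (pn i _).trans (((ih i).2 j hj).1 x hx)
        calc _ ≤ _ := norm_add₃_le
          _ ≤ 3 ^ j * A + 3 ^ j * A + 3 ^ j * A := add_le_add (add_le_add (b 0) (b 1)) (b 2)
          _ = _ := by ring
      · rw [iter_succ_dist hS hx hy, it x hx, it y hy]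
        have b : ∀ i, ‖(PP i).compContinuousMultilinearMap (iteratedFDerivWithin ℝ j (g i) S x - iteratedFDerivWithin ℝ j (g i) S y)‖ ≤ 3 ^ j * (A * ‖x - y‖ ^ α) := fun i =>
          (pn i _).trans (((ih i).2 j hj).2 x hx y hy)
        have es : ∀ (X0 X1 X2 Y0 Y1 Y2 : ContinuousMultilinearMap ℝ (fun _ : Fin j => V3) ℝ),
          (PP 0).compContinuousMultilinearMap X0 + (PP 1).compContinuousMultilinearMap X1 + (PP 2).compContinuousMultilinearMap X2 -
          ((PP 0).compContinuousMultilinearMap Y0 + (PP 1).compContinuousMultilinearMap Y1 + (PP 2).compContinuousMultilinearMap Y2) =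
          (PP 0).compContinuousMultilinearMap (X0 - Y0) + (PP 1).compContinuousMultilinearMap (X1 - Y1) + (PP 2).compContinuousMultilinearMap (X2 - Y2) := by
          intro X0 X1 X2 Y0 Y1 Y2; ext1 m
          simp; abel
        rw [es]
        calc _ ≤ _ := norm_add₃_le
          _ ≤ 3 ^ j * (A * ‖x - y‖ ^ α) + 3 ^ j * (A * ‖x - y‖ ^ α) + 3 ^ j * (A * ‖x - y‖ ^ α) := add_le_add (add_le_add (b 0) (b 1)) (b 2)
          _ = _ := by ring


lemma iter_pull {S : Set V3} (hS : UniqueDiffOn ℝ S) (T : V3 ≃L[ℝ] V3) {s : ℝ} (hs : 0 ≤ s) (hT : ∀ z, ‖T z‖ ≤ s * ‖z‖)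
    (f : V3 → ℝ) (i : ℕ) {z : V3} (hz : T z ∈ S) :
    ‖iteratedFDerivWithin ℝ i (f ∘ T) (T ⁻¹' S) z‖ ≤ s ^ i * ‖iteratedFDerivWithin ℝ i f S (T z)‖ := by
  rw [ContinuousLinearEquiv.iteratedFDerivWithin_comp_right T f hS hz]
  refine (ContinuousMultilinearMap.norm_compContinuousLinearMap_le _ _).trans ?_
  rw [mul_comm]
  gcongr
  calc _ ≤ ∏ _j : Fin i, s := by
        refine Finset.prod_le_prod (fun _ _ => norm_nonneg _) fun _ _ => ?_
        exact ContinuousLinearMap.opNorm_le_bound _ hs hT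
    _ = s ^ i := by simp

lemma iter_pull_sub {S : Set V3} (hS : UniqueDiffOn ℝ S) (T : V3 ≃L[ℝ] V3) {s : ℝ} (hs : 0 ≤ s) (hT : ∀ z, ‖T z‖ ≤ s * ‖z‖)
    (f : V3 → ℝ) (i : ℕ) {z z' : V3} (hz : T z ∈ S) (hz' : T z' ∈ S) :
    ‖iteratedFDerivWithin ℝ i (f ∘ T) (T ⁻¹' S) z - iteratedFDerivWithin ℝ i (f ∘ T) (T ⁻¹' S) z'‖
      ≤ s ^ i * ‖iteratedFDerivWithin ℝ i f S (T z) - iteratedFDerivWithin ℝ i f S (T z')‖ := by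
  rw [ContinuousLinearEquiv.iteratedFDerivWithin_comp_right T f hS hz, ContinuousLinearEquiv.iteratedFDerivWithin_comp_right T f hS hz']
  have e : (iteratedFDerivWithin ℝ i f S (T z)).compContinuousLinearMap (fun _ => (T : V3 →L[ℝ] V3)) -
      (iteratedFDerivWithin ℝ i f S (T z')).compContinuousLinearMap (fun _ => (T : V3 →L[ℝ] V3)) =
      (iteratedFDerivWithin ℝ i f S (T z) - iteratedFDerivWithin ℝ i f S (T z')).compContinuousLinearMap (fun _ => (T : V3 →L[ℝ] V3)) := by
    ext; simp
  rw [e]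
  refine (ContinuousMultilinearMap.norm_compContinuousLinearMap_le _ _).trans ?_
  rw [mul_comm]
  gcongr
  calc _ ≤ ∏ _j : Fin i, s := by
        refine Finset.prod_le_prod (fun _ _ => norm_nonneg _) fun _ _ => ?_
        exact ContinuousLinearMap.opNorm_le_bound _ hs hT
    _ = s ^ i := by simp

lemma half_taylor {g g' : ℝ → ℝ} {d δ : ℝ} (hδ : 0 < δ)
    (h1 : ∀ t ∈ Ico (0:ℝ) δ, HasDerivWithinAt g (g' t) (Ici t) t)
    (hc : ContinuousOn g (Ico 0 δ)) (h2 : HasDerivWithinAt g' d (Ici 0) 0) :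
    Tendsto (fun t => (g t - g 0 - g' 0 * t) / t ^ 2) (𝓝[>] 0) (𝓝 (d / 2)) := by
  have := half_second_diff (g := fun t => g t - g' 0 * t) (g' := fun t => g' t - g' 0) (d := d) hδ
    (fun t ht => ((h1 t ht).sub ((hasDerivAt_id' t).const_mul (g' 0)).hasDerivWithinAt).congr_deriv (by ring))
    (hc.sub (by fun_prop)) (by ring) (h2.sub_const _)
  refine this.congr fun t => ?_
  ring

/-- Second-order directional expansion within a convex-like set. -/
lemma dir_second {S : Set V3} (hS : UniqueDiffOn ℝ S) {v : V3 → ℝ} (hv : ContDiffOn ℝ (2:ℕ) v S) {p a : V3} {δ : ℝ} (hδ : 0 < δ)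
    (hm : ∀ t ∈ Ico (0:ℝ) δ, p + t • a ∈ S) :
    Tendsto (fun t : ℝ => (v (p + t • a) - v p - (∑ i, pdW S i v p * a i) * t) / t ^ 2) (𝓝[>] 0)
      (𝓝 ((∑ i, ∑ j, pdW S j (pdW S i v) p * a j * a i) / 2)) := by
  have hcv : ∀ t : ℝ, HasDerivAt (fun t : ℝ => p + t • a) a t := fun t => by
    simpa using ((hasDerivAt_id' t).smul_const a).const_add p
  have key : ∀ (w : V3 → ℝ), ContDiffOn ℝ (1:ℕ) w S → ∀ t ∈ Ico (0:ℝ) δ,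
      HasDerivWithinAt (fun s : ℝ => w (p + s • a)) (∑ i, pdW S i w (p + t • a) * a i) (Ico 0 δ) t := fun w hw t ht => by
    have := curve_deriv (c := fun s : ℝ => p + s • a) (pdW_fd hw le_rfl (hm t ht)) (hcv t).hasDerivWithinAt (fun s hs => hm s hs)
    rw [Fin.sum_univ_three]; exact this
  have up : ∀ (w : V3 → ℝ), ContDiffOn ℝ (1:ℕ) w S → ∀ t ∈ Ico (0:ℝ) δ,
      HasDerivWithinAt (fun s : ℝ => w (p + s • a)) (∑ i, pdW S i w (p + t • a) * a i) (Ici t) t := fun w hw t ht =>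
    (key w hw t ht).mono_of_mem_nhdsWithin (by
      refine mem_nhdsWithin.2 ⟨Iio δ, isOpen_Iio, ht.2, fun s hs => ⟨ht.1.trans hs.2, hs.1⟩⟩)
  have hv1 : ContDiffOn ℝ (1:ℕ) v S := hv.of_le (by norm_num)
  have hp := fun i => pdW_cd hS hv (m := 1) (by norm_num) i
  have h2 : HasDerivWithinAt (fun t : ℝ => ∑ i, pdW S i v (p + t • a) * a i)
      (∑ i, (∑ j, pdW S j (pdW S i v) (p + (0:ℝ) • a) * a j) * a i) (Ici 0) 0 :=
    HasDerivWithinAt.fun_sum fun i _ => (up _ (hp i) 0 ⟨le_rfl, hδ⟩).mul_const _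
  have := half_taylor (g := fun t : ℝ => v (p + t • a)) hδ (up v hv1) (fun t ht => (key v hv1 t ht).continuousWithinAt) h2
  simp only [zero_smul, add_zero] at this
  simp only [Finset.sum_mul] at this ⊢
  exact this


def sg (b : ℝ) (z : V3) : V3 := ((-b * z 0 + z 2) / √(1 + b ^ 2)) • ee 0 + z 1 • ee 1 + ((z 0 + b * z 2) / √(1 + b ^ 2)) • ee 2

lemma sg0 (b : ℝ) (z : V3) : sg b z 0 = (-b * z 0 + z 2) / √(1 + b ^ 2) := by simp [sg, ee_apply]
lemma sg1 (b : ℝ) (z : V3) : sg b z 1 = z 1 := by simp [sg, ee_apply]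
lemma sg2 (b : ℝ) (z : V3) : sg b z 2 = (z 0 + b * z 2) / √(1 + b ^ 2) := by simp [sg, ee_apply]

lemma qpos (b : ℝ) : 0 < √(1 + b ^ 2) := by positivity
lemma qsq (b : ℝ) : √(1 + b ^ 2) ^ 2 = 1 + b ^ 2 := Real.sq_sqrt (by positivity)
lemma qge (b : ℝ) : 1 ≤ √(1 + b ^ 2) := by
  rw [Real.one_le_sqrt]; nlinarith [sq_nonneg b]

lemma v3_ext {x y : V3} (h0 : x 0 = y 0) (h1 : x 1 = y 1) (h2 : x 2 = y 2) : x = y := by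
  ext i; fin_cases i <;> assumption

lemma sg_sg (b : ℝ) (z : V3) : sg b (sg b z) = z := by
  have h := qpos b
  have h2 := qsq b
  refine v3_ext ?_ ?_ ?_
  · rw [sg0, sg0, sg2]; field_simp; rw [h2]; ring
  · rw [sg1, sg1]
  · rw [sg2, sg0, sg2]; field_simp; rw [h2]; ring

def sgL (b : ℝ) : V3 →ₗ[ℝ] V3 where
  toFun := sg b
  map_add' x y := by
    refine v3_ext ?_ ?_ ?_ <;> simp [sg0, sg1, sg2] <;> ring
  map_smul' c x := by
    refine v3_ext ?_ ?_ ?_ <;> simp [sg0, sg1, sg2] <;> ring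

def sgE (b : ℝ) : V3 ≃L[ℝ] V3 := (LinearEquiv.ofInvolutive (sgL b) (sg_sg b)).toContinuousLinearEquiv

lemma sgE_apply (b : ℝ) (z : V3) : sgE b z = sg b z := rfl

lemma norm_v3_sq (z : V3) : ‖z‖ ^ 2 = z 0 ^ 2 + z 1 ^ 2 + z 2 ^ 2 := by
  rw [EuclideanSpace.norm_sq_eq, Fin.sum_univ_three]; simp

lemma sg_sq (b : ℝ) (z : V3) : sg b z 0 ^ 2 + sg b z 2 ^ 2 = z 0 ^ 2 + z 2 ^ 2 := by
  have h := qpos b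
  have h2 := qsq b
  rw [sg0, sg2, div_pow, div_pow, h2]
  have : 0 < 1 + b ^ 2 := by positivity
  field_simp; ring

lemma rx_sg (b : ℝ) (z : V3) : rx (sg b z) = rx z := by
  rw [rx, rx, sg_sq]

lemma norm_sg (b : ℝ) (z : V3) : ‖sg b z‖ = ‖z‖ := by
  rw [← sq_eq_sq₀ (norm_nonneg _) (norm_nonneg _), norm_v3_sq, norm_v3_sq, sg1]
  linarith [sg_sq b z]

lemma sg_CQ_aux {b : ℝ} {z : V3} (h : z ∈ CQ b) : sg b z ∈ CQ b := by
  obtain ⟨h0, h1⟩ := h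
  have h := qpos b
  have h2 := qsq b
  refine ⟨?_, ?_⟩
  · rw [sg0]; apply div_nonneg _ h.le; linarith
  · rw [sg0, sg2, ← mul_div_assoc]
    gcongr
    nlinarith [sq_nonneg b]

lemma sg_CQ {b : ℝ} {z : V3} : sg b z ∈ CQ b ↔ z ∈ CQ b :=
  ⟨fun h => by rw [← sg_sg b z]; exact sg_CQ_aux h, sg_CQ_aux⟩

/-- Chart isometries. -/
structure IsJ (b : ℝ) (J : V3 ≃L[ℝ] V3) : Prop where
  cq : ∀ z, J z ∈ CQ b ↔ z ∈ CQ b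
  rx : ∀ z, rx (J z) = rx z
  norm : ∀ z, ‖J z‖ = ‖z‖
  orth : ∀ i j : Fin 3, ∑ k, J (ee k) i * J (ee k) j = if i = j then 1 else 0
  neu : (∀ w : V3, w 0 = 0 → J w 0 = 0 ∧ J (ee 0) = ee 0) ∨
    (∀ w : V3, w 0 = 0 → J w 2 = b * J w 0 ∧ J (ee 0) 0 = -b / √(1 + b ^ 2) ∧ J (ee 0) 1 = 0 ∧ J (ee 0) 2 = 1 / √(1 + b ^ 2))

lemma isJ_id (b : ℝ) : IsJ b (ContinuousLinearEquiv.refl ℝ V3) := by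
  refine ⟨fun z => Iff.rfl, fun z => rfl, fun z => rfl, fun i j => ?_, Or.inl fun w hw => ⟨hw, rfl⟩⟩
  simp only [ContinuousLinearEquiv.refl_apply, ee_apply, Fin.sum_univ_three]
  fin_cases i <;> fin_cases j <;> simp

lemma isJ_sg (b : ℝ) : IsJ b (sgE b) := by
  have h := qpos b
  have h2 := qsq b
  refine ⟨fun z => sg_CQ, fun z => rx_sg b z, fun z => norm_sg b z, fun i j => ?_, Or.inr fun w hw => ⟨?_, ?_, ?_, ?_⟩⟩
  · simp only [sgE_apply, Fin.sum_univ_three]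
    fin_cases i <;> fin_cases j <;> simp [sg0, sg1, sg2, ee_apply] <;> field_simp <;> (try rw [h2]) <;> ring
  · rw [sgE_apply, sg0, sg2, hw]; ring
  · rw [sgE_apply, sg0]; simp [ee_apply]
  · rw [sgE_apply, sg1]; simp [ee_apply]
  · rw [sgE_apply, sg2]; simp [ee_apply]

lemma exists_J {b : ℝ} {x : V3} (hx : x ∈ CQ b) :
    ∃ J z, IsJ b J ∧ z ∈ CQ b ∧ J z = x ∧ z 0 * √(1 + b ^ 2) ≤ z 2 - b * z 0 := by
  have h := qpos b
  have h2 := qsq b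
  by_cases hc : x 0 * √(1 + b ^ 2) ≤ x 2 - b * x 0
  · exact ⟨_, x, isJ_id b, hx, rfl, hc⟩
  · refine ⟨_, sg b x, isJ_sg b, sg_CQ_aux hx, sg_sg b x, ?_⟩
    rw [sg0, sg2]
    have e : (x 0 + b * x 2) / √(1 + b ^ 2) - b * ((-b * x 0 + x 2) / √(1 + b ^ 2)) = x 0 * √(1 + b ^ 2) := by
      field_simp; rw [h2]; ring
    rw [e, div_mul_cancel₀ _ h.ne']
    push Not at hc
    linarith

def RR (b : ℝ) : ℝ := 100 * (1 + b + √(1 + b ^ 2)) * (1 + b)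

lemma RR_ge {b : ℝ} (hb : 0 < b) : 100 ≤ RR b := by
  have := qge b
  unfold RR
  have : 2 ≤ 1 + b + √(1 + b ^ 2) := by linarith
  nlinarith

structure Chart (b : ℝ) (x : V3) (T : V3 ≃L[ℝ] V3) (s : ℝ) (z₀ : V3) : Prop where
  spos : 0 < s
  sdef : s * RR b = rx x
  base : T z₀ = x
  norm : ∀ z, ‖T z‖ = s * ‖z‖
  nn : 0 ≤ z₀ 0
  cq : ∀ w ∈ cube z₀ 14, (T w ∈ CQ b ↔ 0 ≤ w 0)
  rlo : ∀ w ∈ cube z₀ 14, rx x / 2 ≤ rx (T w)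
  rhi : ∀ w ∈ cube z₀ 14, rx (T w) ≤ 3 / 2 * rx x
  orth : ∀ i j : Fin 3, ∑ k, T (ee k) i * T (ee k) j = if i = j then s ^ 2 else 0
  neu : (∀ w : V3, w 0 = 0 → T w 0 = 0 ∧ T (ee 0) = s • ee 0) ∨
    (∀ w : V3, w 0 = 0 → T w 2 = b * T w 0 ∧ T (ee 0) 0 = -b * (s / √(1 + b ^ 2)) ∧ T (ee 0) 1 = 0 ∧ T (ee 0) 2 = s / √(1 + b ^ 2))

lemma smul_CQ {b s : ℝ} (hs : 0 < s) (z : V3) : s • z ∈ CQ b ↔ z ∈ CQ b := by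
  simp only [CQ, mem_setOf_eq, PiLp.smul_apply, smul_eq_mul]
  rw [mul_nonneg_iff_of_pos_left hs, show b * (s * z 0) = s * (b * z 0) by ring, mul_le_mul_iff_right₀ hs]

lemma exists_chart {b : ℝ} (hb : 0 < b) {x : V3} (hx : x ∈ CQ b) (hr : 0 < rx x) :
    ∃ T z₀, Chart b x T (rx x / RR b) z₀ := by
  have hR := RR_ge hb
  have hRp : 0 < RR b := by linarith
  set s := rx x / RR b with hs
  have sp : 0 < s := by positivity
  have sd : s * RR b = rx x := by rw [hs]; field_simp
  obtain ⟨J, z, hJ, hz, hJz, hc⟩ := exists_J ((smul_CQ (inv_pos.2 sp) x).2 hx)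
  have hq := qge b
  have Ts : ∀ w, (J.trans (ContinuousLinearEquiv.smulLeft (Units.mk0 s sp.ne'))) w = s • J w := fun w => rfl
  have rz : rx z = RR b := by
    rw [← hJ.rx, hJz, rx_smul, abs_of_pos (inv_pos.2 sp), ← sd]; field_simp
  have z0 : 0 ≤ z 0 := hz.1
  have z2 : 0 ≤ z 2 := le_trans (mul_nonneg hb.le z0) hz.2
  have d2 : 100 * (1 + b) ≤ z 2 - b * z 0 := by
    have h1 : rx z ≤ z 0 + z 2 := by
      rw [rx, Real.sqrt_le_left (by positivity)]; nlinarith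
    rw [rz, RR] at h1
    have h2 : z 0 + z 2 ≤ (1 + b + √(1 + b ^ 2)) * (z 2 - b * z 0) := by
      have h3 : z 0 ≤ z 2 - b * z 0 := by nlinarith
      nlinarith
    have := h1.trans h2
    rw [show 100 * (1 + b + √(1 + b ^ 2)) * (1 + b) = (1 + b + √(1 + b ^ 2)) * (100 * (1 + b)) by ring] at this
    exact le_of_mul_le_mul_left this (by positivity)
  have rd : ∀ w ∈ cube z 14, rx (w - z) ≤ 28 := fun w hw => by
    have a0 := hw 0
    have a2 := hw 2
    rw [abs_le] at a0 a2
    rw [rx, Real.sqrt_le_left (by norm_num)]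
    simp only [PiLp.sub_apply]
    nlinarith
  refine ⟨J.trans (ContinuousLinearEquiv.smulLeft (Units.mk0 s sp.ne')), z, sp, sd, ?_, fun w => ?_, z0, fun w hw => ?_, fun w hw => ?_, fun w hw => ?_, fun i j => ?_, ?_⟩
  · rw [Ts, hJz, smul_inv_smul₀ sp.ne']
  · rw [Ts, norm_smul, hJ.norm, Real.norm_of_nonneg sp.le]
  · rw [Ts, smul_CQ sp, hJ.cq]
    refine ⟨fun h => h.1, fun h => ⟨h, ?_⟩⟩
    have a0 := hw 0
    have a2 := hw 2
    rw [abs_le] at a0 a2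
    nlinarith
  · rw [Ts, rx_smul, hJ.rx, abs_of_pos sp, ← sd]
    have h1 := rx_add_le w (z - w)
    rw [add_sub_cancel] at h1
    have h2 := rd w hw
    rw [show w - z = (-1:ℝ) • (z - w) by simp, rx_smul] at h2
    norm_num at h2
    rw [mul_div_assoc]
    gcongr
    linarith
  · rw [Ts, rx_smul, hJ.rx, abs_of_pos sp, ← sd]
    have h1 := rx_add_le z (w - z)
    rw [add_sub_cancel] at h1
    have h2 := rd w hw
    rw [show 3 / 2 * (s * RR b) = s * (3 / 2 * RR b) by ring]
    gcongr
    linarith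
  · have := hJ.orth i j
    simp only [Ts, PiLp.smul_apply, smul_eq_mul]
    calc _ = s ^ 2 * ∑ k, J (ee k) i * J (ee k) j := by rw [Finset.mul_sum]; exact Finset.sum_congr rfl fun _ _ => by ring
      _ = _ := by rw [this]; split_ifs <;> simp
  · rcases hJ.neu with h | h
    · refine Or.inl fun w hw => ?_
      obtain ⟨h1, h2⟩ := h w hw
      rw [Ts, Ts, h2]
      exact ⟨by simp [h1], rfl⟩
    · refine Or.inr fun w hw => ?_
      obtain ⟨h1, h2, h3, h4⟩ := h w hw
      simp only [Ts, PiLp.smul_apply, smul_eq_mul, h1, h2, h3, h4]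
      refine ⟨by ring, by ring, by ring, by ring⟩


lemma Chart.mem {b L : ℝ} {x : V3} {T : V3 ≃L[ℝ] V3} {s : ℝ} {z₀ : V3} (h : Chart b x T s z₀) (hx : 0 < rx x) (hxL : rx x ≤ L / 2)
    {w : V3} (hw : w ∈ cube z₀ 14) (h0 : 0 ≤ w 0) : T w ∈ SL b L ∧ rx (T w) < L := by
  have h1 := h.rlo w hw
  have h2 := h.rhi w hw
  have h3 := (h.cq w hw).2 h0
  have h4 : rx (T w) < L := by linarith
  exact ⟨(mem_SL (by linarith)).2 ⟨h3, h4.le, by linarith⟩, h4⟩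

lemma chart_dir {b L : ℝ} {x : V3} {T : V3 ≃L[ℝ] V3} {s : ℝ} {z₀ : V3} (h : Chart b x T s z₀) (hx : 0 < rx x) (hxL : rx x ≤ L / 2)
    {v : V3 → ℝ} (hv : ContDiffOn ℝ (2:ℕ) v (SL b L)) {w a : V3}
    (hm : ∀ᶠ t in 𝓝[≥] (0:ℝ), w + t • a ∈ hc z₀ 14) :
    Tendsto (fun t : ℝ => (v (T (R3 (w + t • a))) - v (T (R3 w)) - (∑ i, pdW (SL b L) i v (T w) * T a i) * t) / t ^ 2) (𝓝[>] 0)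
      (𝓝 ((∑ i, ∑ j, pdW (SL b L) j (pdW (SL b L) i v) (T w) * T a j * T a i) / 2)) := by
  obtain ⟨δ, hδ, hsub⟩ := mem_nhdsGE_iff_exists_Ico_subset.1 hm
  have hδ : 0 < δ := hδ
  have hL : 0 < L := by linarith
  have hw : w ∈ hc z₀ 14 := by simpa using hsub (show (0:ℝ) ∈ Ico 0 δ from ⟨le_rfl, hδ⟩)
  have := dir_second (unique_SL b hL) hv (p := T w) (a := T a) hδ (fun t ht => by
    have h1 := hsub ht
    have := (h.mem hx hxL (ocube_subset_cube _ _ h1.1) h1.2).1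
    rwa [map_add, map_smul] at this)
  refine this.congr' ?_
  filter_upwards [Ioo_mem_nhdsGT hδ] with t ht
  have h1 := hsub ⟨ht.1.le, ht.2⟩
  rw [R3_of_nonneg h1.2, R3_of_nonneg hw.2, map_add, map_smul]

lemma line_mem {z₀ w : V3} (hw : w ∈ ocube z₀ 14) (h0 : 0 ≤ w 0) (a : V3) (ha : a 0 = 0 ∨ 0 < w 0 ∨ 0 ≤ a 0) :
    ∀ᶠ t in 𝓝[≥] (0:ℝ), w + t • a ∈ hc z₀ 14 := by
  have c : Tendsto (fun t : ℝ => w + t • a) (𝓝[≥] 0) (𝓝 w) := by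
    have : Continuous (fun t : ℝ => w + t • a) := by fun_prop
    have := this.tendsto 0
    simp only [zero_smul, add_zero] at this
    exact this.mono_left nhdsWithin_le_nhds
  have h1 := c.eventually ((isOpen_ocube z₀ 14).mem_nhds hw)
  rcases ha with ha | ha | ha
  · filter_upwards [h1] with t ht
    exact ⟨ht, by simp [ha, h0]⟩
  · filter_upwards [h1, c.eventually ((isOpen_lt continuous_const (by fun_prop) : IsOpen {y : V3 | 0 < y 0}).mem_nhds ha)] with t ht ht2
    exact ⟨ht, le_of_lt ht2⟩
  · filter_upwards [h1, self_mem_nhdsWithin] with t ht ht2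
    refine ⟨ht, ?_⟩
    have : (0:ℝ) ≤ t := ht2
    simp only [PiLp.add_apply, PiLp.smul_apply, smul_eq_mul]
    positivity

lemma R3_rfl3 (w : V3) : R3 (rfl3 0 w) = R3 w := by
  ext i
  by_cases h : i = 0
  · subst h; rw [R3_zero, R3_zero, rfl3_apply_same, abs_neg]
  · rw [R3_ne h, R3_ne h, rfl3_apply_ne h]

lemma chart_good {b L : ℝ} {x : V3} {T : V3 ≃L[ℝ] V3} {s : ℝ} {z₀ : V3} (h : Chart b x T s z₀) (hx : 0 < rx x) (hxL : rx x ≤ L / 2)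
    {f v : V3 → ℝ} (hv : IsCutoffSolution b L f v) (hlap : ∀ x ∈ SL b L, lapW (SL b L) v x = f x) :
    Good (fun w => v (T (R3 w))) (fun w => s ^ 2 * f (T (R3 w))) z₀ 14 := by
  have hv2 : ContDiffOn ℝ (2:ℕ) v (SL b L) := by exact_mod_cast hv.1
  obtain ⟨-, -, hn0, hn1, -, -, -⟩ := hv
  refine ⟨?_, ?_⟩
  · refine hv2.continuousOn.comp (T.continuous.comp continuous_R3).continuousOn fun w hw => ?_
    exact (h.mem hx hxL (R3_mem_cube h.nn hw) (by rw [R3_zero]; positivity)).1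
  have main : ∀ w ∈ ocube z₀ 14, 0 ≤ w 0 → HasLap (fun w => v (T (R3 w))) w (s ^ 2 * f (T (R3 w))) := by
    intro w hw h0
    have hwS := h.mem hx hxL (ocube_subset_cube _ _ hw) h0
    have dir : ∀ k : Fin 3, Tendsto (fun t : ℝ => (v (T (R3 (w + t • ee k))) + v (T (R3 (w - t • ee k))) - 2 * v (T (R3 w))) / t ^ 2) (𝓝[>] 0)
        (𝓝 (∑ i, ∑ j, pdW (SL b L) j (pdW (SL b L) i v) (T w) * T (ee k) j * T (ee k) i)) := by
      intro k
      by_cases hk : k = 0 ∧ w 0 = 0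
      · obtain ⟨rfl, hw0⟩ := hk
        have h1 := chart_dir h hx hxL hv2 (line_mem hw h0 (ee 0) (Or.inr (Or.inr (by simp [ee_apply]))))
        have h2 : (∑ i, pdW (SL b L) i v (T w) * T (ee 0) i) = 0 := by
          rw [Fin.sum_univ_three]
          rcases h.neu with hh | hh
          · obtain ⟨e1, e2⟩ := hh w hw0
            have := hn1 _ hwS.1 e1 hwS.2
            rw [e2, this]; simp [ee_apply]
          · obtain ⟨e1, e2, e3, e4⟩ := hh w hw0
            have := hn0 _ hwS.1 e1 hwS.2
            rw [e2, e3, e4]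
            linear_combination (-s / √(1 + b ^ 2)) * this
        rw [h2] at h1
        have h3 := (h1.const_mul 2)
        rw [mul_div_cancel₀ _ (two_ne_zero)] at h3
        refine h3.congr fun t => ?_
        have e : R3 (w - t • ee 0) = R3 (w + t • ee 0) := by
          rw [← R3_rfl3]
          congr 1
          ext i
          by_cases hi : i = 0
          · subst hi; rw [rfl3_apply_same]; simp [ee_apply, hw0]
          · rw [rfl3_apply_ne hi]; simp [ee_apply, hi]
        rw [e]; ring
      · have hp : (ee k) 0 = 0 ∨ 0 < w 0 := by
          by_cases hk0 : k = 0
          · right; exact lt_of_le_of_ne h0 (fun e => hk ⟨hk0, e.symm⟩)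
          · left; simp [ee_apply, Ne.symm hk0]
        have h1 := chart_dir h hx hxL hv2 (line_mem hw h0 (ee k) (hp.imp id Or.inl))
        have h2 := chart_dir h hx hxL hv2 (line_mem hw h0 (-ee k) (hp.imp (fun e => by simp [e]) Or.inl))
        have h3 := h1.add h2
        simp only [map_neg, PiLp.neg_apply, mul_neg, neg_mul, neg_neg, add_halves, Finset.sum_neg_distrib] at h3
        refine h3.congr fun t => ?_
        rw [smul_neg, ← sub_eq_add_neg]
        ring
    have hs := tendsto_finsetSum (Finset.univ : Finset (Fin 3)) fun k _ => dir k
    have e : ∑ k, (∑ i, ∑ j, pdW (SL b L) j (pdW (SL b L) i v) (T w) * T (ee k) j * T (ee k) i) = s ^ 2 * f (T (R3 w)) := by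
      rw [R3_of_nonneg h0, ← hlap _ hwS.1, lapW]
      rw [Finset.sum_comm]
      rw [Finset.mul_sum]
      refine Finset.sum_congr rfl fun i _ => ?_
      rw [Finset.sum_comm]
      calc _ = ∑ j, pdW (SL b L) j (pdW (SL b L) i v) (T w) * ∑ k, T (ee k) j * T (ee k) i := by
            refine Finset.sum_congr rfl fun j _ => ?_
            rw [Finset.mul_sum]; exact Finset.sum_congr rfl fun _ _ => by ring
        _ = _ := by simp only [h.orth]; simp; ring
    rw [e] at hs
    refine Tendsto.congr (fun t => ?_) hs
    rw [Finset.sum_div]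
  intro w hw
  by_cases h0 : 0 ≤ w 0
  · exact main w hw h0
  · push Not at h0
    have e : rfl3 0 w = R3 w := by
      rw [← R3_rfl3, R3_of_nonneg]; rw [rfl3_apply_same]; linarith
    have hm := R3_mem_hc h.nn hw
    have := main (R3 w) hm.1 hm.2
    rw [← e] at this
    have := HasLap.refl 0 this
    simp only [R3_rfl3] at this
    exact this


def WW (δ r : ℝ) : ℝ := max 1 (r ^ δ)

lemma WW_one (δ r : ℝ) : 1 ≤ WW δ r := le_max_left _ _
lemma WW_rpow (δ r : ℝ) : r ^ δ ≤ WW δ r := le_max_right _ _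
lemma WW_two {δ r ρ : ℝ} (hδ : 0 < δ) (hδ1 : δ < 1) (hr : 0 < r) (hρ0 : 0 ≤ ρ) (hρ : ρ ≤ 2 * r) : WW δ ρ ≤ 2 * WW δ r := by
  have h1 := WW_one δ r
  refine max_le (by linarith) ?_
  calc ρ ^ δ ≤ (2 * r) ^ δ := by gcongr
    _ = 2 ^ δ * r ^ δ := Real.mul_rpow (by norm_num) hr.le
    _ ≤ 2 ^ (1:ℝ) * r ^ δ := by gcongr; norm_num
    _ ≤ 2 * WW δ r := by rw [Real.rpow_one]; gcongr; exact WW_rpow _ _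

lemma f_sup_D1 {b L : ℝ} {α δ δ₀ M : ℝ} (hδ0 : 0 < δ) (hδ1 : δ < 1) (hδ₀1 : δ₀ < 1) (hM : 0 ≤ M) {f : V3 → ℝ}
    (h : wnormLE (SQ b) 4 α (1 - δ) (2 - δ₀) (wedgeQL b L) f M) {j : ℕ} (hj : j ≤ 4) {x : V3} (hx : x ∈ D1 b L) (hr : 0 < rx x) :
    rx x ^ (2 + j) * ‖iteratedFDerivWithin ℝ j f (SQ b) x‖ ≤ M * rx x ^ δ₀ := by
  obtain ⟨⟨h1, h2⟩, -⟩ := h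
  rcases lt_or_gt_of_ne hx.2 with hlt | hgt
  · have := h1 j hj x hx.1 hr hlt
    rw [max_eq_left (by have : (0:ℝ) ≤ j := by positivity
                        linarith)] at this
    calc _ = rx x ^ (1 + δ) * (rx x ^ (1 - δ + j) * ‖iteratedFDerivWithin ℝ j f (SQ b) x‖) := by
          rw [← mul_assoc, ← Real.rpow_add hr, ← Real.rpow_natCast]
          congr 2; push_cast; ring
      _ ≤ rx x ^ δ₀ * M := by
          refine mul_le_mul ?_ this (by positivity) (by positivity)
          exact Real.rpow_le_rpow_of_exponent_ge hr hlt.le (by linarith)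
      _ = _ := mul_comm _ _
  · have := h2 j hj x hx.1 hgt
    calc _ = rx x ^ δ₀ * (rx x ^ (2 - δ₀ + j) * ‖iteratedFDerivWithin ℝ j f (SQ b) x‖) := by
          rw [← mul_assoc, ← Real.rpow_add hr, ← Real.rpow_natCast]
          congr 2; push_cast; ring
      _ ≤ rx x ^ δ₀ * M := by gcongr
      _ = _ := mul_comm _ _

lemma f_hol_D1 {b L : ℝ} {α δ δ₀ M : ℝ} (hα0 : 0 < α) (hδ0 : 0 < δ) (hδ1 : δ < 1) (hδ₀1 : δ₀ < 1) (hM : 0 ≤ M) {f : V3 → ℝ}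
    (h : wnormLE (SQ b) 4 α (1 - δ) (2 - δ₀) (wedgeQL b L) f M) {x y : V3} (hx : x ∈ D1 b L) (hy : y ∈ D1 b L) (hrx : 0 < rx x) (hry : 0 < rx y) :
    min (rx x) (rx y) ^ (6 + α) * ‖iteratedFDerivWithin ℝ 4 f (SQ b) x - iteratedFDerivWithin ℝ 4 f (SQ b) y‖
      ≤ M * min (rx x) (rx y) ^ δ₀ * ‖x - y‖ ^ α := by
  obtain ⟨-, h1, h2⟩ := h
  have hne : min (rx x) (rx y) ≠ 1 := by
    rcases min_choice (rx x) (rx y) with e | e <;> rw [e]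
    · exact hx.2
    · exact hy.2
  have hr : 0 < min (rx x) (rx y) := lt_min hrx hry
  rcases lt_or_gt_of_ne hne with hlt | hgt
  · have := h1 x hx.1 y hy.1 hr hlt
    rw [max_eq_left (by push_cast; linarith)] at this
    set m := min (rx x) (rx y)
    calc _ = m ^ (1 + δ) * (m ^ (1 - δ + (4:ℕ) + α) * ‖iteratedFDerivWithin ℝ 4 f (SQ b) x - iteratedFDerivWithin ℝ 4 f (SQ b) y‖) := by
          rw [← mul_assoc, ← Real.rpow_add hr]
          congr 2; push_cast; ring
      _ ≤ m ^ δ₀ * (M * ‖x - y‖ ^ α) := by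
          refine mul_le_mul ?_ this (by positivity) (by positivity)
          exact Real.rpow_le_rpow_of_exponent_ge hr hlt.le (by linarith)
      _ = _ := by ring
  · have := h2 x hx.1 y hy.1 hgt
    set m := min (rx x) (rx y)
    calc _ = m ^ δ₀ * (m ^ (2 - δ₀ + (4:ℕ) + α) * ‖iteratedFDerivWithin ℝ 4 f (SQ b) x - iteratedFDerivWithin ℝ 4 f (SQ b) y‖) := by
          rw [← mul_assoc, ← Real.rpow_add hr]
          congr 2; push_cast; ring
      _ ≤ m ^ δ₀ * (M * ‖x - y‖ ^ α) := by gcongr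
      _ = _ := by ring

lemma SL_closure_D1 {b L : ℝ} (hL : 0 < L) {x : V3} (hx : x ∈ SL b L) : x ∈ closure (D1 b L) := D1_dense hx.1

lemma f_sup {b L : ℝ} (hL : 0 < L) {α δ δ₀ M : ℝ} (hδ0 : 0 < δ) (hδ1 : δ < 1) (hδ₀0 : 0 < δ₀) (hδ₀1 : δ₀ < 1) (hM : 0 ≤ M) {f : V3 → ℝ}
    (hf : ContDiffOn ℝ (4:ℕ) f (SQ b))
    (h : wnormLE (SQ b) 4 α (1 - δ) (2 - δ₀) (wedgeQL b L) f M) {j : ℕ} (hj : j ≤ 4) {x : V3} (hx : x ∈ SL b L) :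
    rx x ^ (2 + j) * ‖iteratedFDerivWithin ℝ j f (SQ b) x‖ ≤ M * rx x ^ δ₀ := by
  have hsub : D1 b L ⊆ SQ b := fun y hy => SL_subset_SQ (D1_subset_SL hy)
  have hxQ : x ∈ SQ b := SL_subset_SQ hx
  refine ContinuousWithinAt.closure_le (s := D1 b L) (SL_closure_D1 hL hx) (f := fun y => rx y ^ (2 + j) * ‖iteratedFDerivWithin ℝ j f (SQ b) y‖) (g := fun y => M * rx y ^ δ₀) ?_ ?_ ?_
  · have := (hf.continuousOn_iteratedFDerivWithin (m := j) (by exact_mod_cast hj) (unique_SQ b) x hxQ).mono hsub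
    exact (continuous_rx.continuousWithinAt.pow _).mul this.norm
  · exact (continuous_rx.continuousWithinAt.rpow_const (Or.inr hδ₀0.le)).const_mul M
  · intro y hy
    exact f_sup_D1 hδ0 hδ1 hδ₀1 hM h hj hy ((mem_SL hL).1 (D1_subset_SL hy)).2.2

lemma f_hol {b L : ℝ} (hL : 0 < L) {α δ δ₀ M : ℝ} (hα0 : 0 < α) (hδ0 : 0 < δ) (hδ1 : δ < 1) (hδ₀0 : 0 < δ₀) (hδ₀1 : δ₀ < 1) (hM : 0 ≤ M) {f : V3 → ℝ}
    (hf : ContDiffOn ℝ (4:ℕ) f (SQ b))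
    (h : wnormLE (SQ b) 4 α (1 - δ) (2 - δ₀) (wedgeQL b L) f M) {x y : V3} (hx : x ∈ SL b L) (hy : y ∈ SL b L) :
    min (rx x) (rx y) ^ (6 + α) * ‖iteratedFDerivWithin ℝ 4 f (SQ b) x - iteratedFDerivWithin ℝ 4 f (SQ b) y‖
      ≤ M * min (rx x) (rx y) ^ δ₀ * ‖x - y‖ ^ α := by
  have hsub : D1 b L ⊆ SQ b := fun y hy => SL_subset_SQ (D1_subset_SL hy)
  have hc := hf.continuousOn_iteratedFDerivWithin (m := 4) le_rfl (unique_SQ b)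
  have hp : (x, y) ∈ closure (D1 b L ×ˢ D1 b L) := by
    rw [closure_prod_eq]; exact ⟨SL_closure_D1 hL hx, SL_closure_D1 hL hy⟩
  have c1 : Continuous fun p : V3 × V3 => min (rx p.1) (rx p.2) :=
    (continuous_rx.comp continuous_fst).min (continuous_rx.comp continuous_snd)
  refine ContinuousWithinAt.closure_le (s := D1 b L ×ˢ D1 b L) hp
    (f := fun p => min (rx p.1) (rx p.2) ^ (6 + α) * ‖iteratedFDerivWithin ℝ 4 f (SQ b) p.1 - iteratedFDerivWithin ℝ 4 f (SQ b) p.2‖)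
    (g := fun p => M * min (rx p.1) (rx p.2) ^ δ₀ * ‖p.1 - p.2‖ ^ α) ?_ ?_ ?_
  · refine (c1.continuousWithinAt.rpow_const (Or.inr (by linarith))).mul ?_
    refine ContinuousWithinAt.norm (ContinuousWithinAt.sub ?_ ?_)
    · exact ((hc x (SL_subset_SQ hx)).mono hsub).comp (f := Prod.fst) (s := D1 b L ×ˢ D1 b L) (x := (x, y)) continuous_fst.continuousWithinAt (fun p hp => hp.1)
    · exact ((hc y (SL_subset_SQ hy)).mono hsub).comp (f := Prod.snd) (s := D1 b L ×ˢ D1 b L) (x := (x, y)) continuous_snd.continuousWithinAt (fun p hp => hp.2)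
  · refine ((c1.continuousWithinAt.rpow_const (Or.inr hδ₀0.le)).const_mul M).mul ?_
    exact ContinuousWithinAt.rpow_const (by fun_prop) (Or.inr hα0.le)
  · intro p hp
    exact f_hol_D1 hα0 hδ0 hδ1 hδ₀1 hM h hp.1 hp.2 ((mem_SL hL).1 (D1_subset_SL hp.1)).2.2 ((mem_SL hL).1 (D1_subset_SL hp.2)).2.2

lemma v_bdd {b L : ℝ} (hL : 0 < L) {δ δ₀ M : ℝ} (hδ0 : 0 < δ) (hδ₀0 : 0 < δ₀) {v : V3 → ℝ} (hv : ContinuousOn v (SL b L))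
    (h : wsupLE (SL b L) 0 (-1 - δ) (-δ₀) (wedgeQL b L) v M) : ∃ B, ∀ x ∈ wedgeQL b L, |v x| ≤ B := by
  refine ⟨|M| * (1 + L ^ δ₀), ?_⟩
  have main : ∀ x ∈ D1 b L, |v x| ≤ |M| * (1 + L ^ δ₀) := by
    intro x hx
    have hr : 0 < rx x := ((mem_SL hL).1 (D1_subset_SL hx)).2.2
    have hrL : rx x ≤ L := ((mem_SL hL).1 (D1_subset_SL hx)).2.1
    have hLp : 0 < L ^ δ₀ := by positivity
    have hM := le_abs_self M
    have hM0 := abs_nonneg M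
    rcases lt_or_gt_of_ne hx.2 with hlt | hgt
    · have := h.1 0 le_rfl x hx.1 hr hlt
      rw [max_eq_right (by push_cast; linarith), Real.rpow_zero, one_mul, norm_iteratedFDerivWithin_zero, Real.norm_eq_abs] at this
      nlinarith
    · have := h.2 0 le_rfl x hx.1 hgt
      rw [norm_iteratedFDerivWithin_zero, Real.norm_eq_abs] at this
      push_cast at this
      rw [add_zero, Real.rpow_neg hr.le, inv_mul_le_iff₀ (by positivity)] at this
      calc _ ≤ _ := this
        _ ≤ rx x ^ δ₀ * |M| := by gcongr
        _ ≤ L ^ δ₀ * |M| := by gcongr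
        _ ≤ _ := by nlinarith
  intro x hx
  have hxS := QL_subset_SL hx
  refine ContinuousWithinAt.closure_le (s := D1 b L) (SL_closure_D1 hL hxS) (f := fun y => |v y|) (g := fun _ => |M| * (1 + L ^ δ₀)) ?_ continuousWithinAt_const main
  exact ((hv x hxS).mono (fun y hy => D1_subset_SL hy)).abs


lemma Chart.hc_eq {b : ℝ} {x : V3} {T : V3 ≃L[ℝ] V3} {s : ℝ} {z₀ : V3} (h : Chart b x T s z₀) (hx : 0 < rx x) :
    hc z₀ 14 = (T ⁻¹' SQ b) ∩ ocube z₀ 14 := by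
  ext w
  constructor
  · intro hw
    refine ⟨mem_SQ.2 ⟨(h.cq w (ocube_subset_cube _ _ hw.1)).2 hw.2, ?_⟩, hw.1⟩
    have := h.rlo w (ocube_subset_cube _ _ hw.1)
    linarith
  · intro hw
    exact ⟨hw.2, (h.cq w (ocube_subset_cube _ _ hw.2)).1 (mem_SQ.1 hw.1).1⟩

lemma chart_F {b L : ℝ} {x : V3} {T : V3 ≃L[ℝ] V3} {s : ℝ} {z₀ : V3} (hb : 0 < b) (h : Chart b x T s z₀) (hx : 0 < rx x) (hxL : rx x ≤ L / 2)
    {α δ δ₀ M : ℝ} (hα0 : 0 < α) (hα1 : α < 1) (hδ0 : 0 < δ) (hδ1 : δ < 1) (hδ₀0 : 0 < δ₀) (hδ₀1 : δ₀ < 1) (hM : 0 ≤ M) {f : V3 → ℝ}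
    (hf : ContDiffOn ℝ (4:ℕ) f (SQ b)) (hn : wnormLE (SQ b) 4 α (1 - δ) (2 - δ₀) (wedgeQL b L) f M) :
    CB (hc z₀ 14) α 4 (fun w => s ^ 2 * f (T (R3 w))) (100 * (M * (2 * WW δ₀ (rx x)))) := by
  have hL : 0 < L := by linarith
  have hs := h.spos
  have hsr : s ≤ rx x / 2 := by
    have := h.sdef
    have h2 := RR_ge hb
    nlinarith
  have huc := hc_unique h.nn (by norm_num : (0:ℝ) < 14)
  have hS := unique_SQ b
  have hW := WW_one δ₀ (rx x)
  have key : ∀ w ∈ hc z₀ 14, T w ∈ SQ b ∧ T w ∈ SL b L ∧ s ≤ rx (T w) ∧ WW δ₀ (rx (T w)) ≤ 2 * WW δ₀ (rx x) := by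
    intro w hw
    have hwc := ocube_subset_cube _ _ hw.1
    have h1 := (h.mem hx hxL hwc hw.2).1
    have h2 := h.rlo w hwc
    have h3 := h.rhi w hwc
    exact ⟨SL_subset_SQ h1, h1, by linarith, WW_two hδ₀0 hδ₀1 hx (by linarith) (by linarith)⟩
  have cdT : ContDiffOn ℝ (4:ℕ) (f ∘ T) (T ⁻¹' SQ b) := hf.comp_continuousLinearMap (T : V3 →L[ℝ] V3)
  have cd : ContDiffOn ℝ (4:ℕ) (f ∘ T) (hc z₀ 14) := cdT.mono (by rw [h.hc_eq hx]; exact inter_subset_left)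
  have itT : ∀ j : ℕ, ∀ w ∈ hc z₀ 14, iteratedFDerivWithin ℝ j (f ∘ T) (hc z₀ 14) w = iteratedFDerivWithin ℝ j (f ∘ T) (T ⁻¹' SQ b) w := by
    intro j w hw
    rw [h.hc_eq hx]
    exact iteratedFDerivWithin_inter_open (isOpen_ocube _ _) hw.1
  have its : ∀ j : ℕ, j ≤ 4 → ∀ w ∈ hc z₀ 14, iteratedFDerivWithin ℝ j (s ^ 2 • (f ∘ T)) (hc z₀ 14) w = s ^ 2 • iteratedFDerivWithin ℝ j (f ∘ T) (T ⁻¹' SQ b) w := by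
    intro j hj w hw
    rw [iteratedFDerivWithin_const_smul_apply ((cd w hw).of_le (by exact_mod_cast hj)) huc hw, itT j w hw]
  have hIB : IB (hc z₀ 14) α 4 (s ^ 2 • (f ∘ T)) (M * (2 * WW δ₀ (rx x))) := by
    refine ⟨(cd.const_smul (s ^ 2) : ContDiffOn ℝ (4:ℕ) (fun y => s ^ 2 • (f ∘ T) y) (hc z₀ 14)), fun j hj w hw => ?_, fun w hw w' hw' => ?_⟩
    · obtain ⟨k1, k2, k3, k4⟩ := key w hw
      rw [its j hj w hw, norm_smul, Real.norm_of_nonneg (by positivity)]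
      have h1 := iter_pull hS T hs.le (fun z => (h.norm z).le) f j k1
      have h2 := f_sup hL hδ0 hδ1 hδ₀0 hδ₀1 hM hf hn hj k2
      calc _ ≤ s ^ 2 * (s ^ j * ‖iteratedFDerivWithin ℝ j f (SQ b) (T w)‖) := by gcongr
        _ = s ^ (2 + j) * ‖iteratedFDerivWithin ℝ j f (SQ b) (T w)‖ := by ring
        _ ≤ rx (T w) ^ (2 + j) * ‖iteratedFDerivWithin ℝ j f (SQ b) (T w)‖ := by gcongr
        _ ≤ M * rx (T w) ^ δ₀ := h2
        _ ≤ M * (2 * WW δ₀ (rx x)) := by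
            gcongr; exact (WW_rpow _ _).trans k4
    · obtain ⟨k1, k2, k3, k4⟩ := key w hw
      obtain ⟨k1', k2', k3', k4'⟩ := key w' hw'
      rw [its 4 le_rfl w hw, its 4 le_rfl w' hw', ← smul_sub, norm_smul, Real.norm_of_nonneg (by positivity)]
      have h1 := iter_pull_sub hS T hs.le (fun z => (h.norm z).le) f 4 k1 k1'
      have h2 := f_hol hL hα0 hδ0 hδ1 hδ₀0 hδ₀1 hM hf hn k2 k2'
      have e : ‖T w - T w'‖ = s * ‖w - w'‖ := by rw [← map_sub, h.norm]
      rw [e, Real.mul_rpow hs.le (norm_nonneg _)] at h2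
      have hm : s ≤ min (rx (T w)) (rx (T w')) := le_min k3 k3'
      have hmW : min (rx (T w)) (rx (T w')) ^ δ₀ ≤ 2 * WW δ₀ (rx x) := by
        rcases min_choice (rx (T w)) (rx (T w')) with e | e <;> rw [e]
        · exact (WW_rpow _ _).trans k4
        · exact (WW_rpow _ _).trans k4'
      set m := min (rx (T w)) (rx (T w'))
      set N := ‖iteratedFDerivWithin ℝ 4 f (SQ b) (T w) - iteratedFDerivWithin ℝ 4 f (SQ b) (T w')‖
      have hsα : 0 < s ^ α := by positivity
      have h3 : s ^ α * (s ^ 6 * N) ≤ s ^ α * (M * (2 * WW δ₀ (rx x)) * ‖w - w'‖ ^ α) := by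
        calc s ^ α * (s ^ 6 * N) = s ^ (6 + α) * N := by
              rw [Real.rpow_add hs, show (6:ℝ) = ((6:ℕ):ℝ) by norm_num, Real.rpow_natCast]; ring
          _ ≤ m ^ (6 + α) * N := by gcongr
          _ ≤ _ := h2
          _ = s ^ α * (M * m ^ δ₀ * ‖w - w'‖ ^ α) := by ring
          _ ≤ _ := by gcongr
      calc _ ≤ s ^ 2 * (s ^ 4 * N) := by gcongr
        _ = s ^ 6 * N := by ring
        _ ≤ _ := le_of_mul_le_mul_left h3 hsα
  have := CB_of_IB hα0 hα1 huc (hc_convex _ _) (fun y hy z hz => ?_) (by positivity) hIB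
  · refine this.congr fun w hw => ?_
    rw [R3_of_nonneg hw.2]; rfl
  · have h1 := norm_le_of_mem_cube (ocube_subset_cube _ _ hy.1)
    have h2 := norm_le_of_mem_cube (ocube_subset_cube _ _ hz.1)
    have h3 : y - z = (y - z₀) - (z - z₀) := by abel
    rw [h3]
    have := norm_sub_le (y - z₀) (z - z₀)
    linarith


def KP (δ : ℝ) : ℝ := 180 + (4 / δ ^ 2 + 64 * (2 / δ ^ 2 + 4 ^ (4 / δ))) + 2 / δ ^ 2

lemma KP_pos {δ : ℝ} (hδ : 0 < δ) : 0 < KP δ := by unfold KP; positivity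

lemma local_est {b α δ δ₀ : ℝ} (hb : 0 < b) (hα0 : 0 < α) (hα1 : α < 1)
    (hδ0 : 0 < δ) (hδ1 : δ < 1) (hδ₀0 : 0 < δ₀) (hδ₀1 : δ₀ < 1) :
    ∃ K : ℝ, 0 < K ∧ ∀ L : ℝ, 4 ≤ L → ∀ f v : V3 → ℝ, ∀ M : ℝ, 0 < M →
      ContDiffOn ℝ (4:ℕ) f (SQ b) → wnormLE (SQ b) 4 α (1 - δ) (2 - δ₀) (wedgeQL b L) f M →
      IsCutoffSolution b L f v → (∃ B, ∀ x ∈ wedgeQL b L, |v x| ≤ B) →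
      ∀ x ∈ SL b L, rx x ≤ L / 2 → ContDiffWithinAt ℝ (6:ℕ) v (SL b L) x ∧
        (∀ j : ℕ, j ≤ 6 → rx x ^ j * ‖iteratedFDerivWithin ℝ j v (SL b L) x‖ ≤ K * M * WW δ₀ (rx x)) ∧
        ∀ y ∈ SL b L, ‖x - y‖ < rx x / RR b → rx x ^ (6 + α) * ‖iteratedFDerivWithin ℝ 6 v (SL b L) x - iteratedFDerivWithin ℝ 6 v (SL b L) y‖
          ≤ K * M * WW δ₀ (rx x) * ‖x - y‖ ^ α := by
  obtain ⟨C, hC, hsch⟩ := schauder hα0 hα1 4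
  have hR := RR_ge hb
  have hKP := KP_pos hδ₀0
  refine ⟨RR b ^ 7 * (3 ^ 6 * (C * (200 + 2 * KP δ₀))), by positivity, ?_⟩
  intro L hL f v M hM hf hn hv ⟨B, hB⟩ x hxS hxL
  have hL0 : 0 < L := by linarith
  obtain ⟨hxC, -, hx⟩ := (mem_SL hL0).1 hxS
  obtain ⟨hlap, hvb⟩ := polar_bound hb hL hM hδ₀0 hδ₀1 (hf.continuousOn.mono SL_subset_SQ) (fun y hy => by
    have := f_sup hL0 hδ0 hδ1 hδ₀0 hδ₀1 hM.le hf hn (Nat.zero_le 4) hy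
    rwa [norm_iteratedFDerivWithin_zero, Real.norm_eq_abs, add_zero] at this) hv hB
  obtain ⟨T, z₀, hT⟩ := exists_chart hb hxC hx
  set s := rx x / RR b with hs
  have sp := hT.spos
  have hW := WW_one δ₀ (rx x)
  have hW0 : 0 < WW δ₀ (rx x) := by linarith
  set A := (200 + 2 * KP δ₀) * M * WW δ₀ (rx x) with hA
  have hA0 : 0 < A := by positivity
  have hCB := hsch (fun w => v (T (R3 w))) (fun w => s ^ 2 * f (T (R3 w))) z₀ A hT.nn hA0
    (fun y => by rw [R3_R3]) (fun y => by rw [R3_R3])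
  rw [show 2 + 3 * ((4:ℕ):ℝ) = 14 by norm_num] at hCB
  have hCB := hCB (chart_good hT hx hxL hv hlap) (fun z hz => ?_) ((chart_F hb hT hx hxL hα0 hα1 hδ0 hδ1 hδ₀0 hδ₀1 hM.le hf hn).mono subset_rfl ?_)
  rotate_left
  · have hzc := R3_mem_cube hT.nn hz
    have h1 := hT.mem hx hxL hzc (by rw [R3_zero]; positivity)
    have h2 := hvb _ h1.1 h1.2
    have h3 : WW δ₀ (rx (T (R3 z))) ≤ 2 * WW δ₀ (rx x) := WW_two hδ₀0 hδ₀1 hx (rx_nonneg _) (by linarith [hT.rhi _ hzc])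
    calc _ ≤ KP δ₀ * M * WW δ₀ (rx (T (R3 z))) := h2
      _ ≤ KP δ₀ * M * (2 * WW δ₀ (rx x)) := by gcongr
      _ ≤ A := by rw [hA]; nlinarith [mul_pos hM hW0]
  · rw [hA]; nlinarith [mul_pos (mul_pos hKP hM) hW0]
  have hu1 := hc_unique hT.nn (by norm_num : (0:ℝ) < 1)
  obtain ⟨cdU, hU⟩ := IB_of_CB hα0 hu1 hCB
  have h11 : hc z₀ 1 ⊆ hc z₀ 14 := hc_mono (by norm_num)
  have pre : SL b L ∩ (T.symm ⁻¹' ocube z₀ 1) = T.symm ⁻¹' hc z₀ 1 := by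
    ext y
    constructor
    · rintro ⟨h1, h2⟩
      have h2 : T.symm y ∈ ocube z₀ 1 := h2
      refine ⟨h2, ?_⟩
      rw [← hT.cq _ (ocube_subset_cube _ _ (ocube_mono (by norm_num) h2)), T.apply_symm_apply]
      exact ((mem_SL hL0).1 h1).1
    · intro h1
      have h1 : T.symm y ∈ hc z₀ 1 := h1
      have := (hT.mem hx hxL (ocube_subset_cube _ _ (h11 h1).1) h1.2).1
      rw [T.apply_symm_apply] at this
      exact ⟨this, h1.1⟩
  have hO : IsOpen (T.symm ⁻¹' ocube z₀ 1) := (isOpen_ocube _ _).preimage T.symm.continuous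
  have hTs : ∀ z, ‖T.symm z‖ = s⁻¹ * ‖z‖ := fun z => by
    have := hT.norm (T.symm z)
    rw [T.apply_symm_apply] at this
    rw [this]; field_simp
  have near : ∀ y ∈ SL b L, ‖x - y‖ < s → T.symm y ∈ hc z₀ 1 := by
    intro y hy hd
    have : y ∈ T.symm ⁻¹' hc z₀ 1 := by
      rw [← pre]
      refine ⟨hy, fun i => ?_⟩
      have h1 := abs_apply_le_norm (T.symm y - z₀) i
      have h2 : T.symm y - z₀ = T.symm (y - x) := by
        rw [map_sub, ← hT.base, T.symm_apply_apply]
      rw [PiLp.sub_apply, h2, hTs, norm_sub_rev] at h1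
      refine h1.trans_lt ?_
      rw [inv_mul_lt_iff₀ sp]; linarith
    exact this
  have veq : EqOn v ((fun w => v (T (R3 w))) ∘ T.symm) (T.symm ⁻¹' hc z₀ 1) := by
    intro y hy
    have hy : T.symm y ∈ hc z₀ 1 := hy
    simp only [Function.comp_apply]
    rw [R3_of_nonneg hy.2, T.apply_symm_apply]
  have ite : ∀ j : ℕ, ∀ y, T.symm y ∈ hc z₀ 1 → iteratedFDerivWithin ℝ j v (SL b L) y =
      iteratedFDerivWithin ℝ j ((fun w => v (T (R3 w))) ∘ T.symm) (T.symm ⁻¹' hc z₀ 1) y := by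
    intro j y hy
    have hy' : y ∈ T.symm ⁻¹' hc z₀ 1 := hy
    have hy2 := hy'
    rw [← pre] at hy2
    rw [← iteratedFDerivWithin_inter_open hO hy2.2, pre]
    exact iteratedFDerivWithin_congr veq hy' j
  have hx1 : T.symm x ∈ hc z₀ 1 := near x hxS (by simpa using sp)
  have hsr : rx x * s⁻¹ = RR b := by rw [← hT.sdef]; field_simp
  have hRp : 1 ≤ RR b := by linarith
  have si : 0 ≤ s⁻¹ := by positivity
  have fin : RR b ^ 7 * (3 ^ 6 * (C * (200 + 2 * KP δ₀))) * M * WW δ₀ (rx x) = RR b ^ 7 * (3 ^ 6 * (C * A)) := by rw [hA]; ring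
  refine ⟨?_, fun j hj => ?_, fun y hy hd => ?_⟩
  · have c1 : ContDiffOn ℝ (6:ℕ) ((fun w => v (T (R3 w))) ∘ T.symm) (T.symm ⁻¹' hc z₀ 1) :=
      cdU.comp_continuousLinearMap (T.symm : V3 →L[ℝ] V3)
    have c2 := (c1.congr veq) x hx1
    rw [← pre] at c2
    exact (contDiffWithinAt_inter (hO.mem_nhds hx1.1)).1 c2
  · rw [ite j x hx1, fin]
    have h1 := iter_pull hu1 T.symm si (fun z => (hTs z).le) (fun w => v (T (R3 w))) j hx1
    have h2 := (hU j hj).1 _ hx1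
    calc _ ≤ rx x ^ j * (s⁻¹ ^ j * (3 ^ j * (C * A))) := by gcongr; exact h1.trans (by gcongr)
      _ = RR b ^ j * (3 ^ j * (C * A)) := by rw [← hsr]; ring
      _ ≤ RR b ^ 7 * (3 ^ 6 * (C * A)) := by
          gcongr
          · omega
          · norm_num
  · have hy1 := near y hy hd
    rw [ite 6 x hx1, ite 6 y hy1, fin]
    have h1 := iter_pull_sub hu1 T.symm si (fun z => (hTs z).le) (fun w => v (T (R3 w))) 6 hx1 hy1
    have h2 := (hU 6 le_rfl).2 _ hx1 _ hy1
    have e : ‖T.symm x - T.symm y‖ = s⁻¹ * ‖x - y‖ := by rw [← map_sub, hTs]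
    rw [e, Real.mul_rpow si (norm_nonneg _)] at h2
    calc _ ≤ rx x ^ (6 + α) * (s⁻¹ ^ 6 * (3 ^ 6 * (C * A * (s⁻¹ ^ α * ‖x - y‖ ^ α)))) := by gcongr; exact h1.trans (by gcongr)
      _ = (rx x * s⁻¹) ^ 6 * (rx x * s⁻¹) ^ α * (3 ^ 6 * (C * A)) * ‖x - y‖ ^ α := by
          rw [Real.mul_rpow hx.le si, Real.rpow_add hx, show (6:ℝ) = ((6:ℕ):ℝ) by norm_num, Real.rpow_natCast]; ring
      _ ≤ RR b ^ 6 * RR b ^ (1:ℝ) * (3 ^ 6 * (C * A)) * ‖x - y‖ ^ α := by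
          rw [hsr]; gcongr
      _ = RR b ^ 7 * (3 ^ 6 * (C * A)) * ‖x - y‖ ^ α := by rw [Real.rpow_one]; ring


lemma WW_far {δ r m : ℝ} (hδ1 : δ < 1) (hm : 0 < m) (hr : m ≤ r) : m ^ 6 * WW δ r ≤ r ^ 6 * WW δ m := by
  have hr0 : 0 < r := by linarith
  have hW := WW_one δ m
  unfold WW
  rw [mul_max_of_nonneg _ _ (by positivity)]
  refine max_le ?_ ?_
  · exact mul_le_mul (by gcongr) hW (by norm_num) (by positivity)
  · calc m ^ 6 * r ^ δ = m ^ δ * m ^ (6 - δ) * r ^ δ := by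
          rw [← Real.rpow_add hm, ← Real.rpow_natCast]; congr 2; push_cast; ring
      _ ≤ m ^ δ * r ^ (6 - δ) * r ^ δ := by
          gcongr; linarith
      _ = r ^ 6 * m ^ δ := by
          rw [mul_assoc, ← Real.rpow_add hr0, ← Real.rpow_natCast r 6, mul_comm]; congr 2; push_cast; ring
      _ ≤ _ := by gcongr; exact le_max_right _ _

lemma main_pos {b α δ δ₀ : ℝ} (hb : 0 < b) (hα0 : 0 < α) (hα1 : α < 1)
    (hδ0 : 0 < δ) (hδ1 : δ < 1) (hδ₀0 : 0 < δ₀) (hδ₀1 : δ₀ < 1) :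
    ∃ K : ℝ, 0 < K ∧ ∀ L : ℝ, 4 ≤ L → ∀ f v : V3 → ℝ, ∀ M : ℝ, 0 < M →
      ContDiffOn ℝ (4:ℕ) f (SQ b) → wnormLE (SQ b) 4 α (1 - δ) (2 - δ₀) (wedgeQL b L) f M →
      IsCutoffSolution b L f v → (∃ B, ∀ x ∈ wedgeQL b L, |v x| ≤ B) →
      ContDiffOn ℝ 6 v (SL b (L / 2)) ∧ wnormLE (SL b L) 6 α 0 (-δ₀) (wedgeQL b (L / 2)) v (K * M) := by
  obtain ⟨K, hK, hloc⟩ := local_est hb hα0 hα1 hδ0 hδ1 hδ₀0 hδ₀1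
  have hR := RR_ge hb
  have hRp : 1 ≤ RR b := by linarith
  refine ⟨2 * RR b * K, by positivity, ?_⟩
  intro L hL f v M hM hf hn hv hB
  have hL0 : 0 < L := by linarith
  have hL20 : 0 < L / 2 := by linarith
  have loc := hloc L hL f v M hM hf hn hv hB
  have sub : ∀ x ∈ SL b (L / 2), x ∈ SL b L ∧ rx x ≤ L / 2 := fun x hx => by
    obtain ⟨h1, h2, h3⟩ := (mem_SL hL20).1 hx
    exact ⟨(mem_SL hL0).2 ⟨h1, by linarith, h3⟩, h2⟩
  have hle : K * M ≤ 2 * RR b * K * M := by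
    have := mul_pos hK hM
    nlinarith
  have hol : ∀ x ∈ SL b (L / 2), ∀ y ∈ SL b (L / 2), rx x ≤ rx y →
      rx x ^ (6 + α) * ‖iteratedFDerivWithin ℝ 6 v (SL b L) x - iteratedFDerivWithin ℝ 6 v (SL b L) y‖
        ≤ 2 * RR b * K * M * WW δ₀ (rx x) * ‖x - y‖ ^ α := by
    intro x hx y hy hxy
    have hW := WW_one δ₀ (rx x)
    have hW0 : 0 < WW δ₀ (rx x) := by linarith
    have hr : 0 < rx x := ((mem_SL hL20).1 hx).2.2
    have hry : 0 < rx y := ((mem_SL hL20).1 hy).2.2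
    obtain ⟨-, bx, hx2⟩ := loc x (sub x hx).1 (sub x hx).2
    obtain ⟨-, bY, -⟩ := loc y (sub y hy).1 (sub y hy).2
    by_cases hd : ‖x - y‖ < rx x / RR b
    · refine (hx2 y (sub y hy).1 hd).trans ?_
      gcongr
    · push Not at hd
      have h1 := bx 6 le_rfl
      have h2 := bY 6 le_rfl
      have h3 := WW_far hδ₀1 hr hxy
      have h4 : rx x ^ 6 * ‖iteratedFDerivWithin ℝ 6 v (SL b L) y‖ ≤ K * M * WW δ₀ (rx x) := by
        have : rx y ^ 6 * (rx x ^ 6 * ‖iteratedFDerivWithin ℝ 6 v (SL b L) y‖) ≤ rx y ^ 6 * (K * M * WW δ₀ (rx x)) := by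
          calc _ = rx x ^ 6 * (rx y ^ 6 * ‖iteratedFDerivWithin ℝ 6 v (SL b L) y‖) := by ring
            _ ≤ rx x ^ 6 * (K * M * WW δ₀ (rx y)) := by gcongr
            _ = K * M * (rx x ^ 6 * WW δ₀ (rx y)) := by ring
            _ ≤ K * M * (rx y ^ 6 * WW δ₀ (rx x)) := by gcongr
            _ = _ := by ring
        exact le_of_mul_le_mul_left this (by positivity)
      have h5 : rx x ^ α ≤ RR b * ‖x - y‖ ^ α := by
        rw [div_le_iff₀ (by linarith)] at hd
        calc rx x ^ α ≤ (‖x - y‖ * RR b) ^ α := by gcongr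
          _ = ‖x - y‖ ^ α * RR b ^ α := Real.mul_rpow (norm_nonneg _) (by linarith)
          _ ≤ ‖x - y‖ ^ α * RR b ^ (1:ℝ) := by gcongr
          _ = _ := by rw [Real.rpow_one, mul_comm]
      have h6 := norm_sub_le (iteratedFDerivWithin ℝ 6 v (SL b L) x) (iteratedFDerivWithin ℝ 6 v (SL b L) y)
      calc _ = rx x ^ α * (rx x ^ 6 * ‖iteratedFDerivWithin ℝ 6 v (SL b L) x - iteratedFDerivWithin ℝ 6 v (SL b L) y‖) := by
            rw [Real.rpow_add hr, show (6:ℝ) = ((6:ℕ):ℝ) by norm_num, Real.rpow_natCast]; ring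
        _ ≤ rx x ^ α * (rx x ^ 6 * (‖iteratedFDerivWithin ℝ 6 v (SL b L) x‖ + ‖iteratedFDerivWithin ℝ 6 v (SL b L) y‖)) := by gcongr
        _ ≤ rx x ^ α * (2 * (K * M * WW δ₀ (rx x))) := mul_le_mul_of_nonneg_left (by rw [mul_add]; linarith) (by positivity)
        _ ≤ RR b * ‖x - y‖ ^ α * (2 * (K * M * WW δ₀ (rx x))) := by gcongr
        _ = _ := by ring
  have hol2 : ∀ x ∈ SL b (L / 2), ∀ y ∈ SL b (L / 2),
      min (rx x) (rx y) ^ (6 + α) * ‖iteratedFDerivWithin ℝ 6 v (SL b L) x - iteratedFDerivWithin ℝ 6 v (SL b L) y‖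
        ≤ 2 * RR b * K * M * WW δ₀ (min (rx x) (rx y)) * ‖x - y‖ ^ α := by
    intro x hx y hy
    rcases le_total (rx x) (rx y) with h | h
    · rw [min_eq_left h]; exact hol x hx y hy h
    · rw [min_eq_right h, norm_sub_rev, norm_sub_rev x y]; exact hol y hy x hx h
  have W1 : ∀ r : ℝ, 0 < r → r < 1 → WW δ₀ r = 1 := fun r h0 h1 =>
    max_eq_left (Real.rpow_le_one h0.le h1.le hδ₀0.le)
  have W2 : ∀ r : ℝ, 1 < r → WW δ₀ r = r ^ δ₀ := fun r h1 =>
    max_eq_right (Real.one_le_rpow h1.le hδ₀0.le)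
  refine ⟨fun x hx => ?_, ⟨?_, ?_⟩, ?_, ?_⟩
  · have h1 := (loc x (sub x hx).1 (sub x hx).2).1
    exact (by exact_mod_cast h1.mono fun y hy => (sub y hy).1)
  · intro j hj x hx h0 h1
    have hx := QL_subset_SL hx
    have := (loc x (sub x hx).1 (sub x hx).2).2.1 j hj
    rw [W1 _ h0 h1, mul_one] at this
    rw [max_eq_left (by positivity), zero_add, Real.rpow_natCast]
    exact this.trans hle
  · intro j hj x hx h1
    have hx := QL_subset_SL hx
    have h0 : 0 < rx x := by linarith
    have := (loc x (sub x hx).1 (sub x hx).2).2.1 j hj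
    rw [W2 _ h1] at this
    rw [Real.rpow_add h0, Real.rpow_neg h0.le, Real.rpow_natCast, mul_assoc, inv_mul_le_iff₀ (by positivity)]
    refine this.trans ?_
    rw [mul_comm]
    gcongr
  · intro x hx y hy h0 h1
    have := hol2 x (QL_subset_SL hx) y (QL_subset_SL hy)
    rw [W1 _ h0 h1, mul_one] at this
    rw [max_eq_left (by positivity), zero_add]
    exact_mod_cast this
  · intro x hx y hy h1
    have h0 : 0 < min (rx x) (rx y) := by linarith
    have := hol2 x (QL_subset_SL hx) y (QL_subset_SL hy)
    rw [W2 _ h1] at this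
    rw [show -δ₀ + ((6:ℕ):ℝ) + α = -δ₀ + (6 + α) by push_cast; ring, Real.rpow_add h0, Real.rpow_neg h0.le, mul_assoc, inv_mul_le_iff₀ (by positivity)]
    refine this.trans (le_of_eq ?_)
    ring

lemma wnormLE_mono {S D D' : Set V3} {m : ℕ} {α k l M M' : ℝ} {u : V3 → ℝ} (h : wnormLE S m α k l D u M) (hD : D' ⊆ D) (hM : M ≤ M') :
    wnormLE S m α k l D' u M' := by
  obtain ⟨⟨h1, h2⟩, h3, h4⟩ := h
  refine ⟨⟨fun j hj x hx a b => (h1 j hj x (hD hx) a b).trans hM, fun j hj x hx a => (h2 j hj x (hD hx) a).trans hM⟩,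
    fun x hx y hy a b => (h3 x (hD hx) y (hD hy) a b).trans (by gcongr), fun x hx y hy a => (h4 x (hD hx) y (hD hy) a).trans (by gcongr)⟩

lemma le_lim {q C M p : ℝ} (h : ∀ η : ℝ, 0 < η → q ≤ C * (M + η) * p) : q ≤ C * M * p := by
  have c : Tendsto (fun η : ℝ => C * (M + η) * p) (𝓝[>] 0) (𝓝 (C * (M + 0) * p)) :=
    ((by fun_prop : Continuous fun η : ℝ => C * (M + η) * p).tendsto 0).mono_left nhdsWithin_le_nhds
  rw [add_zero] at c
  exact ge_of_tendsto c (by filter_upwards [self_mem_nhdsWithin] with η hη using h η hη)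

lemma wnormLE_lim {S D : Set V3} {m : ℕ} {α k l C M : ℝ} {u : V3 → ℝ} (h : ∀ η : ℝ, 0 < η → wnormLE S m α k l D u (C * (M + η))) :
    wnormLE S m α k l D u (C * M) := by
  refine ⟨⟨fun j hj x hx a b => ?_, fun j hj x hx a => ?_⟩, fun x hx y hy a b => ?_, fun x hx y hy a => ?_⟩
  · have := le_lim (p := 1) (fun η hη => by rw [mul_one]; exact (h η hη).1.1 j hj x hx a b)
    rwa [mul_one] at this
  · have := le_lim (p := 1) (fun η hη => by rw [mul_one]; exact (h η hη).1.2 j hj x hx a)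
    rwa [mul_one] at this
  · exact le_lim (fun η hη => (h η hη).2.1 x hx y hy a b)
  · exact le_lim (fun η hη => (h η hη).2.2 x hx y hy a)

theorem stmt13 (b₀ α δ δ₀ : ℝ) (hb₀ : 0 < b₀) (hα0 : 0 < α) (hα1 : α < 1)
    (hδ0 : 0 < δ) (hδ1 : δ < 1) (hδ₀0 : 0 < δ₀) (hδ₀1 : δ₀ < 1) :
    ∃ C : ℝ, 0 < C ∧
      ∀ L : ℝ, 4 ≤ L → ∀ f : V3 → ℝ,
        memH (SQ b₀) 4 α (1 - δ) (2 - δ₀) (wedgeQ b₀) f →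
        Per2On (closure (wedgeQ b₀)) f →
        ∀ v : V3 → ℝ, IsCutoffSolution b₀ L f v →
          (∃ M, wsupLE (SL b₀ L) 0 (-1 - δ) (-δ₀) (wedgeQL b₀ L) v M) →
          ContDiffOn ℝ 6 v (SL b₀ (L / 2)) ∧
          ∀ M : ℝ, 0 ≤ M →
            wnormLE (SQ b₀) 4 α (1 - δ) (2 - δ₀) (wedgeQL b₀ L) f M →
            wnormLE (SL b₀ L) 6 α 0 (-δ₀) (wedgeQL b₀ (L / 2)) v (C * M) := by
  obtain ⟨C, hC, key⟩ := main_pos hb₀ hα0 hα1 hδ0 hδ1 hδ₀0 hδ₀1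
  refine ⟨C, hC, fun L hL f hf _ v hv ⟨B, hB⟩ => ?_⟩
  have hL0 : 0 < L := by linarith
  obtain ⟨hfc, M₀, hM₀, hfn⟩ := hf
  have hfc : ContDiffOn ℝ (4:ℕ) f (SQ b₀) := by exact_mod_cast hfc
  have hbd := v_bdd hL0 hδ0 hδ₀0 hv.1.continuousOn hB
  refine ⟨(key L hL f v (M₀ + 1) (by linarith) hfc (wnormLE_mono hfn (fun x hx => hx.1) (by linarith)) hv hbd).1, fun M hM hn => ?_⟩
  exact wnormLE_lim fun η hη => (key L hL f v (M + η) (by linarith) hfc (wnormLE_mono hn subset_rfl (by linarith)) hv hbd).2
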